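/- Let F be a field of characteristic 2, let φ be an anisotropic quadratic form over F of dimension 5 and type (1,3) that is not a Pfister neighbour, and let ψ be an anisotropic totally singular quadratic form over F which is either of type (0,3), or of type (0,4) with norm degree ndeg_F(ψ) = 8. Then φ_{F(ψ)} is isotropic if and only if there exist a quadratic form φ' over F of type (1,3) and a form π ∈ GP₃F such that φ is Witt equivalent to φ' ⊥ π, ψ ≺_w φ', and ψ ≺_w π. -/

import Mathlib

open QuadraticMap MvPolynomial
open scoped TensorProduct

set_option synthInstance.maxHeartbeats 1000000
set_option maxHeartbeats 1000000


section Defs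

variable {K : Type} [CommRing K]

/-- The binary quadratic form `[a,b] : (x,y) ↦ a·x² + x·y + b·y²`. -/
noncomputable def binQF (a b : K) : QuadraticForm K (Fin 2 → K) :=
  (Matrix.of ![![a, 1], ![0, b]]).toQuadraticMap'

/-- The diagonal (totally singular) quadratic form `⟨c₁, …, c_s⟩`. -/
noncomputable def diagQF {s : ℕ} (c : Fin s → K) : QuadraticForm K (Fin s → K) :=
  QuadraticMap.weightedSumSquares K c

/-- The orthogonal sum `[a₁,b₁] ⊥ ⋯ ⊥ [a_r,b_r]` of binary forms. -/
noncomputable def binsQF {r : ℕ} (a b : Fin r → K) : QuadraticForm K (Fin r → Fin 2 → K) :=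
  QuadraticMap.pi fun i => binQF (a i) (b i)

/-- The orthogonal sum of `m` hyperbolic planes `[0,0]`. -/
noncomputable def hypQF (K : Type) [CommRing K] (m : ℕ) :
    QuadraticForm K (Fin m → Fin 2 → K) :=
  binsQF (fun _ => 0) (fun _ => 0)

/-- The `(n+1)`-fold quadratic Pfister form `⟨⟨a₁,…,aₙ⟩⟩_b ⊗ [1,c]`, i.e. the orthogonal
sum over all subsets `S ⊆ {1,…,n}` of `(∏_{i∈S} aᵢ)·[1,c]`. -/
noncomputable def pfisterQF (n : ℕ) (a : Fin n → K) (c : K) :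
    QuadraticForm K (Finset (Fin n) → Fin 2 → K) :=
  QuadraticMap.pi fun S : Finset (Fin n) => (∏ i ∈ S, a i) • binQF 1 c

variable {V W : Type} [AddCommGroup V] [Module K V] [AddCommGroup W] [Module K W]

/-- `φ` has type `(r,s)`: it is isometric to `[a₁,b₁] ⊥ ⋯ ⊥ [a_r,b_r] ⊥ ⟨c₁,…,c_s⟩`. -/
def HasTypeRS (φ : QuadraticForm K V) (r s : ℕ) : Prop :=
  ∃ (a b : Fin r → K) (c : Fin s → K), φ.Equivalent ((binsQF a b).prod (diagQF c))

/-- `φ` is dominated by `ψ`. -/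
def Dominated (φ : QuadraticForm K V) (ψ : QuadraticForm K W) : Prop :=
  ∃ f : V →ₗ[K] W, Function.Injective f ∧ ∀ v, φ v = ψ (f v)

/-- `φ` is weakly dominated by `ψ`: `α·φ` is dominated by `ψ` for some unit `α`. -/
def WeaklyDominated (φ : QuadraticForm K V) (ψ : QuadraticForm K W) : Prop :=
  ∃ α : Kˣ, Dominated ((α : K) • φ) ψ

/-- Witt equivalence of quadratic forms. -/
def WittEquiv (Q₁ : QuadraticForm K V) (Q₂ : QuadraticForm K W) : Prop :=
  ∃ k l : ℕ, (Q₁.prod (hypQF K k)).Equivalent (Q₂.prod (hypQF K l))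

/-- `φ` is a Pfister neighbour: there is a quadratic Pfister form `π` with
`2·dim φ > dim π` and `φ ≺_w π`. -/
def IsPfisterNeighbour (φ : QuadraticForm K V) : Prop :=
  ∃ (n : ℕ) (a : Fin n → Kˣ) (c : K),
    2 * Module.finrank K V > 2 ^ (n + 1) ∧
      WeaklyDominated φ (pfisterQF n (fun i => (a i : K)) c)

/-- The Artin–Schreier set `℘(K) = {t² + t : t ∈ K}`. -/
def ArtinSchreier (K : Type) [CommRing K] : Set K := {x : K | ∃ t : K, x = t ^ 2 + t}

end Defs

section FunField

variable (F : Type) [Field F]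

/-- The coefficient matrix of a quadratic form on `Fin n → F` with respect to the
standard basis: diagonal entries `ψ(eᵢ)`, above-diagonal entries `b_ψ(eᵢ,eⱼ)`. -/
noncomputable def coeffMat {n : ℕ} (ψ : QuadraticForm F (Fin n → F)) :
    Matrix (Fin n) (Fin n) F :=
  Matrix.of fun i j =>
    if i = j then ψ (Pi.single i 1)
    else if i < j then polar ψ (Pi.single i 1) (Pi.single j 1) else 0

/-- The homogeneous degree 2 polynomial `P_ψ` associated to a quadratic form `ψ`. -/
noncomputable def qfPoly {n : ℕ} (ψ : QuadraticForm F (Fin n → F)) :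
    MvPolynomial (Fin n) F :=
  ∑ i : Fin n, ∑ j : Fin n, MvPolynomial.C (coeffMat F ψ i j) * (X i * X j)

/-- The affine coordinate ring `F[x₁,…,xₙ]/(P_ψ)` of the quadric `ψ = 0`. -/
def FunFieldRing {n : ℕ} (ψ : QuadraticForm F (Fin n → F)) : Type :=
  MvPolynomial (Fin n) F ⧸ Ideal.span {qfPoly F ψ}

noncomputable instance {n : ℕ} (ψ : QuadraticForm F (Fin n → F)) :
    CommRing (FunFieldRing F ψ) :=
  inferInstanceAs (CommRing (MvPolynomial (Fin n) F ⧸ Ideal.span {qfPoly F ψ}))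

noncomputable instance {n : ℕ} (ψ : QuadraticForm F (Fin n → F)) :
    Algebra F (FunFieldRing F ψ) :=
  inferInstanceAs (Algebra F (MvPolynomial (Fin n) F ⧸ Ideal.span {qfPoly F ψ}))

/-- The function field `F(ψ)` of the quadric `ψ = 0`. -/
def FunField {n : ℕ} (ψ : QuadraticForm F (Fin n → F)) : Type :=
  FractionRing (FunFieldRing F ψ)

noncomputable instance {n : ℕ} (ψ : QuadraticForm F (Fin n → F)) :
    CommRing (FunField F ψ) :=
  inferInstanceAs (CommRing (FractionRing (FunFieldRing F ψ)))

noncomputable instance {n : ℕ} (ψ : QuadraticForm F (Fin n → F)) :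
    Algebra (FunFieldRing F ψ) (FunField F ψ) :=
  inferInstanceAs (Algebra (FunFieldRing F ψ) (FractionRing (FunFieldRing F ψ)))

noncomputable instance {n : ℕ} (ψ : QuadraticForm F (Fin n → F)) :
    Algebra F (FunField F ψ) :=
  inferInstanceAs (Algebra F (FractionRing (FunFieldRing F ψ)))

/-- The canonical map `F → F(ψ)`. -/
noncomputable def funFieldMap {n : ℕ} (ψ : QuadraticForm F (Fin n → F)) :
    F →+* FunField F ψ :=
  algebraMap F (FunField F ψ)

/-- Scalar extension of a quadratic form on `Fin n → F` along a ring homomorphism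
`f : F → K`. -/
noncomputable def extendQF {K : Type} [CommRing K] (f : F →+* K) {n : ℕ}
    (φ : QuadraticForm F (Fin n → F)) : QuadraticForm K (Fin n → K) :=
  ((coeffMat F φ).map f).toQuadraticMap'

end FunField


section Quat

variable (K : Type) [CommRing K]

/-- Defining relations for the char-2 quaternion algebra `[a,b)`: generators `i,j` with
`i² + i = a`, `j² = b`, `j·i = i·j + j` (i.e. `j·i·j⁻¹ = i + 1`). -/
inductive QuatRel (a b : K) : FreeAlgebra K (Fin 2) → FreeAlgebra K (Fin 2) → Prop
  | i_sq : QuatRel a b (FreeAlgebra.ι K 0 * FreeAlgebra.ι K 0 + FreeAlgebra.ι K 0)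
      (algebraMap K _ a)
  | j_sq : QuatRel a b (FreeAlgebra.ι K 1 * FreeAlgebra.ι K 1) (algebraMap K _ b)
  | swap : QuatRel a b (FreeAlgebra.ι K 1 * FreeAlgebra.ι K 0)
      (FreeAlgebra.ι K 0 * FreeAlgebra.ι K 1 + FreeAlgebra.ι K 1)

/-- The quaternion algebra `[a,b)` over `K` (characteristic two convention). -/
def QuatAlg (a b : K) : Type := RingQuot (QuatRel K a b)

noncomputable instance (a b : K) : Ring (QuatAlg K a b) :=
  inferInstanceAs (Ring (RingQuot (QuatRel K a b)))
noncomputable instance (a b : K) : Algebra K (QuatAlg K a b) :=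
  inferInstanceAs (Algebra K (RingQuot (QuatRel K a b)))

/-- `[a,b)` is split over `K`: isomorphic to the `2×2` matrix algebra. -/
def QuatSplit (a b : K) : Prop :=
  Nonempty (QuatAlg K a b ≃ₐ[K] Matrix (Fin 2) (Fin 2) K)

end Quat

section Sqrt

variable (F : Type) [Field F]

/-- The field `F(√c₁,…,√c_s)` obtained by adjoining square roots of the `cᵢ`
(inside an algebraic closure of `F`). -/
noncomputable def sqrtExt {s : ℕ} (c : Fin s → F) :
    IntermediateField F (AlgebraicClosure F) :=
  IntermediateField.adjoin F
    {y : AlgebraicClosure F | ∃ i, y ^ 2 = algebraMap F (AlgebraicClosure F) (c i)}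

/-- The subfield `F² = {x² : x ∈ F}` of squares of a field of characteristic 2. -/
noncomputable def sqSubfield : Subfield F := Subfield.closure (Set.range fun x : F => x ^ 2)

set_option synthInstance.maxHeartbeats 1000000 in
/-- The norm degree `[F²(cᵢ·cⱼ) : F²]` of a diagonal form `⟨c₁,…,c_s⟩`. -/
noncomputable def normDegree {s : ℕ} (c : Fin s → F) : ℕ :=
  Module.finrank (sqSubfield F)
    (IntermediateField.adjoin (sqSubfield F)
      (Set.range fun p : Fin s × Fin s => c p.1 * c p.2))

end Sqrt

/-- A ring is a division algebra if it is nontrivial and every nonzero element is a unit. -/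
def IsDivisionAlgebra (T : Type) [Ring T] : Prop :=
  (0 : T) ≠ 1 ∧ ∀ x : T, x ≠ 0 → IsUnit x

set_option linter.unusedSectionVars false

section GForm

/-- The quadratic polynomial `[a,b] ⊥ ⟨d⟩` evaluated at a vector. -/
def gq {R ι : Type*} [CommRing R] [Fintype ι] (a b : R) (d : ι → R) (v : Fin 2 ⊕ ι → R) : R :=
  a * v (.inl 0) ^ 2 + v (.inl 0) * v (.inl 1) + b * v (.inl 1) ^ 2 + ∑ i, d i * v (.inr i) ^ 2

/-- Anisotropy of `[a,b] ⊥ ⟨d⟩`. -/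
def GAnis {R ι : Type*} [CommRing R] [Fintype ι] (a b : R) (d : ι → R) : Prop :=
  ∀ v : Fin 2 ⊕ ι → R, gq a b d v = 0 → v = 0

variable {ι : Type*} [Fintype ι]

theorem gq_mul {R : Type*} [CommRing R] (a b : R) (d : ι → R) (r : R) (v : Fin 2 ⊕ ι → R) :
    gq a b d (fun i => r * v i) = r ^ 2 * gq a b d v := by
  have : ∑ i, d i * (r * v (.inr i)) ^ 2 = r ^ 2 * ∑ i, d i * v (.inr i) ^ 2 := by
    rw [Finset.mul_sum]; exact Finset.sum_congr rfl fun i _ => by ring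
  simp only [gq, this]; ring

theorem map_gq {R S : Type*} [CommRing R] [CommRing S] (f : R →+* S) (a b : R) (d : ι → R)
    (v : Fin 2 ⊕ ι → R) :
    f (gq a b d v) = gq (f a) (f b) (fun i => f (d i)) (fun i => f (v i)) := by
  simp [gq]

theorem gq_add {R : Type*} [CommRing R] [CharP R 2] (a b : R) (d : ι → R)
    (v w : Fin 2 ⊕ ι → R) :
    gq a b d (fun i => v i + w i) = gq a b d v + gq a b d w +
      (v (.inl 0) * w (.inl 1) + v (.inl 1) * w (.inl 0)) := by
  have : ∑ i, d i * (v (.inr i) + w (.inr i)) ^ 2 =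
      ∑ i, d i * v (.inr i) ^ 2 + ∑ i, d i * w (.inr i) ^ 2 := by
    rw [← Finset.sum_add_distrib]
    exact Finset.sum_congr rfl fun i _ => by rw [CharTwo.add_sq]; ring
  simp only [gq]
  rw [this]
  simp only [CharTwo.add_sq]
  ring

theorem exists_eval_ne_zero {R κ : Type*} [CommRing R] [IsDomain R] (r : R)
    (v : κ → Polynomial R) (hv : v ≠ 0) :
    ∃ (k : ℕ) (w : κ → Polynomial R),
      (∀ i, v i = (Polynomial.X - Polynomial.C r) ^ k * w i) ∧ ∃ i, (w i).eval r ≠ 0 := by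
  obtain ⟨j, hj⟩ := Function.ne_iff.1 hv
  induction hn : (v j).natDegree using Nat.strong_induction_on generalizing v with
  | _ n ih =>
  by_cases h : ∃ i, (v i).eval r ≠ 0
  · exact ⟨0, v, by simp, h⟩
  · push Not at h
    choose w hw using fun i => Polynomial.dvd_iff_isRoot.2 (h i)
    have hwj : w j ≠ 0 := by
      intro h0; apply hj; rw [hw j, h0, mul_zero]; rfl
    have hd : (v j).natDegree = (w j).natDegree + 1 := by
      rw [hw j, Polynomial.natDegree_mul (Polynomial.X_sub_C_ne_zero r) hwj,
        Polynomial.natDegree_X_sub_C, add_comm]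
    obtain ⟨k, w', h1, h2⟩ := ih (w j).natDegree (by omega) w
      (fun h0 => hwj (congrFun h0 j)) hwj rfl
    exact ⟨k + 1, w', fun i => by rw [hw i, h1 i]; ring, h2⟩

theorem gq_eq_zero_of_mul {R : Type*} [CommRing R] [IsDomain R] {a b r : R} {d : ι → R}
    {v w : Fin 2 ⊕ ι → R} (hr : r ≠ 0) (hw : ∀ i, v i = r * w i) (hv : gq a b d v = 0) :
    gq a b d w = 0 := by
  have : v = fun i => r * w i := funext hw
  rw [this, gq_mul] at hv
  exact (mul_eq_zero.1 hv).resolve_left (pow_ne_zero 2 hr)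

/-- A nontrivial zero over `R[X]` specializes to a nontrivial zero over `R`. -/
theorem exists_zero_eval {R : Type*} [CommRing R] [IsDomain R] (r : R) {a b : Polynomial R}
    {d : ι → Polynomial R} (h : ¬ GAnis a b d) :
    ¬ GAnis (a.eval r) (b.eval r) (fun i => (d i).eval r) := by
  simp only [GAnis, not_forall] at h
  obtain ⟨v, hv, h0⟩ := h
  obtain ⟨k, w, hw, i, hi⟩ := exists_eval_ne_zero r v h0
  have hz := gq_eq_zero_of_mul (pow_ne_zero k (Polynomial.X_sub_C_ne_zero r)) hw hv
  intro H
  have := H (fun i => (w i).eval r) (by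
    have := map_gq (Polynomial.evalRingHom r) a b d w
    rw [hz] at this
    simpa using this.symm)
  exact hi (congrFun this i)

theorem GAnis.polynomial {R : Type*} [CommRing R] [IsDomain R] {a b : R} {d : ι → R}
    (h : GAnis a b d) :
    GAnis (Polynomial.C a) (Polynomial.C b) (fun i => Polynomial.C (d i)) := by
  by_contra H
  exact exists_zero_eval 0 H (by simpa using h)

theorem GAnis.of_injective {R S : Type*} [CommRing R] [CommRing S] {f : R →+* S}
    (hf : Function.Injective f) {a b : R} {d : ι → R}
    (h : GAnis (f a) (f b) (fun i => f (d i))) : GAnis a b d := by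
  intro v hv
  have := h (fun i => f (v i)) (by rw [← map_gq, hv, map_zero])
  funext i
  exact hf (by simpa using congrFun this i)

theorem GAnis.fraction {R : Type*} [CommRing R] (K : Type*) [CommRing K] [Algebra R K]
    [IsFractionRing R K] {a b : R} {d : ι → R} (h : GAnis a b d) :
    GAnis (algebraMap R K a) (algebraMap R K b) (fun i => algebraMap R K (d i)) := by
  intro v hv
  obtain ⟨s, hs⟩ := IsLocalization.exist_integer_multiples_of_finite (nonZeroDivisors R) v
  choose w hw using hs
  have hs0 : IsUnit (algebraMap R K (s : R)) := IsLocalization.map_units K s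
  have hw' : ∀ i, algebraMap R K (w i) = algebraMap R K s * v i := fun i => by
    rw [hw i, Algebra.smul_def]
  have h1 : w = 0 := h w (by
    apply IsFractionRing.injective R K
    rw [map_gq, map_zero]
    simp only [hw', gq_mul, hv, mul_zero])
  funext i
  have := hw' i
  rw [h1] at this
  exact (hs0.mul_right_eq_zero).1 (by simpa using this.symm)

section CasselsPfister

variable {E : Type*} [Field E] [CharP E 2] {a b : E} {d : ι → E}

local notation "gqC" => gq (Polynomial.C a) (Polynomial.C b) (fun i => Polynomial.C (d i))

theorem natDegree_gq_le {w : Fin 2 ⊕ ι → Polynomial E} {n : ℕ}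
    (h : ∀ i, (w i).natDegree ≤ n) : (gqC w).natDegree ≤ 2 * n := by
  have h1 : ∀ (e : E) i, (Polynomial.C e * w i ^ 2).natDegree ≤ 2 * n := fun e i =>
    (Polynomial.natDegree_C_mul_le _ _).trans
      (Polynomial.natDegree_pow_le.trans (Nat.mul_le_mul_left _ (h i)))
  have h2 : (w (.inl 0) * w (.inl 1)).natDegree ≤ 2 * n :=
    Polynomial.natDegree_mul_le.trans (by have := h (.inl 0); have := h (.inl 1); omega)
  exact Polynomial.natDegree_add_le_of_degree_le (Polynomial.natDegree_add_le_of_degree_le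
    (Polynomial.natDegree_add_le_of_degree_le (h1 _ _) h2) (h1 _ _))
    (Polynomial.natDegree_sum_le_of_forall_le _ _ fun i _ => h1 _ _)

theorem coeff_gq {w : Fin 2 ⊕ ι → Polynomial E} {n : ℕ}
    (h : ∀ i, (w i).natDegree ≤ n) :
    (gqC w).coeff (2 * n) = gq a b d (fun i => (w i).coeff n) := by
  have h1 : ∀ i, (w i ^ 2).coeff (2 * n) = (w i).coeff n ^ 2 := fun i =>
    Polynomial.coeff_pow_of_natDegree_le (h i)
  have h2 : (w (.inl 0) * w (.inl 1)).coeff (2 * n) = (w (.inl 0)).coeff n * (w (.inl 1)).coeff n := by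
    rw [two_mul]; exact Polynomial.coeff_mul_add_eq_of_natDegree_le (h _) (h _)
  simp [gq, h1, h2, Polynomial.finsetSum_coeff]

theorem natDegree_le_one_of_gq (ha : GAnis a b d) {w : Fin 2 ⊕ ι → Polynomial E}
    (h : (gqC w).natDegree ≤ 2) : ∀ i, (w i).natDegree ≤ 1 := by
  have key : ∀ n, (∀ i, (w i).natDegree ≤ n + 1) → ∀ i, (w i).natDegree ≤ 1 := by
    intro n
    induction n with
    | zero => exact fun h => h
    | succ n ih =>
      intro hn
      apply ih
      have h0 := ha _ ((coeff_gq hn).symm.trans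
        (Polynomial.coeff_eq_zero_of_natDegree_lt (by omega)))
      intro i
      have h1 := congrFun h0 i
      have h2 := hn i
      rcases Nat.lt_or_ge (w i).natDegree (n + 2) with h3 | h3
      · omega
      · have h4 : (w i).natDegree = n + 1 + 1 := by omega
        have : (w i).leadingCoeff = 0 := by rw [Polynomial.leadingCoeff, h4]; exact h1
        rw [Polynomial.leadingCoeff_eq_zero] at this
        rw [this] at h4; simp at h4
  refine key (∑ i, (w i).natDegree) fun i => ?_
  have := Finset.single_le_sum (f := fun i => (w i).natDegree) (fun _ _ => Nat.zero_le _)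
    (Finset.mem_univ i)
  omega

theorem cassels_pfister (ha : GAnis a b d) (f : Polynomial E) (v : Fin 2 ⊕ ι → Polynomial E)
    (r : Polynomial E) (hr : r ≠ 0) (h : gqC v = f * r ^ 2) : ∃ w, gqC w = f := by
  induction hn : r.natDegree using Nat.strong_induction_on generalizing v r with
  | _ n ih =>
  set w : Fin 2 ⊕ ι → Polynomial E := fun i => v i / r with hw
  set v' : Fin 2 ⊕ ι → Polynomial E := fun i => v i % r with hv'
  have hv : v = fun i => r * w i + v' i := funext fun i => (EuclideanDomain.div_add_mod _ _).symm
  by_cases h0 : v' = 0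
  · refine ⟨w, ?_⟩
    have : v = fun i => r * w i := by rw [hv]; funext i; simp [h0]
    rw [this, gq_mul, mul_comm] at h
    exact mul_right_cancel₀ (pow_ne_zero 2 hr) h
  set B : Polynomial E := w (.inl 0) * v' (.inl 1) + w (.inl 1) * v' (.inl 0) with hB
  set N : Polynomial E := f + gqC w with hN
  have two : (2 : Polynomial E) = 0 := CharTwo.two_eq_zero
  have e1 : r * (r * N + B) = gqC v' := by
    rw [hv, gq_add, gq_mul] at h
    rw [hN]
    linear_combination (-1 : Polynomial E) * h + (r ^ 2 * gqC w + r * B) * two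
  have hgv : gqC v' ≠ 0 := fun h' => h0 (ha.polynomial v' h')
  have hr' : r * N + B ≠ 0 := by
    intro h'; rw [h', mul_zero] at e1; exact hgv e1.symm
  have hdeg : (r * N + B).natDegree < n := by
    obtain ⟨i, hi⟩ := Function.ne_iff.1 h0
    have hlt : ∀ i, (v' i).natDegree ≤ n - 1 := fun i => by
      by_cases hz : v' i = 0
      · rw [hz]; simp
      · have := Polynomial.natDegree_lt_natDegree hz (Polynomial.degree_mod_lt (v i) hr)
        omega
    have h1 : 1 ≤ n := by
      have := Polynomial.natDegree_lt_natDegree hi (Polynomial.degree_mod_lt (v i) hr)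
      omega
    have h2 := natDegree_gq_le (a := a) (b := b) (d := d) hlt
    rw [← e1, Polynomial.natDegree_mul hr hr'] at h2
    omega
  refine ih _ hdeg (fun i => N * v i + B * w i) (r * N + B) hr' ?_ rfl
  have hBB : v (.inl 0) * w (.inl 1) + v (.inl 1) * w (.inl 0) = B := by
    rw [hv, hB]; linear_combination (r * w (.inl 0) * w (.inl 1)) * two
  rw [gq_add _ _ _ (fun i => N * v i) (fun i => B * w i), gq_mul, gq_mul, h]
  linear_combination N * B * hBB + B ^ 2 * hN + (B ^ 2 * gqC w - f * r * N * B) * two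

/-- Over a polynomial ring, an anisotropic `[a,b] ⊥ ⟨d⟩` representing `f₀ + f₂ X²` up to squares
does so by a linear vector, whose coefficients are orthogonal. -/
theorem GAnis.represents (ha : GAnis a b d) (f₀ f₂ : E) (v : Fin 2 ⊕ ι → Polynomial E)
    (r : Polynomial E) (hvr : v ≠ 0 ∨ r ≠ 0)
    (h : gqC v + (Polynomial.C f₀ + Polynomial.C f₂ * Polynomial.X ^ 2) * r ^ 2 = 0) :
    ∃ w₀ w₁ : Fin 2 ⊕ ι → E, gq a b d w₀ = f₀ ∧ gq a b d w₁ = f₂ ∧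
      w₀ (.inl 0) * w₁ (.inl 1) + w₀ (.inl 1) * w₁ (.inl 0) = 0 := by
  have hr : r ≠ 0 := by
    rintro rfl
    exact hvr.elim (fun hv => hv (ha.polynomial v (by simpa using h))) (fun h => h rfl)
  obtain ⟨w, hw⟩ := cassels_pfister ha _ v r hr (CharTwo.add_eq_zero.1 h)
  have hd : ∀ i, (w i).natDegree ≤ 1 := natDegree_le_one_of_gq ha (by
    rw [hw]; compute_degree)
  choose p q hpq using fun i => Polynomial.exists_eq_X_add_C_of_natDegree_le_one (hd i)
  have e : gqC w = Polynomial.C (gq a b d q) + Polynomial.C (gq a b d p) * Polynomial.X ^ 2 +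
      Polynomial.C (q (.inl 0) * p (.inl 1) + q (.inl 1) * p (.inl 0)) * Polynomial.X := by
    have h1 : w = fun i => (Polynomial.X * Polynomial.C (p i)) + Polynomial.C (q i) := by
      funext i; rw [hpq i]; ring
    rw [h1, gq_add, gq_mul, ← map_gq Polynomial.C, ← map_gq Polynomial.C]
    simp only [map_add, map_mul]
    ring
  rw [hw] at e
  have c0 := congrArg (Polynomial.coeff · 0) e
  have c1 := congrArg (Polynomial.coeff · 1) e
  have c2 := congrArg (Polynomial.coeff · 2) e
  simp [Polynomial.coeff_X, Polynomial.coeff_C] at c0 c1 c2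
  exact ⟨q, p, c0.symm, c2.symm, c1.symm⟩

end CasselsPfister
end GForm

section Presentations

variable {F : Type} [Field F] [CharP F 2]

/-- The diagonal form `⟨c⟩` is anisotropic, i.e. `c` is linearly independent over the squares. -/
def SqIndep {ι : Type*} [Fintype ι] (c : ι → F) : Prop :=
  ∀ r : ι → F, ∑ i, c i * r i ^ 2 = 0 → r = 0

theorem GAnis.sqIndep {ι : Type*} [Fintype ι] {a b : F} {c : ι → F} (h : GAnis a b c) :
    SqIndep c := by
  intro r hr
  have := h (Sum.elim 0 r) (by simpa [gq] using hr)
  funext i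
  exact congrFun this (.inr i)

variable {V : Type} [AddCommGroup V] [Module F V]

/-- `φ` is similar to `[a,b] ⊥ ⟨c⟩`. -/
def Presents (φ : QuadraticForm F V) (a b : F) (c : Fin 3 → F) : Prop :=
  ∃ κ : F, κ ≠ 0 ∧ ∃ T : (Fin 2 ⊕ Fin 3 → F) →ₗ[F] V, Function.Injective T ∧
    ∀ v, φ (T v) = κ * gq a b c v

/-- `ψ` is similar to `⟨g⟩`. -/
def DiagPresents {s : ℕ} (ψ : QuadraticForm F V) (g : Fin s → F) : Prop :=
  ∃ κ : F, κ ≠ 0 ∧ ∃ T : (Fin s → F) →ₗ[F] V, Function.Injective T ∧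
    ∀ v, ψ (T v) = κ * ∑ i, g i * v i ^ 2

theorem Presents.gAnis {φ : QuadraticForm F V} {a b : F} {c : Fin 3 → F} (h : Presents φ a b c)
    (hφ : φ.Anisotropic) : GAnis a b c := by
  obtain ⟨κ, -, T, hT, e⟩ := h
  intro v hv
  have := hφ (T v) (by rw [e, hv, mul_zero])
  exact hT (by rw [this, map_zero])

theorem DiagPresents.sqIndep {s : ℕ} {ψ : QuadraticForm F V} {g : Fin s → F}
    (h : DiagPresents ψ g) (hψ : ψ.Anisotropic) : SqIndep g := by
  obtain ⟨κ, -, T, hT, e⟩ := h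
  intro v hv
  have := hψ (T v) (by rw [e, hv, mul_zero])
  exact hT (by rw [this, map_zero])

theorem injective_of_gq {ι : Type*} [Fintype ι] {a b a' b' μ : F} {c c' : ι → F}
    (hc' : SqIndep c') (hμ : μ ≠ 0) (T : (Fin 2 ⊕ ι → F) →ₗ[F] (Fin 2 ⊕ ι → F))
    (hT : ∀ v, gq a b c (T v) = μ * gq a' b' c' v) : Function.Injective T := by
  classical
  rw [injective_iff_map_eq_zero]
  intro v hv
  have key : ∀ w : Fin 2 ⊕ ι → F, v (.inl 0) * w (.inl 1) + v (.inl 1) * w (.inl 0) + gq a' b' c' v = 0 := by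
    intro w
    have h1 := hT (v + w)
    rw [map_add, hv, zero_add, hT w] at h1
    have h2 := gq_add a' b' c' v w
    change gq a' b' c' (v + w) = _ at h2
    have h3 := mul_left_cancel₀ hμ h1
    linear_combination -h2 - h3
  have h0 : gq a' b' c' v = 0 := by simpa using key 0
  have h1 : v (.inl 0) = 0 := by simpa [h0] using key (Pi.single (.inl 1) 1)
  have h2 : v (.inl 1) = 0 := by simpa [h0] using key (Pi.single (.inl 0) 1)
  have h3 := hc' (fun i => v (.inr i)) (by simpa [gq, h1, h2] using h0)
  funext i
  rcases i with i | i
  · fin_cases i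
    · exact h1
    · exact h2
  · exact congrFun h3 i

theorem Presents.of_map {φ : QuadraticForm F V} {a b a' b' μ : F} {c c' : Fin 3 → F}
    (h : Presents φ a b c) (hc' : SqIndep c') (hμ : μ ≠ 0)
    (T : (Fin 2 ⊕ Fin 3 → F) →ₗ[F] (Fin 2 ⊕ Fin 3 → F))
    (hT : ∀ v, gq a b c (T v) = μ * gq a' b' c' v) : Presents φ a' b' c' := by
  obtain ⟨κ, hκ, S, hS, e⟩ := h
  exact ⟨κ * μ, mul_ne_zero hκ hμ, S ∘ₗ T, hS.comp (injective_of_gq hc' hμ T hT), fun v => by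
    simp [e, hT, mul_assoc]⟩

theorem Presents.twist {φ : QuadraticForm F V} {a b : F} {c : Fin 3 → F}
    (h : Presents φ a b c) (hφ : φ.Anisotropic) {η₀ η₁ : F} (hη : η₀ ≠ 0 ∨ η₁ ≠ 0)
    (r : Fin 3 → F) :
    ∃ b', Presents φ (a * η₀ ^ 2 + η₀ * η₁ + b * η₁ ^ 2 + ∑ i, c i * r i ^ 2) b' c := by
  obtain ⟨ζ₀, ζ₁, hζ⟩ : ∃ ζ₀ ζ₁, η₀ * ζ₁ + η₁ * ζ₀ = 1 := by
    rcases hη with h | h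
    · exact ⟨0, η₀⁻¹, by field_simp; ring⟩
    · exact ⟨η₁⁻¹, 0, by field_simp; ring⟩
  have two : (2 : F) = 0 := CharTwo.two_eq_zero
  refine ⟨a * ζ₀ ^ 2 + ζ₀ * ζ₁ + b * ζ₁ ^ 2, h.of_map (h.gAnis hφ).sqIndep one_ne_zero
    { toFun := fun v => Sum.elim ![v (.inl 0) * η₀ + v (.inl 1) * ζ₀,
        v (.inl 0) * η₁ + v (.inl 1) * ζ₁] (fun i => v (.inr i) + v (.inl 0) * r i)
      map_add' := fun v w => by
        funext i
        rcases i with i | i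
        · fin_cases i <;> simp <;> ring
        · simp; ring
      map_smul' := fun t v => by
        funext i
        rcases i with i | i
        · fin_cases i <;> simp <;> ring
        · simp; ring } fun v => ?_⟩
  have : ∑ i, c i * (v (.inr i) + v (.inl 0) * r i) ^ 2 =
      ∑ i, c i * v (.inr i) ^ 2 + v (.inl 0) ^ 2 * ∑ i, c i * r i ^ 2 := by
    rw [Finset.mul_sum, ← Finset.sum_add_distrib]
    exact Finset.sum_congr rfl fun i _ => by rw [CharTwo.add_sq]; ring
  simp only [gq, LinearMap.coe_mk, AddHom.coe_mk, Sum.elim_inl, Sum.elim_inr,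
    Matrix.cons_val_zero, Matrix.cons_val_one, this]
  linear_combination (v (.inl 0) * v (.inl 1)) * hζ + (v (.inl 0) * v (.inl 1)) *
    (a * η₀ * ζ₀ + b * η₁ * ζ₁) * two

theorem Presents.basis {φ : QuadraticForm F V} {a b : F} {c c' : Fin 3 → F}
    (h : Presents φ a b c) (hc' : SqIndep c') (m : Fin 3 → Fin 3 → F)
    (hm : ∀ i, c' i = ∑ j, m i j ^ 2 * c j) : Presents φ a b c' := by
  refine h.of_map hc' one_ne_zero
    { toFun := fun v => Sum.elim (fun i => v (.inl i)) (fun j => ∑ i, m i j * v (.inr i))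
      map_add' := fun v w => by
        funext i
        rcases i with i | i
        · simp
        · simp [mul_add, Finset.sum_add_distrib]
      map_smul' := fun t v => by
        funext i
        rcases i with i | i
        · simp
        · simp [Finset.mul_sum, mul_left_comm] } fun v => ?_
  simp only [gq, LinearMap.coe_mk, AddHom.coe_mk, Sum.elim_inl, Sum.elim_inr, one_mul, hm,
    Fin.sum_univ_three, CharTwo.add_sq]
  ring

theorem SqIndep.scale {ι : Type*} [Fintype ι] {c : ι → F} (h : SqIndep c) {μ : F} (hμ : μ ≠ 0) :
    SqIndep (fun i => μ * c i) := fun r hr => h r (by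
  have : ∑ i, μ * c i * r i ^ 2 = μ * ∑ i, c i * r i ^ 2 := by
    rw [Finset.mul_sum]; exact Finset.sum_congr rfl fun i _ => by ring
  exact (mul_eq_zero.1 (this ▸ hr)).resolve_left hμ)

theorem Presents.scale {φ : QuadraticForm F V} {a b : F} {c : Fin 3 → F}
    (h : Presents φ a b c) (hφ : φ.Anisotropic) {μ : F} (hμ : μ ≠ 0) :
    Presents φ (μ * a) (b / μ) (fun i => μ * c i) := by
  refine h.of_map ((h.gAnis hφ).sqIndep.scale hμ) hμ
    { toFun := fun v => Sum.elim ![μ * v (.inl 0), v (.inl 1)] (fun j => μ * v (.inr j))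
      map_add' := fun v w => by
        funext i
        rcases i with i | i
        · fin_cases i <;> simp <;> ring
        · simp; ring
      map_smul' := fun t v => by
        funext i
        rcases i with i | i
        · fin_cases i <;> simp <;> ring
        · simp; ring } fun v => ?_
  simp only [gq, LinearMap.coe_mk, AddHom.coe_mk, Sum.elim_inl, Sum.elim_inr,
    Matrix.cons_val_zero, Matrix.cons_val_one, Fin.sum_univ_three]
  field_simp

theorem DiagPresents.basis {s : ℕ} {ψ : QuadraticForm F V} {g g' : Fin s → F}
    (h : DiagPresents ψ g) (hg' : SqIndep g') (m : Fin s → Fin s → F)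
    (hm : ∀ i, g' i = ∑ j, m i j ^ 2 * g j) : DiagPresents ψ g' := by
  obtain ⟨κ, hκ, S, hS, e⟩ := h
  have key : ∀ v : Fin s → F, ∑ j, g j * (∑ i, m i j * v i) ^ 2 = ∑ i, g' i * v i ^ 2 := by
    intro v
    simp only [hm, Finset.sum_mul, CharTwo.sum_sq, Finset.mul_sum]
    rw [Finset.sum_comm]
    exact Finset.sum_congr rfl fun i _ => Finset.sum_congr rfl fun j _ => by ring
  let T : (Fin s → F) →ₗ[F] (Fin s → F) :=
    { toFun := fun v j => ∑ i, m i j * v i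
      map_add' := fun v w => by
        funext i
        simp [mul_add, Finset.sum_add_distrib]
      map_smul' := fun t v => by
        funext i
        simp [Finset.mul_sum, mul_left_comm] }
  have hT : Function.Injective T := by
    rw [injective_iff_map_eq_zero]
    intro v hv
    refine hg' v ?_
    rw [← key]
    refine Finset.sum_eq_zero fun j _ => ?_
    have : ∑ i, m i j * v i = 0 := congrFun hv j
    rw [this]; ring
  exact ⟨κ, hκ, S ∘ₗ T, hS.comp hT, fun v => by
    rw [LinearMap.comp_apply, e, ← key]; rfl⟩

theorem DiagPresents.scale {s : ℕ} {ψ : QuadraticForm F V} {g : Fin s → F}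
    (h : DiagPresents ψ g) {μ : F} (hμ : μ ≠ 0) : DiagPresents ψ (fun i => μ * g i) := by
  obtain ⟨κ, hκ, S, hS, e⟩ := h
  refine ⟨κ / μ, div_ne_zero hκ hμ, S, hS, fun v => ?_⟩
  have : ∑ i, μ * g i * v i ^ 2 = μ * ∑ i, g i * v i ^ 2 := by
    rw [Finset.mul_sum]; exact Finset.sum_congr rfl fun i _ => by ring
  rw [e, this]
  field_simp

end Presentations

section Evaluation

variable {K : Type} [CommRing K]

theorem binQF_apply (a b : K) (v : Fin 2 → K) :
    binQF a b v = a * v 0 ^ 2 + v 0 * v 1 + b * v 1 ^ 2 := by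
  simp [binQF, Matrix.toQuadraticMap', Matrix.toQuadraticForm', Matrix.toLinearMap₂'_apply',
    Matrix.mulVec, dotProduct, Fin.sum_univ_two]
  ring

theorem diagQF_apply {s : ℕ} (c v : Fin s → K) : diagQF c v = ∑ i, c i * v i ^ 2 := by
  simp [diagQF, QuadraticMap.weightedSumSquares_apply, _root_.sq]

theorem binsQF_apply {r : ℕ} (a b : Fin r → K) (v : Fin r → Fin 2 → K) :
    binsQF a b v = ∑ i, (a i * v i 0 ^ 2 + v i 0 * v i 1 + b i * v i 1 ^ 2) := by
  simp [binsQF, QuadraticMap.pi_apply, binQF_apply]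

theorem hypQF_apply (m : ℕ) (v : Fin m → Fin 2 → K) : hypQF K m v = ∑ i, v i 0 * v i 1 := by
  simp [hypQF, binsQF_apply]

/-- The vector of the fourfold sum indexed by the subsets of `Fin 2` with given components. -/
def subsetVec (x₀ x₁ x₂ x₃ : Fin 2 → K) : Finset (Fin 2) → Fin 2 → K := fun S =>
  if S = ∅ then x₀ else if S = {0} then x₁ else if S = {1} then x₂ else x₃

theorem univ_subsets : (Finset.univ : Finset (Finset (Fin 2))) = {∅, {0}, {1}, {0, 1}} := by
  decide

theorem pfisterQF_two_apply (p : Fin 2 → K) (d : K) (v : Finset (Fin 2) → Fin 2 → K) :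
    pfisterQF 2 p d v = (v ∅ 0 ^ 2 + v ∅ 0 * v ∅ 1 + d * v ∅ 1 ^ 2) +
      p 0 * (v {0} 0 ^ 2 + v {0} 0 * v {0} 1 + d * v {0} 1 ^ 2) +
      p 1 * (v {1} 0 ^ 2 + v {1} 0 * v {1} 1 + d * v {1} 1 ^ 2) +
      p 0 * p 1 * (v {0, 1} 0 ^ 2 + v {0, 1} 0 * v {0, 1} 1 + d * v {0, 1} 1 ^ 2) := by
  have h : ∀ f : Finset (Fin 2) → K,
      ∑ S, f S = f ∅ + f {0} + f {1} + f {0, 1} := by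
    intro f
    rw [univ_subsets, Finset.sum_insert (by decide), Finset.sum_insert (by decide),
      Finset.sum_insert (by decide), Finset.sum_singleton]
    ring
  rw [pfisterQF, QuadraticMap.pi_apply, h]
  simp [binQF_apply]

theorem pfisterQF_subsetVec (p : Fin 2 → K) (d : K) (x₀ x₁ x₂ x₃ : Fin 2 → K) :
    pfisterQF 2 p d (subsetVec x₀ x₁ x₂ x₃) = (x₀ 0 ^ 2 + x₀ 0 * x₀ 1 + d * x₀ 1 ^ 2) +
      p 0 * (x₁ 0 ^ 2 + x₁ 0 * x₁ 1 + d * x₁ 1 ^ 2) +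
      p 1 * (x₂ 0 ^ 2 + x₂ 0 * x₂ 1 + d * x₂ 1 ^ 2) +
      p 0 * p 1 * (x₃ 0 ^ 2 + x₃ 0 * x₃ 1 + d * x₃ 1 ^ 2) := by
  have h1 : ({0} : Finset (Fin 2)) ≠ ∅ := by decide
  have h2 : ({1} : Finset (Fin 2)) ≠ ∅ := by decide
  have h3 : ({0, 1} : Finset (Fin 2)) ≠ ∅ := by decide
  have h4 : ({1} : Finset (Fin 2)) ≠ {0} := by decide
  have h5 : ({0, 1} : Finset (Fin 2)) ≠ {0} := by decide
  have h6 : ({0, 1} : Finset (Fin 2)) ≠ {1} := by decide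
  simp only [pfisterQF_two_apply, subsetVec, if_pos, h1, h2, h3, h4, h5, h6, if_false]

theorem subsetVec_add (x₀ x₁ x₂ x₃ y₀ y₁ y₂ y₃ : Fin 2 → K) :
    subsetVec (x₀ + y₀) (x₁ + y₁) (x₂ + y₂) (x₃ + y₃) =
      subsetVec x₀ x₁ x₂ x₃ + subsetVec y₀ y₁ y₂ y₃ := by
  funext S; simp only [subsetVec, Pi.add_apply]; split_ifs <;> rfl

theorem subsetVec_smul (t : K) (x₀ x₁ x₂ x₃ : Fin 2 → K) :
    subsetVec (t • x₀) (t • x₁) (t • x₂) (t • x₃) = t • subsetVec x₀ x₁ x₂ x₃ := by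
  funext S; simp only [subsetVec, Pi.smul_apply]; split_ifs <;> rfl

theorem exists_subsetVec (v : Finset (Fin 2) → Fin 2 → K) :
    v = subsetVec (v ∅) (v {0}) (v {1}) (v {0, 1}) := by
  funext S
  have : S ∈ (Finset.univ : Finset (Finset (Fin 2))) := Finset.mem_univ S
  rw [univ_subsets] at this
  simp only [Finset.mem_insert, Finset.mem_singleton] at this
  rcases this with rfl | rfl | rfl | rfl <;> rfl

end Evaluation

section Bridge

variable {F : Type} [Field F] [CharP F 2]

/-- The field of all `α² + β² p + γ² e + δ² p e`. -/
def biq (p e : F) : Subfield F where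
  carrier := {x | ∃ α β γ δ : F, x = α ^ 2 + p * β ^ 2 + e * γ ^ 2 + p * e * δ ^ 2}
  mul_mem' := by
    rintro _ _ ⟨a, b, c, d, rfl⟩ ⟨a', b', c', d', rfl⟩
    refine ⟨a * a' + p * b * b' + e * c * c' + p * e * d * d',
      a * b' + b * a' + e * c * d' + e * d * c',
      a * c' + c * a' + p * b * d' + p * d * b', a * d' + d * a' + b * c' + c * b', ?_⟩
    simp only [CharTwo.add_sq]; ring
  one_mem' := ⟨1, 0, 0, 0, by ring⟩
  add_mem' := by
    rintro _ _ ⟨a, b, c, d, rfl⟩ ⟨a', b', c', d', rfl⟩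
    refine ⟨a + a', b + b', c + c', d + d', ?_⟩
    simp only [CharTwo.add_sq]; ring
  zero_mem' := ⟨0, 0, 0, 0, by ring⟩
  neg_mem' := by
    rintro _ ⟨a, b, c, d, rfl⟩
    exact ⟨a, b, c, d, CharTwo.neg_eq _⟩
  inv_mem' := by
    rintro x ⟨a, b, c, d, hx⟩
    by_cases h0 : x = 0
    · exact ⟨0, 0, 0, 0, by rw [h0]; simp⟩
    refine ⟨a / x, b / x, c / x, d / x, ?_⟩
    have : x⁻¹ = x / x ^ 2 := by field_simp
    rw [this]
    nth_rewrite 1 [hx]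
    field_simp

theorem sq_mem_biq (p e x : F) : x ^ 2 ∈ biq p e := ⟨x, 0, 0, 0, by ring⟩
theorem left_mem_biq (p e : F) : p ∈ biq p e := ⟨0, 1, 0, 0, by ring⟩
theorem right_mem_biq (p e : F) : e ∈ biq p e := ⟨0, 0, 1, 0, by ring⟩

theorem presents_of_hasTypeRS {φ : QuadraticForm F (Fin 5 → F)} (h : HasTypeRS φ 1 3) :
    ∃ a b c, Presents φ a b c := by
  obtain ⟨a, b, c, ⟨e⟩⟩ := h
  let T : (Fin 2 ⊕ Fin 3 → F) →ₗ[F] ((Fin 1 → Fin 2 → F) × (Fin 3 → F)) :=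
    { toFun := fun v => (fun _ i => v (.inl i), fun i => v (.inr i))
      map_add' := fun _ _ => rfl
      map_smul' := fun _ _ => rfl }
  refine ⟨a 0, b 0, c, 1, one_ne_zero, e.symm.toLinearEquiv.toLinearMap ∘ₗ T, ?_, fun v => ?_⟩
  · refine e.symm.toLinearEquiv.injective.comp fun v w h => ?_
    funext i
    rcases i with i | i
    · exact congrFun (congrFun (congrArg Prod.fst h) 0) i
    · exact congrFun (congrArg Prod.snd h) i
  · change φ (e.symm (T v)) = _
    rw [e.symm.map_app]
    simp [T, gq, QuadraticMap.prod_apply, binsQF_apply, diagQF_apply]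

theorem diagPresents_of_equivalent {V : Type} [AddCommGroup V] [Module F V] {s : ℕ}
    {ψ : QuadraticForm F V} {c : Fin s → F} (h : ψ.Equivalent (diagQF c)) :
    DiagPresents ψ c := by
  obtain ⟨e⟩ := h
  refine ⟨1, one_ne_zero, e.symm.toLinearEquiv.toLinearMap, e.symm.toLinearEquiv.injective,
    fun v => ?_⟩
  change ψ (e.symm v) = _
  rw [e.symm.map_app, diagQF_apply, one_mul]

theorem SqIndep.ne_zero {ι : Type*} [Fintype ι] {c : ι → F} (h : SqIndep c) (i : ι) :
    c i ≠ 0 := by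
  classical
  intro h0
  have := congrFun (h (Pi.single i 1) (Finset.sum_eq_zero fun j _ => by
    by_cases hj : j = i
    · subst hj; simp [h0]
    · simp [hj])) i
  simp at this

theorem Presents.normalize {V : Type} [AddCommGroup V] [Module F V] {φ : QuadraticForm F V}
    (hφ : φ.Anisotropic) {a b : F} {c : Fin 3 → F} (h : Presents φ a b c) :
    ∃ a b p e, Presents φ a b ![1, p, e] := by
  have h0 := (h.gAnis hφ).sqIndep.ne_zero 0
  have h1 := h.scale hφ (inv_ne_zero h0)
  refine ⟨(c 0)⁻¹ * a, b / (c 0)⁻¹, (c 0)⁻¹ * c 1, (c 0)⁻¹ * c 2, ?_⟩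
  convert h1 using 1
  funext i
  fin_cases i <;> simp [h0]

theorem Presents.exists_linearEquiv {φ : QuadraticForm F (Fin 5 → F)} {a b : F} {c : Fin 3 → F}
    (h : Presents φ a b c) : ∃ κ : F, κ ≠ 0 ∧ ∃ T : (Fin 2 ⊕ Fin 3 → F) ≃ₗ[F] (Fin 5 → F),
      ∀ v, φ (T v) = κ * gq a b c v := by
  obtain ⟨κ, hκ, T, hT, e⟩ := h
  exact ⟨κ, hκ, T.linearEquivOfInjective hT (by simp), e⟩

/-- If `φ` is similar to `[a,b] ⊥ ⟨1,p,e⟩` and not a Pfister neighbour, then `[a,b]` does not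
represent elements of the biquadratic field of `p` and `e`. -/
theorem Presents.not_mem_biq {φ : QuadraticForm F (Fin 5 → F)} (hφ : φ.Anisotropic)
    (hpn : ¬ IsPfisterNeighbour φ) {a b p e : F} (h : Presents φ a b ![1, p, e]) {η₀ η₁ : F}
    (hη : η₀ ≠ 0 ∨ η₁ ≠ 0) : a * η₀ ^ 2 + η₀ * η₁ + b * η₁ ^ 2 ∉ biq p e := by
  rintro ⟨α, β, γ, δ, hx⟩
  obtain ⟨b', h'⟩ := h.twist hφ hη ![α, β, γ]
  have two : (2 : F) = 0 := CharTwo.two_eq_zero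
  have ha : a * η₀ ^ 2 + η₀ * η₁ + b * η₁ ^ 2 + ∑ i, (![1, p, e] : Fin 3 → F) i *
      (![α, β, γ] : Fin 3 → F) i ^ 2 = p * e * δ ^ 2 := by
    rw [hx]
    simp only [Fin.sum_univ_three, Matrix.cons_val_zero, Matrix.cons_val_one, Matrix.cons_val]
    linear_combination (α ^ 2 + p * β ^ 2 + e * γ ^ 2) * two
  rw [ha] at h'
  have hδ : δ ≠ 0 := by
    rintro rfl
    have := congrFun (h'.gAnis hφ (Sum.elim ![1, 0] 0) (by simp [gq])) (.inl 0)
    simp at this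
  have hp : p ≠ 0 := (h.gAnis hφ).sqIndep.ne_zero 1
  have he : e ≠ 0 := (h.gAnis hφ).sqIndep.ne_zero 2
  apply hpn
  obtain ⟨κ, hκ, T, hT⟩ := h'.exists_linearEquiv
  refine ⟨2, ![Units.mk0 p hp, Units.mk0 e he], p * e * δ ^ 2 * b', by simp,
    Units.mk0 κ⁻¹ (inv_ne_zero hκ), ?_⟩
  let S : (Fin 2 ⊕ Fin 3 → F) →ₗ[F] (Finset (Fin 2) → Fin 2 → F) :=
    { toFun := fun v => subsetVec ![v (.inr 0), 0] ![v (.inr 1), 0] ![v (.inr 2), 0]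
        ![δ * v (.inl 0), v (.inl 1) / (p * e * δ)]
      map_add' := fun v w => by
        rw [← subsetVec_add]
        congr 1 <;> funext i <;> fin_cases i <;> simp <;> ring
      map_smul' := fun t v => by
        rw [RingHom.id_apply, ← subsetVec_smul]
        congr 1 <;> funext i <;> fin_cases i <;> simp <;> ring }
  have hS : ∀ v, pfisterQF 2 (fun i => (((![Units.mk0 p hp, Units.mk0 e he] :
      Fin 2 → Fˣ) i : Fˣ) : F)) (p * e * δ ^ 2 * b') (S v) =
      gq (p * e * δ ^ 2) b' ![1, p, e] v := by
    intro v
    simp only [S, LinearMap.coe_mk, AddHom.coe_mk, pfisterQF_subsetVec, gq, Fin.sum_univ_three,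
      Matrix.cons_val_zero, Matrix.cons_val_one, Matrix.cons_val, Units.val_mk0]
    field_simp
    ring
  refine ⟨S ∘ₗ T.symm.toLinearMap, ?_, fun v => ?_⟩
  · rw [injective_iff_map_eq_zero]
    intro v hv
    have := hS (T.symm v)
    rw [show S (T.symm v) = 0 from hv, map_zero] at this
    exact T.symm.map_eq_zero_iff.1 (h'.gAnis hφ _ this.symm)
  · rw [LinearMap.comp_apply, hS]
    have := hT (T.symm v)
    rw [LinearEquiv.apply_symm_apply] at this
    simp [this, hκ]

end Bridge

section Outputs

variable {F : Type} [Field F] [CharP F 2]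

/-- The decomposition condition characterizing isotropy over the function field. -/
def Decomposes {s : ℕ} (φ : QuadraticForm F (Fin 5 → F)) (ψ : QuadraticForm F (Fin s → F)) :
    Prop :=
  ∃ (φ' : QuadraticForm F (Fin 5 → F)) (γ : Fˣ) (p : Fin 2 → Fˣ) (cc : F),
    HasTypeRS φ' 1 3 ∧
    WittEquiv φ (φ'.prod ((γ : F) • pfisterQF 2 (fun i => (p i : F)) cc)) ∧
    WeaklyDominated ψ φ' ∧
    WeaklyDominated ψ ((γ : F) • pfisterQF 2 (fun i => (p i : F)) cc)

theorem DiagPresents.weaklyDominated {W : Type} [AddCommGroup W] [Module F W] {s : ℕ}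
    {ψ : QuadraticForm F (Fin s → F)} (hψ : ψ.Anisotropic) {g : Fin s → F}
    (h : DiagPresents ψ g) {Q : QuadraticForm F W} {μ : F} (hμ : μ ≠ 0)
    (S : (Fin s → F) →ₗ[F] W) (hS : ∀ v, Q (S v) = μ * ∑ i, g i * v i ^ 2) :
    WeaklyDominated ψ Q := by
  have hg := h.sqIndep hψ
  obtain ⟨κ, hκ, T, hT, e⟩ := h
  let T' := T.linearEquivOfInjective hT rfl
  have e' : ∀ v, ψ (T' v) = κ * ∑ i, g i * v i ^ 2 := e
  refine ⟨Units.mk0 (μ / κ) (div_ne_zero hμ hκ), S ∘ₗ T'.symm.toLinearMap, ?_, fun v => ?_⟩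
  · rw [injective_iff_map_eq_zero]
    intro v hv
    have := hS (T'.symm v)
    rw [show S (T'.symm v) = 0 from hv, map_zero] at this
    exact T'.symm.map_eq_zero_iff.1 (hg _ ((mul_eq_zero.1 this.symm).resolve_left hμ))
  · have := e' (T'.symm v)
    rw [LinearEquiv.apply_symm_apply] at this
    change _ = Q (S (T'.symm v))
    rw [hS, _root_.smul_apply, this, Units.val_mk0, smul_eq_mul]
    field_simp

theorem equivalent_of_injective {V W : Type} [AddCommGroup V] [Module F V] [AddCommGroup W]
    [Module F W] [FiniteDimensional F V] [FiniteDimensional F W] {Q : QuadraticForm F V}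
    {Q' : QuadraticForm F W} (T : V →ₗ[F] W) (hT : Function.Injective T)
    (hd : Module.finrank F V = Module.finrank F W) (h : ∀ v, Q' (T v) = Q v) :
    Q.Equivalent Q' :=
  ⟨{ T.linearEquivOfInjective hT hd with map_app' := h }⟩

theorem subsetVec_eq_zero {x₀ x₁ x₂ x₃ : Fin 2 → F} (h : subsetVec x₀ x₁ x₂ x₃ = 0) :
    x₀ = 0 ∧ x₁ = 0 ∧ x₂ = 0 ∧ x₃ = 0 :=
  ⟨congrFun h ∅, by simpa [subsetVec] using congrFun h {0},
    by simpa [subsetVec] using congrFun h {1},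
    by simpa [subsetVec, show ({0, 1} : Finset (Fin 2)) ≠ {0} by decide] using congrFun h {0, 1}⟩

/-- Linear maps into the space of a `3`-fold Pfister form, by components. -/
def subsetMap {V : Type} [AddCommGroup V] [Module F V] (f₀ f₁ f₂ f₃ : V →ₗ[F] (Fin 2 → F)) :
    V →ₗ[F] (Finset (Fin 2) → Fin 2 → F) where
  toFun v := subsetVec (f₀ v) (f₁ v) (f₂ v) (f₃ v)
  map_add' v w := by simp only [map_add, subsetVec_add]
  map_smul' t v := by simp only [map_smul, subsetVec_smul, RingHom.id_apply]

/-- A pair of linear functionals as a map to the plane. -/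
def pairMap {V : Type} [AddCommGroup V] [Module F V] (f g : V →ₗ[F] F) : V →ₗ[F] (Fin 2 → F) where
  toFun v := ![f v, g v]
  map_add' v w := by funext i; fin_cases i <;> simp
  map_smul' t v := by funext i; fin_cases i <;> simp

theorem decomposes_of_weaklyDominated {s : ℕ} {φ : QuadraticForm F (Fin 5 → F)}
    (hφ : HasTypeRS φ 1 3) {ψ : QuadraticForm F (Fin s → F)} (hψ : ψ.Anisotropic)
    {g : Fin s → F} (hg : DiagPresents ψ g) (hs : s = 3 ∨ s = 4) (hd : WeaklyDominated ψ φ) :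
    Decomposes φ ψ := by
  have two : (2 : F) = 0 := CharTwo.two_eq_zero
  refine ⟨φ, 1, ![1, 1], 0, hφ, ⟨4, 0, ?_⟩, hd, ?_⟩
  · let π (i : Fin 4) (j : Fin 2) : (Fin 4 → Fin 2 → F) →ₗ[F] F :=
      LinearMap.proj (φ := fun _ => F) j ∘ₗ LinearMap.proj (φ := fun _ => Fin 2 → F) i
    let S : (Fin 4 → Fin 2 → F) →ₗ[F] (Finset (Fin 2) → Fin 2 → F) :=
      subsetMap (pairMap (π 0 0) (π 0 0 + π 0 1)) (pairMap (π 1 0) (π 1 0 + π 1 1))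
        (pairMap (π 2 0) (π 2 0 + π 2 1)) (pairMap (π 3 0) (π 3 0 + π 3 1))
    let T : (Fin 5 → F) × (Fin 4 → Fin 2 → F) →ₗ[F]
        ((Fin 5 → F) × (Finset (Fin 2) → Fin 2 → F)) × (Fin 0 → Fin 2 → F) :=
      LinearMap.prod (LinearMap.prodMap LinearMap.id S) 0
    refine equivalent_of_injective T ?_ (by simp [Module.finrank_pi_fintype]) ?_
    · rw [injective_iff_map_eq_zero]
      rintro ⟨x, y⟩ h
      have h1 : x = 0 := congrArg (fun v => v.1.1) h
      have h2 : S y = 0 := congrArg (fun v => v.1.2) h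
      obtain ⟨a0, a1, a2, a3⟩ := subsetVec_eq_zero h2
      have h3 : y = 0 := by
        funext i j
        fin_cases i <;> [have a := a0; have a := a1; have a := a2; have a := a3] <;>
        · have b0 := congrFun a 0
          have b1 := congrFun a 1
          simp [pairMap, π] at b0 b1
          rw [b0, zero_add] at b1
          fin_cases j
          · exact b0
          · exact b1
      rw [h1, h3]; rfl
    · rintro ⟨x, y⟩
      simp only [T, QuadraticMap.prod_apply, LinearMap.prod_apply, hypQF_apply,
        _root_.smul_apply, S, subsetMap, LinearMap.coe_mk, AddHom.coe_mk, pairMap, π,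
        Fin.sum_univ_four]
      simp [pfisterQF_subsetVec]
      linear_combination (y 0 0 ^ 2 + y 1 0 ^ 2 + y 2 0 ^ 2 + y 3 0 ^ 2) * two
  · rcases hs with rfl | rfl
    · let π (i : Fin 3) : (Fin 3 → F) →ₗ[F] F := LinearMap.proj (φ := fun _ => F) i
      refine hg.weaklyDominated hψ one_ne_zero
        (subsetMap (pairMap (π 0) ((g 0 + 1) • π 0)) (pairMap (π 1) ((g 1 + 1) • π 1))
          (pairMap (π 2) ((g 2 + 1) • π 2)) 0) fun v => ?_
      simp [subsetMap, pfisterQF_subsetVec, pairMap, π, Fin.sum_univ_three]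
      linear_combination (v 0 ^ 2 + v 1 ^ 2 + v 2 ^ 2) * two
    · let π (i : Fin 4) : (Fin 4 → F) →ₗ[F] F := LinearMap.proj (φ := fun _ => F) i
      refine hg.weaklyDominated hψ one_ne_zero
        (subsetMap (pairMap (π 0) ((g 0 + 1) • π 0)) (pairMap (π 1) ((g 1 + 1) • π 1))
          (pairMap (π 2) ((g 2 + 1) • π 2)) (pairMap (π 3) ((g 3 + 1) • π 3))) fun v => ?_
      simp [subsetMap, pfisterQF_subsetVec, pairMap, π, Fin.sum_univ_four]
      linear_combination (v 0 ^ 2 + v 1 ^ 2 + v 2 ^ 2 + v 3 ^ 2) * two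

/-- The hyperbolic-plane bookkeeping behind
`xe[1,d] ⊥ ⟨1,p,e⟩ ∼ x[1,d] ⊥ ⟨1,p,e⟩ ⊥ ⟨⟨x,e,d]]`. -/
theorem exists_decomposition {φ : QuadraticForm F (Fin 5 → F)} {x e b p : F} (hx : x ≠ 0)
    (he : e ≠ 0) (h : Presents φ (x * e) b ![1, p, e]) :
    ∃ (κ : F) (hκ : κ ≠ 0) (φ' : QuadraticForm F (Fin 5 → F))
      (L : (Fin 5 → F) ≃ₗ[F] ((Fin 1 → Fin 2 → F) × (Fin 3 → F))),
      HasTypeRS φ' 1 3 ∧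
      (∀ v, φ' v = κ * x * (L v).1 0 0 ^ 2 + (L v).1 0 0 * (L v).1 0 1 +
        e * b / κ * (L v).1 0 1 ^ 2 +
        κ * ((L v).2 0 ^ 2 + p * (L v).2 1 ^ 2 + e * (L v).2 2 ^ 2)) ∧
      WittEquiv φ (φ'.prod ((Units.mk0 κ hκ : F) •
        pfisterQF 2 (fun i => ((![Units.mk0 x hx, Units.mk0 e he] : Fin 2 → Fˣ) i : F))
          (x * e * b))) := by
  have two : (2 : F) = 0 := CharTwo.two_eq_zero
  obtain ⟨κ, hκ, T, hT⟩ := h.exists_linearEquiv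
  obtain ⟨L⟩ : Nonempty ((Fin 5 → F) ≃ₗ[F] ((Fin 1 → Fin 2 → F) × (Fin 3 → F))) :=
    ⟨LinearEquiv.ofFinrankEq _ _ (by simp [Module.finrank_pi_fintype])⟩
  let Q : QuadraticForm F ((Fin 1 → Fin 2 → F) × (Fin 3 → F)) :=
    (binsQF ![κ * x] ![e * b / κ]).prod (diagQF fun i => κ * (![1, p, e] : Fin 3 → F) i)
  have hQ : ∀ v, Q.comp L.toLinearMap v =
      κ * x * (L v).1 0 0 ^ 2 + (L v).1 0 0 * (L v).1 0 1 + e * b / κ * (L v).1 0 1 ^ 2 +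
        κ * ((L v).2 0 ^ 2 + p * (L v).2 1 ^ 2 + e * (L v).2 2 ^ 2) := by
    intro v
    simp [Q, binsQF_apply, diagQF_apply, QuadraticMap.prod_apply, Fin.sum_univ_three]
    ring
  refine ⟨κ, hκ, Q.comp L.toLinearMap, L, ⟨_, _, _, ⟨{ L with map_app' := fun _ => rfl }⟩⟩, hQ,
    4, 0, ?_⟩
  apply QuadraticMap.Equivalent.symm
  let M : (((Fin 5 → F) × (Finset (Fin 2) → Fin 2 → F)) × (Fin 0 → Fin 2 → F)) →ₗ[F]
      (Fin 2 ⊕ Fin 3 → F) × (Fin 4 → Fin 2 → F) :=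
    { toFun := fun v =>
        (Sum.elim ![v.1.2 {0, 1} 0, x * e * v.1.2 {0, 1} 1]
          ![(L v.1.1).2 0 + v.1.2 ∅ 0, (L v.1.1).2 1, (L v.1.1).2 2 + v.1.2 {1} 0],
        ![![κ * x * ((L v.1.1).1 0 0 + v.1.2 {0} 0),
            ((L v.1.1).1 0 0 + v.1.2 {0} 0) +
              ((κ * x)⁻¹ * (L v.1.1).1 0 1 + v.1.2 {0} 1) + v.1.2 {0} 1],
          ![κ * x * ((κ * x)⁻¹ * (L v.1.1).1 0 1 + v.1.2 {0} 1),
            x * e * b * ((κ * x)⁻¹ * (L v.1.1).1 0 1 + v.1.2 {0} 1) + v.1.2 {0} 0],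
          ![κ * v.1.2 ∅ 1, v.1.2 ∅ 0 + x * e * b * v.1.2 ∅ 1],
          ![κ * e * v.1.2 {1} 1, v.1.2 {1} 0 + x * e * b * v.1.2 {1} 1]])
      map_add' := fun v w => by
        refine Prod.ext ?_ ?_
        · funext i
          rcases i with i | i <;> fin_cases i <;> simp <;> ring
        · funext i j
          fin_cases i <;> fin_cases j <;> simp <;> ring
      map_smul' := fun t v => by
        refine Prod.ext ?_ ?_
        · funext i
          rcases i with i | i <;> fin_cases i <;> simp <;> ring
        · funext i j
          fin_cases i <;> fin_cases j <;> simp <;> ring }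
  refine equivalent_of_injective (LinearMap.prodMap T.toLinearMap LinearMap.id ∘ₗ M) ?_
    (by simp [Module.finrank_pi_fintype]) ?_
  · rw [injective_iff_map_eq_zero]
    rintro ⟨⟨u, z⟩, t⟩ h0
    have h1 : T (M ((u, z), t)).1 = 0 := congrArg Prod.fst h0
    have h2 : (M ((u, z), t)).2 = 0 := congrArg Prod.snd h0
    rw [LinearEquiv.map_eq_zero_iff] at h1
    have a0 := congrFun h1 (.inl 0)
    have a1 := congrFun h1 (.inl 1)
    have a2 := congrFun h1 (.inr 0)
    have a3 := congrFun h1 (.inr 1)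
    have a4 := congrFun h1 (.inr 2)
    have b00 := congrFun (congrFun h2 0) 0
    have b01 := congrFun (congrFun h2 0) 1
    have b10 := congrFun (congrFun h2 1) 0
    have b11 := congrFun (congrFun h2 1) 1
    have b20 := congrFun (congrFun h2 2) 0
    have b21 := congrFun (congrFun h2 2) 1
    have b30 := congrFun (congrFun h2 3) 0
    have b31 := congrFun (congrFun h2 3) 1
    simp [M, hx, he, hκ] at a0 a1 a2 a3 a4 b00 b01 b10 b11 b20 b21 b30 b31
    have c1 : z {0} 1 = 0 := by simpa [b00, b10] using b01
    have c2 : z {0} 0 = 0 := by simpa [b10] using b11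
    have c3 : z ∅ 0 = 0 := by simpa [b20] using b21
    have c4 : z {1} 0 = 0 := by simpa [b30] using b31
    have c5 : (L u).1 0 0 = 0 := by simpa [c2] using b00
    have c6 : (L u).1 0 1 = 0 := by simpa [c1, hκ, hx] using b10
    have c7 : (L u).2 0 = 0 := by simpa [c3] using a2
    have c8 : (L u).2 2 = 0 := by simpa [c4] using a4
    clear h0 h1 h2
    have hz : z = 0 := by
      rw [exists_subsetVec z, show z ∅ = 0 from funext (Fin.forall_fin_two.2 ⟨c3, b20⟩),
        show z {0} = 0 from funext (Fin.forall_fin_two.2 ⟨c2, c1⟩),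
        show z {1} = 0 from funext (Fin.forall_fin_two.2 ⟨c4, b30⟩),
        show z {0, 1} = 0 from funext (Fin.forall_fin_two.2 ⟨a0, a1⟩)]
      funext S
      simp [subsetVec]
    have hu : L u = 0 := by
      refine Prod.ext (funext fun i => ?_) (funext fun i => ?_)
      · rw [Subsingleton.elim i 0]
        exact funext (Fin.forall_fin_two.2 ⟨c5, c6⟩)
      · match i with
        | 0 => exact c7
        | 1 => exact a3
        | 2 => exact c8
    rw [LinearEquiv.map_eq_zero_iff] at hu
    rw [hu, hz, Subsingleton.elim t 0]; rfl
  · rintro ⟨⟨u, z⟩, t⟩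
    have e1 : ∀ w, (φ.prod (hypQF F 4)) ((LinearMap.prodMap T.toLinearMap LinearMap.id) w) =
        κ * gq (x * e) b ![1, p, e] w.1 + ∑ i, w.2 i 0 * w.2 i 1 := by
      intro w
      rw [← hT, ← hypQF_apply]; rfl
    rw [LinearMap.comp_apply, e1]
    simp only [QuadraticMap.prod_apply, hQ, _root_.smul_apply, pfisterQF_two_apply, hypQF_apply,
      Finset.univ_eq_empty, Finset.sum_empty, M, LinearMap.coe_mk, AddHom.coe_mk, gq,
      Sum.elim_inl, Sum.elim_inr, Fin.sum_univ_three, Fin.sum_univ_four, Matrix.cons_val_zero,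
      Matrix.cons_val_one, Matrix.cons_val, Units.val_mk0, smul_eq_mul]
    generalize (L u).1 0 0 = y0
    generalize (L u).1 0 1 = y1
    generalize (L u).2 0 = n1
    generalize (L u).2 1 = np
    generalize (L u).2 2 = ne
    have hY : y1 = κ * x * ((κ * x)⁻¹ * y1) := by field_simp
    generalize (κ * x)⁻¹ * y1 = Y at hY
    subst hY
    have hd : e * b / κ * (κ * x * Y) ^ 2 = κ * x * (x * e * b) * Y ^ 2 := by field_simp
    rw [hd]
    generalize z ∅ 0 = z1
    generalize z ∅ 1 = w1
    generalize z {0} 0 = z2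
    generalize z {0} 1 = w2
    generalize z {1} 0 = z3
    generalize z {1} 1 = w3
    generalize z {0, 1} 0 = z4
    generalize z {0, 1} 1 = w4
    linear_combination κ * (n1 * z1 + e * ne * z3 + x * (y0 * z2 + y0 * w2 + z2 * Y + z2 * w2 +
      x * e * b * Y * w2)) * two

end Outputs

section Outputs

variable {F : Type} [Field F] [CharP F 2]

theorem decomposes_three {φ : QuadraticForm F (Fin 5 → F)} {x e b p : F}
    (hx : x ≠ 0) (he : e ≠ 0) (h : Presents φ (x * e) b ![1, p, e])
    {ψ : QuadraticForm F (Fin 3 → F)} (hψ : ψ.Anisotropic) (hg : DiagPresents ψ ![1, x, p])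
    {h₀ f g₀ g₁ g₂ g₃ : F} (hd : x * e * b + h₀ + h₀ ^ 2 =
      x * f ^ 2 + e * g₀ ^ 2 + x * e * g₁ ^ 2 + p * e * g₂ ^ 2 + x * p * e * g₃ ^ 2) :
    Decomposes φ ψ := by
  have two : (2 : F) = 0 := CharTwo.two_eq_zero
  obtain ⟨κ, hκ, φ', L, h1, h2, h3⟩ := exists_decomposition hx he h
  refine ⟨φ', _, _, _, h1, h3, ?_, ?_⟩
  · let S : (Fin 3 → F) →ₗ[F] ((Fin 1 → Fin 2 → F) × (Fin 3 → F)) :=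
      { toFun := fun v => (fun _ => ![v 1, 0], ![v 0, v 2, 0])
        map_add' := fun v w => by
          refine Prod.ext (funext fun _ => ?_) ?_ <;> funext i <;> fin_cases i <;> simp
        map_smul' := fun t v => by
          refine Prod.ext (funext fun _ => ?_) ?_ <;> funext i <;> fin_cases i <;> simp }
    refine hg.weaklyDominated hψ hκ (L.symm.toLinearMap ∘ₗ S) fun v => ?_
    rw [h2]
    simp [S, Fin.sum_univ_three]
    ring
  · let π (i : Fin 3) : (Fin 3 → F) →ₗ[F] F := LinearMap.proj (φ := fun _ => F) i
    by_cases hu : g₂ ^ 2 + x * g₃ ^ 2 = 0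
    · refine hg.weaklyDominated hψ hκ
        (subsetMap (pairMap (π 0 + ((p / e + 1) * (e * g₀)) • π 2) 0)
          (pairMap (π 1 + ((p / e + 1) * (e * g₁)) • π 2) 0)
          (pairMap (((p / e + 1) * h₀ + 1) • π 2) ((p / e + 1) • π 2))
          (pairMap (((p / e + 1) * f) • π 2) 0)) fun v => ?_
      obtain ⟨μ, hμ, hp⟩ : ∃ μ, p / e + 1 = μ ∧ p = e * (μ + 1) :=
        ⟨_, rfl, by field_simp; linear_combination (-e) * two⟩
      rw [hμ]
      simp [subsetMap, pfisterQF_subsetVec, pairMap, π, Fin.sum_univ_three]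
      left
      linear_combination (e * μ ^ 2 * v 2 ^ 2) * hd - v 2 ^ 2 * hp +
        (μ ^ 2 * e ^ 2 * v 2 ^ 2 * p) * hu +
        (v 0 * μ * e * g₀ * v 2 + x * v 1 * μ * e * g₁ * v 2 + e * μ * h₀ * v 2 ^ 2 +
          μ ^ 2 * e * v 2 ^ 2 * (e * g₀ ^ 2 + x * e * g₁ ^ 2 + x * f ^ 2)) * two
    · refine hg.weaklyDominated hψ (mul_ne_zero hκ hu)
        (subsetMap (pairMap (g₂ • π 0 + (x * g₃) • π 1 + g₀ • π 2) 0)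
          (pairMap (g₃ • π 0 + g₂ • π 1 + g₁ • π 2) 0)
          (pairMap ((h₀ / e) • π 2) ((1 / e) • π 2))
          (pairMap ((f / e) • π 2) 0)) fun v => ?_
      simp [subsetMap, pfisterQF_subsetVec, pairMap, π, Fin.sum_univ_three]
      field_simp
      linear_combination v 2 ^ 2 * hd +
        (e * (2 * x * g₂ * g₃ * v 0 * v 1 + (g₂ * v 0 + x * g₃ * v 1) * g₀ * v 2 +
          x * (g₃ * v 0 + g₂ * v 1) * g₁ * v 2 + g₀ ^ 2 * v 2 ^ 2 + x * g₁ ^ 2 * v 2 ^ 2) +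
          x * f ^ 2 * v 2 ^ 2) * two

theorem decomposes_four {φ : QuadraticForm F (Fin 5 → F)} {x e b p : F}
    (hx : x ≠ 0) (he : e ≠ 0) (h : Presents φ (x * e) b ![1, p, e])
    {ψ : QuadraticForm F (Fin 4 → F)} (hψ : ψ.Anisotropic) (hg : DiagPresents ψ ![1, x, p, e])
    {h₀ f g₀ g₁ g₂ : F} (hd : x * e * b + h₀ + h₀ ^ 2 =
      x * f ^ 2 + e * g₀ ^ 2 + x * e * g₁ ^ 2 + x * p * e * g₂ ^ 2) :
    Decomposes φ ψ := by
  have two : (2 : F) = 0 := CharTwo.two_eq_zero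
  obtain ⟨κ, hκ, φ', L, h1, h2, h3⟩ := exists_decomposition hx he h
  refine ⟨φ', _, _, _, h1, h3, ?_, ?_⟩
  · let S : (Fin 4 → F) →ₗ[F] ((Fin 1 → Fin 2 → F) × (Fin 3 → F)) :=
      { toFun := fun v => (fun _ => ![v 1, 0], ![v 0, v 2, v 3])
        map_add' := fun v w => by
          refine Prod.ext (funext fun _ => ?_) ?_ <;> funext i <;> fin_cases i <;> simp
        map_smul' := fun t v => by
          refine Prod.ext (funext fun _ => ?_) ?_ <;> funext i <;> fin_cases i <;> simp }
    refine hg.weaklyDominated hψ hκ (L.symm.toLinearMap ∘ₗ S) fun v => ?_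
    rw [h2]
    simp [S, Fin.sum_univ_four]
    ring
  · let π (i : Fin 4) : (Fin 4 → F) →ₗ[F] F := LinearMap.proj (φ := fun _ => F) i
    by_cases hu : g₂ = 0
    · refine hg.weaklyDominated hψ hκ
        (subsetMap (pairMap (π 0 + ((p / (x * e) + 1) * (x * e * g₁)) • π 2) 0)
          (pairMap (π 1 + ((p / (x * e) + 1) * (e * g₀)) • π 2) 0)
          (pairMap (π 3 + ((p / (x * e) + 1) * (x * f)) • π 2) 0)
          (pairMap (((p / (x * e) + 1) * h₀ + 1) • π 2) ((p / (x * e) + 1) • π 2))) fun v => ?_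
      obtain ⟨μ, hμ, hp⟩ : ∃ μ, p / (x * e) + 1 = μ ∧ p = x * e * (μ + 1) :=
        ⟨_, rfl, by field_simp; linear_combination (-x * e) * two⟩
      rw [hμ]
      simp [subsetMap, pfisterQF_subsetVec, pairMap, π, Fin.sum_univ_four]
      left
      subst hu
      linear_combination (x * e * μ ^ 2 * v 2 ^ 2) * hd - v 2 ^ 2 * hp +
        (v 0 * μ * x * e * g₁ * v 2 + x * v 1 * μ * e * g₀ * v 2 + e * v 3 * μ * x * f * v 2 +
          x * e * μ * h₀ * v 2 ^ 2 +
          x * e * μ ^ 2 * v 2 ^ 2 * (e * g₀ ^ 2 + x * e * g₁ ^ 2 + x * f ^ 2)) * two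
    · refine hg.weaklyDominated hψ hκ
        (subsetMap (pairMap (π 0 + (g₁ / g₂) • π 2) 0)
          (pairMap (π 1 + (g₀ / (x * g₂)) • π 2) 0)
          (pairMap (π 3 + (f / (e * g₂)) • π 2) 0)
          (pairMap ((h₀ / (x * e * g₂)) • π 2) ((1 / (x * e * g₂)) • π 2))) fun v => ?_
      simp [subsetMap, pfisterQF_subsetVec, pairMap, π, Fin.sum_univ_four]
      left
      field_simp
      linear_combination v 2 ^ 2 * hd +
        (x * e * g₂ * g₁ * v 0 * v 2 + e * g₂ * g₀ * x * v 1 * v 2 + x * g₂ * e * f * v 3 * v 2 +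
          v 2 ^ 2 * (x * e * g₁ ^ 2 + e * g₀ ^ 2 + x * f ^ 2)) * two

end Outputs

section BaseChange

theorem quadraticForm_ext {R : Type} [CommRing R] {ι : Type} [Fintype ι] [DecidableEq ι]
    {Q₁ Q₂ : QuadraticForm R (ι → R)} (h1 : ∀ i, Q₁ (Pi.single i 1) = Q₂ (Pi.single i 1))
    (h2 : ∀ i j, Q₁ (Pi.single i 1 + Pi.single j 1) = Q₂ (Pi.single i 1 + Pi.single j 1)) :
    Q₁ = Q₂ := by
  have hp : Q₁.polarBilin = Q₂.polarBilin := by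
    refine LinearMap.BilinForm.ext_basis (Pi.basisFun R ι) fun i j => ?_
    simp [QuadraticMap.polar, h1, h2]
  have hadd : ∀ v w, polar Q₁ v w = polar Q₂ v w := fun v w =>
    congrArg (fun B => B v w) hp
  have key : ∀ (s : Finset ι) (v : ι → R),
      Q₁ (∑ i ∈ s, v i • Pi.single i 1) = Q₂ (∑ i ∈ s, v i • Pi.single i 1) := by
    intro s v
    induction s using Finset.induction_on with
    | empty => simp
    | insert i s hi ih =>
      have e := hadd (v i • Pi.single i 1) (∑ i ∈ s, v i • Pi.single i 1)
      simp only [polar] at e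
      rw [Finset.sum_insert hi]
      have e1 := Q₁.map_smul (v i) (Pi.single i 1)
      have e2 := Q₂.map_smul (v i) (Pi.single i 1)
      rw [h1, ← e2] at e1
      linear_combination e + ih + e1
  ext v
  have hv : v = ∑ i, v i • Pi.single i (1 : R) := by
    funext j
    simp [Finset.sum_apply, Pi.single_apply]
  rw [hv]
  exact key _ v

theorem toQuadraticMap'_apply {R : Type} [CommRing R] {ι : Type} [Fintype ι] [DecidableEq ι]
    (M : Matrix ι ι R) (v : ι → R) :
    M.toQuadraticForm' v = ∑ i, ∑ j, M i j * (v i * v j) := by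
  simp only [Matrix.toQuadraticForm', LinearMap.BilinMap.toQuadraticMap_apply,
    Matrix.toLinearMap₂'_apply]
  exact Finset.sum_congr rfl fun i _ => Finset.sum_congr rfl fun j _ => by simp; ring

theorem polar_toQuadraticForm'_single {R : Type} [CommRing R] {ι : Type} [Fintype ι]
    [DecidableEq ι] (M : Matrix ι ι R) (i j : ι) :
    polar M.toQuadraticForm' (Pi.single i 1) (Pi.single j 1) = M i j + M j i := by
  simp only [polar, toQuadraticMap'_apply, Pi.add_apply, add_mul, mul_add, Finset.sum_add_distrib]
  simp only [Pi.single_apply, mul_ite, mul_one, mul_zero, Finset.sum_ite_eq', Finset.mem_univ,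
    if_true]
  ring

variable {F : Type} [Field F] {K : Type} [CommRing K] (f : F →+* K)

theorem extendQF_apply {n : ℕ} (φ : QuadraticForm F (Fin n → F)) (v : Fin n → K) :
    extendQF F f φ v = ∑ i, ∑ j, f (coeffMat F φ i j) * (v i * v j) :=
  toQuadraticMap'_apply _ v

theorem coeffMat_toQuadraticForm' {n : ℕ} (φ : QuadraticForm F (Fin n → F)) :
    (coeffMat F φ).toQuadraticForm' = φ := by
  have hs : ∀ i, (coeffMat F φ).toQuadraticForm' (Pi.single i 1) = φ (Pi.single i 1) := by
    intro i
    rw [toQuadraticMap'_apply]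
    simp [Pi.single_apply, coeffMat]
  refine quadraticForm_ext hs fun i j => ?_
  rcases eq_or_ne i j with rfl | hij
  · rw [← two_smul F, QuadraticMap.map_smul, QuadraticMap.map_smul, hs]
  have h1 : polar (coeffMat F φ).toQuadraticForm' (Pi.single i 1) (Pi.single j 1) =
      polar φ (Pi.single i 1) (Pi.single j 1) := by
    rw [polar_toQuadraticForm'_single]
    rcases lt_or_gt_of_ne hij with h | h
    · simp [coeffMat, h, hij, hij.symm, h.not_gt]
    · simp [coeffMat, h, hij, hij.symm, h.not_gt, polar_comm]
  simp only [polar, hs] at h1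
  linear_combination h1

theorem extendQF_map {n : ℕ} (φ : QuadraticForm F (Fin n → F)) (v : Fin n → F) :
    extendQF F f φ (fun i => f (v i)) = f (φ v) := by
  conv_rhs => rw [← coeffMat_toQuadraticForm' φ]
  rw [extendQF_apply, toQuadraticMap'_apply]
  simp

/-- Scalar extension of a linear map between coordinate spaces. -/
noncomputable def extendLin {ι κ : Type} [Fintype ι] [DecidableEq ι] [Fintype κ] [DecidableEq κ]
    (T : (ι → F) →ₗ[F] (κ → F)) : (ι → K) →ₗ[K] (κ → K) :=
  Matrix.toLin' ((LinearMap.toMatrix' T).map f)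

theorem extendLin_map {ι κ : Type} [Fintype ι] [DecidableEq ι] [Fintype κ] [DecidableEq κ]
    (T : (ι → F) →ₗ[F] (κ → F)) (v : ι → F) :
    extendLin f T (fun i => f (v i)) = fun i => f (T v i) := by
  have : T v = Matrix.toLin' (LinearMap.toMatrix' T) v := by rw [Matrix.toLin'_toMatrix']
  rw [this]
  funext i
  simp only [extendLin, Matrix.toLin'_apply, Matrix.mulVec, dotProduct, Matrix.map_apply, map_sum,
    map_mul]

theorem extendLin_symm {ι κ : Type} [Fintype ι] [DecidableEq ι] [Fintype κ] [DecidableEq κ]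
    (T : (ι → F) ≃ₗ[F] (κ → F)) (w : κ → K) :
    extendLin f T.toLinearMap (extendLin f T.symm.toLinearMap w) = w := by
  rw [extendLin, extendLin, ← LinearMap.comp_apply, ← Matrix.toLin'_mul, ← Matrix.map_mul,
    ← LinearMap.toMatrix'_comp]
  simp

theorem extendLin_symm_self {ι κ : Type} [Fintype ι] [DecidableEq ι] [Fintype κ] [DecidableEq κ]
    (T : (ι → F) ≃ₗ[F] (κ → F)) (w : ι → K) :
    extendLin f T.symm.toLinearMap (extendLin f T.toLinearMap w) = w := by
  rw [extendLin, extendLin, ← LinearMap.comp_apply, ← Matrix.toLin'_mul, ← Matrix.map_mul,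
    ← LinearMap.toMatrix'_comp]
  simp

theorem extendQF_extendLin {n : ℕ} {ι : Type} [Fintype ι] [DecidableEq ι]
    {φ : QuadraticForm F (Fin n → F)} (T : (ι → F) →ₗ[F] (Fin n → F))
    (QK : QuadraticForm K (ι → K)) (h : ∀ v : ι → F, QK (fun i => f (v i)) = f (φ (T v)))
    (w : ι → K) : extendQF F f φ (extendLin f T w) = QK w := by
  have hf : ∀ i : ι, (Pi.single i 1 : ι → K) = fun j => f ((Pi.single i 1 : ι → F) j) := by
    intro i; funext j
    by_cases hj : j = i
    · subst hj; simp
    · simp [hj]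
  have hK : ∀ v : ι → F, ((extendQF F f φ).comp (extendLin f T)) (fun i => f (v i)) =
      QK (fun i => f (v i)) := by
    intro v
    rw [QuadraticMap.comp_apply, extendLin_map, extendQF_map, h]
  have : (extendQF F f φ).comp (extendLin f T) = QK := by
    refine quadraticForm_ext (fun i => ?_) fun i j => ?_
    · rw [hf, hK]
    · have : (Pi.single i 1 + Pi.single j 1 : ι → K) =
          fun k => f ((Pi.single i 1 + Pi.single j 1 : ι → F) k) := by
        rw [hf i, hf j]; funext k; simp
      rw [this, hK]
  rw [← this]; rfl

/-- `[a,b] ⊥ ⟨d⟩` as a quadratic form. -/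
noncomputable def gqForm {R ι : Type} [CommRing R] [Fintype ι] (a b : R) (d : ι → R) :
    QuadraticForm R (Fin 2 ⊕ ι → R) :=
  (binQF a b).comp (LinearMap.funLeft R R Sum.inl) +
    (QuadraticMap.weightedSumSquares R d).comp (LinearMap.funLeft R R Sum.inr)

theorem gqForm_apply {R ι : Type} [CommRing R] [Fintype ι] (a b : R) (d : ι → R)
    (v : Fin 2 ⊕ ι → R) : gqForm a b d v = gq a b d v := by
  simp [gqForm, gq, binQF_apply, LinearMap.funLeft, QuadraticMap.weightedSumSquares_apply,
    _root_.sq]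

variable [CharP F 2]

theorem Presents.exists_linearEquiv_extend {φ : QuadraticForm F (Fin 5 → F)} {a b : F}
    {c : Fin 3 → F} (h : Presents φ a b c) : ∃ κ : F, κ ≠ 0 ∧
      ∃ T : (Fin 2 ⊕ Fin 3 → F) ≃ₗ[F] (Fin 5 → F),
      ∀ v, extendQF F f φ (extendLin f T.toLinearMap v) =
        f κ * gq (f a) (f b) (fun i => f (c i)) v := by
  obtain ⟨κ, hκ, T, hT⟩ := h.exists_linearEquiv
  refine ⟨κ, hκ, T, fun v => ?_⟩
  rw [extendQF_extendLin f T.toLinearMap (f κ • gqForm (f a) (f b) (fun i => f (c i))),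
    _root_.smul_apply, gqForm_apply, smul_eq_mul]
  intro v
  rw [_root_.smul_apply, gqForm_apply, ← map_gq, smul_eq_mul, ← map_mul, ← hT]
  rfl

theorem Presents.not_gAnis_of_extendQF {φ : QuadraticForm F (Fin 5 → F)} {a b : F}
    {c : Fin 3 → F} (h : Presents φ a b c) (hK : ¬ (extendQF F f φ).Anisotropic) :
    ¬ GAnis (f a) (f b) (fun i => f (c i)) := by
  obtain ⟨κ, hκ, T, hT⟩ := h.exists_linearEquiv_extend f
  intro H
  apply hK
  intro v hv
  have h1 := hT (extendLin f T.symm.toLinearMap v)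
  rw [extendLin_symm, hv] at h1
  have h2 := H _ ((IsUnit.mul_right_eq_zero ((IsUnit.mk0 κ hκ).map f)).1 h1.symm)
  rw [← extendLin_symm f T v, h2, map_zero]

end BaseChange

section FunctionField

variable {F : Type} [Field F] [CharP F 2]

/-- The polynomial `∑ (g_{j+1}/g₀) X_j²`, minus which is the square of the remaining coordinate
on the quadric `⟨g⟩ = 0`. -/
noncomputable def thetaPoly {n : ℕ} (g : Fin (n + 1) → F) : MvPolynomial (Fin n) F :=
  ∑ j, C (g j.succ / g 0) * X j ^ 2

theorem sq_ne_thetaPoly {n : ℕ} {g : Fin (n + 1) → F} (hg : SqIndep g) (hn : n ≠ 0)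
    (r : MvPolynomial (Fin n) F) : r ^ 2 ≠ thetaPoly g := by
  intro h
  obtain ⟨m, rfl⟩ := Nat.exists_eq_succ_of_ne_zero hn
  have h1 := congrArg (eval (Pi.single 0 1)) h
  simp [thetaPoly, Pi.single_apply] at h1
  have h2 := hg (Fin.cons (eval (Pi.single 0 1) r) (Pi.single 0 1)) (by
    simp [Fin.sum_univ_succ, h1]
    have := hg.ne_zero 0
    rw [mul_div_cancel₀ _ this]
    exact CharTwo.add_self_eq_zero (g 1))
  simpa using congrFun h2 1

/-- The polynomial `T² + θ`. -/
noncomputable def quadricPoly {n : ℕ} (g : Fin (n + 1) → F) : Polynomial (MvPolynomial (Fin n) F) :=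
  Polynomial.X ^ 2 + Polynomial.C (thetaPoly g)

theorem quadricPoly_monic {n : ℕ} (g : Fin (n + 1) → F) : (quadricPoly g).Monic :=
  Polynomial.monic_X_pow_add_C _ two_ne_zero

theorem quadricPoly_natDegree {n : ℕ} (g : Fin (n + 1) → F) : (quadricPoly g).natDegree = 2 :=
  Polynomial.natDegree_X_pow_add_C

theorem quadricPoly_prime {n : ℕ} {g : Fin (n + 1) → F} (hg : SqIndep g) (hn : n ≠ 0) :
    Prime (quadricPoly g) := by
  refine Irreducible.prime ?_
  rw [(quadricPoly_monic g).irreducible_iff_roots_eq_zero_of_degree_le_three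
    (by rw [quadricPoly_natDegree]) (by rw [quadricPoly_natDegree]; norm_num)]
  refine Multiset.eq_zero_of_forall_notMem fun r hr => ?_
  have := (Polynomial.mem_roots'.1 hr).2
  simp [quadricPoly] at this
  exact sq_ne_thetaPoly hg hn r (CharTwo.add_eq_zero.1 this)

theorem map_extendLin {R S ι κ : Type} [CommRing R] [CommRing S] [Fintype ι] [DecidableEq ι]
    [Fintype κ] [DecidableEq κ] (f : F →+* R) (h : F →+* S) (t : R →+* S)
    (hth : ∀ x, t (f x) = h x)
    (T : (ι → F) →ₗ[F] (κ → F)) (w : ι → R) (i : κ) :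
    t (extendLin f T w i) = extendLin h T (fun j => t (w j)) i := by
  simp [extendLin, Matrix.toLin'_apply, Matrix.mulVec, dotProduct, hth]

theorem DiagPresents.exists_linearEquiv {n : ℕ} {ψ : QuadraticForm F (Fin n → F)} {g : Fin n → F}
    (h : DiagPresents ψ g) : ∃ κ : F, κ ≠ 0 ∧ ∃ T : (Fin n → F) ≃ₗ[F] (Fin n → F),
      ∀ v, ψ (T v) = κ * ∑ i, g i * v i ^ 2 := by
  obtain ⟨κ, hκ, T, hT, e⟩ := h
  exact ⟨κ, hκ, LinearEquiv.ofInjectiveEndo T hT, e⟩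

/-- The linear substitution `X ↦ S X` on polynomials. -/
noncomputable def substHom {n : ℕ} (S : (Fin n → F) →ₗ[F] (Fin n → F)) :
    MvPolynomial (Fin n) F →ₐ[F] MvPolynomial (Fin n) F :=
  aeval (extendLin (C : F →+* MvPolynomial (Fin n) F) S X)

theorem substHom_X {n : ℕ} (S : (Fin n → F) →ₗ[F] (Fin n → F)) (i : Fin n) :
    substHom S (X i) = extendLin C S X i := aeval_X _ i

theorem substHom_C {n : ℕ} (S : (Fin n → F) →ₗ[F] (Fin n → F)) (x : F) :
    substHom S (C x) = C x := algHom_C _ x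

theorem substHom_extendLin {n : ℕ} (S : (Fin n → F) →ₗ[F] (Fin n → F))
    (T : (Fin n → F) →ₗ[F] (Fin n → F)) (w : Fin n → MvPolynomial (Fin n) F) (i : Fin n) :
    substHom S (extendLin C T w i) = extendLin C T (fun j => substHom S (w j)) i :=
  map_extendLin C C (substHom S : MvPolynomial (Fin n) F →+* MvPolynomial (Fin n) F)
    (substHom_C S) T w i

theorem substHom_comp_symm {n : ℕ} (S : (Fin n → F) ≃ₗ[F] (Fin n → F)) :
    (substHom S.toLinearMap).comp (substHom S.symm.toLinearMap) = AlgHom.id F _ := by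
  refine algHom_ext fun i => ?_
  have h1 : (fun j => substHom S.toLinearMap (X j)) =
      extendLin (C : F →+* MvPolynomial (Fin n) F) S.toLinearMap X :=
    funext (substHom_X S.toLinearMap)
  rw [AlgHom.comp_apply, substHom_X, substHom_extendLin]
  rw [h1]
  rw [extendLin_symm_self]
  rfl

theorem exists_mvPolynomial_equiv {n : ℕ} {ψ : QuadraticForm F (Fin n → F)} {g : Fin n → F}
    (h : DiagPresents ψ g) : ∃ (κ : F) (τ : MvPolynomial (Fin n) F ≃ₐ[F] MvPolynomial (Fin n) F),
      κ ≠ 0 ∧ τ (qfPoly F ψ) = C κ * ∑ i, C (g i) * X i ^ 2 := by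
  obtain ⟨κ, hκ, T, hT⟩ := h.exists_linearEquiv
  refine ⟨κ, AlgEquiv.ofAlgHom (substHom T.toLinearMap) (substHom T.symm.toLinearMap)
    (substHom_comp_symm T) (substHom_comp_symm T.symm), hκ, ?_⟩
  change substHom T.toLinearMap (qfPoly F ψ) = _
  have h1 : substHom T.toLinearMap (qfPoly F ψ) =
      extendQF F (C : F →+* MvPolynomial (Fin n) F) ψ
        (extendLin (C : F →+* MvPolynomial (Fin n) F) T.toLinearMap X) := by
    rw [extendQF_apply, qfPoly]
    simp only [map_sum, map_mul, substHom_X, substHom_C]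
  rw [h1, extendQF_extendLin (C : F →+* MvPolynomial (Fin n) F) T.toLinearMap
    ((C κ : MvPolynomial (Fin n) F) •
      QuadraticMap.weightedSumSquares (MvPolynomial (Fin n) F) (fun i => (C (g i) : MvPolynomial (Fin n) F)))]
  · simp [QuadraticMap.weightedSumSquares_apply, _root_.sq]
  · intro v
    have := hT v
    rw [LinearEquiv.coe_coe, this]
    simp [QuadraticMap.weightedSumSquares_apply, _root_.sq]

theorem exists_funFieldRing_equiv {n : ℕ} {ψ : QuadraticForm F (Fin (n + 1) → F)}
    {g : Fin (n + 1) → F} (h : DiagPresents ψ g) (h0 : g 0 ≠ 0) :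
    ∃ σ : FunFieldRing F ψ ≃+* AdjoinRoot (quadricPoly g),
      ∀ x : F, σ (algebraMap F _ x) = AdjoinRoot.of _ (C x) := by
  obtain ⟨κ, τ, hκ, hτ⟩ := exists_mvPolynomial_equiv h
  let e : MvPolynomial (Fin (n + 1)) F ≃ₐ[F] Polynomial (MvPolynomial (Fin n) F) :=
    τ.trans (finSuccEquiv F n)
  have he : e (qfPoly F ψ) = Polynomial.C (C (κ * g 0)) * quadricPoly g := by
    change finSuccEquiv F n (τ (qfPoly F ψ)) = _
    rw [hτ]
    have hC : ∀ x : F, finSuccEquiv F n (C x) = Polynomial.C (C x) := fun x =>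
      (finSuccEquiv F n).commutes x
    have hp : ∑ j, Polynomial.C (C (g j.succ)) * (Polynomial.C (X j)) ^ 2 =
        Polynomial.C (C (g 0) * thetaPoly g) := by
      rw [thetaPoly, Finset.mul_sum, map_sum]
      refine Finset.sum_congr rfl fun j _ => ?_
      rw [← mul_assoc, ← C_mul, mul_div_cancel₀ _ h0]
      simp
    rw [Fin.sum_univ_succ]
    simp only [map_mul, map_add, map_sum, map_pow, hC, finSuccEquiv_X_zero, finSuccEquiv_X_succ, hp,
      quadricPoly]
    ring
  have hI : Ideal.span {quadricPoly g} =
      Ideal.map (e.toRingEquiv : MvPolynomial (Fin (n + 1)) F →+* Polynomial (MvPolynomial (Fin n) F))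
        (Ideal.span {qfPoly F ψ}) := by
    rw [Ideal.map_span, Set.image_singleton]
    change _ = Ideal.span {e (qfPoly F ψ)}
    rw [he]
    refine (Ideal.span_singleton_mul_left_unit ?_ _).symm
    exact ((IsUnit.mk0 _ (mul_ne_zero hκ h0)).map C).map Polynomial.C
  refine ⟨Ideal.quotientEquiv _ _ e.toRingEquiv hI, fun x => ?_⟩
  change Ideal.Quotient.mk _ (e (algebraMap F _ x)) = _
  rw [e.commutes]
  rfl

end FunctionField

section Extraction

theorem exists_of_not_gAnis_adjoinRoot {B ι : Type} [CommRing B] [CharP B 2]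
    [Fintype ι] {a b θ : B} {c : ι → B} {q : Polynomial B} (hq : q = Polynomial.X ^ 2 + Polynomial.C θ)
    (h : ¬ GAnis (AdjoinRoot.of q a) (AdjoinRoot.of q b) (fun i => AdjoinRoot.of q (c i))) :
    ∃ u w : Fin 2 ⊕ ι → B, (u ≠ 0 ∨ w ≠ 0) ∧ gq a b c u + θ * gq a b c w = 0 ∧
      u (.inl 0) * w (.inl 1) + u (.inl 1) * w (.inl 0) = 0 := by
  have : Nontrivial B := CharP.nontrivial_of_char_ne_one (R := B) (v := 2) (by norm_num)
  have hqm : q.Monic := hq ▸ Polynomial.monic_X_pow_add_C _ two_ne_zero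
  have hqd : q.natDegree = 2 := hq ▸ Polynomial.natDegree_X_pow_add_C
  simp only [GAnis, not_forall] at h
  obtain ⟨v, hv, h0⟩ := h
  have hrep : ∀ z : AdjoinRoot q, ∃ u w : B,
      z = AdjoinRoot.of q u + AdjoinRoot.root q * AdjoinRoot.of q w := by
    intro z
    obtain ⟨r, rfl⟩ := AdjoinRoot.mk_surjective z
    have h1 : (r %ₘ q).natDegree ≤ 1 := by
      have := Polynomial.natDegree_modByMonic_lt r hqm (by
        intro h; rw [h] at hqd; simp at hqd)
      omega
    obtain ⟨w, u, hwu⟩ := Polynomial.exists_eq_X_add_C_of_natDegree_le_one h1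
    refine ⟨u, w, ?_⟩
    have h2 : AdjoinRoot.mk q r = AdjoinRoot.mk q (r %ₘ q) := by
      rw [AdjoinRoot.mk_eq_mk]
      exact ⟨r /ₘ q, by linear_combination -Polynomial.modByMonic_add_div r q⟩
    rw [h2, hwu, map_add, map_mul, AdjoinRoot.mk_C, AdjoinRoot.mk_C, AdjoinRoot.mk_X]
    ring
  choose u w huw using fun i => hrep (v i)
  have hroot : AdjoinRoot.root q ^ 2 = AdjoinRoot.of q θ := by
    have h1 : AdjoinRoot.mk q q = 0 := AdjoinRoot.mk_self
    have h2 : AdjoinRoot.mk q (Polynomial.X ^ 2 + Polynomial.C θ) = 0 := by rw [← hq]; exact h1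
    have h3 : (AdjoinRoot.of q θ) + AdjoinRoot.of q θ = 0 := by
      rw [← map_add, CharTwo.add_self_eq_zero, map_zero]
    rw [map_add, map_pow, AdjoinRoot.mk_X, AdjoinRoot.mk_C] at h2
    linear_combination h2 - h3
  have : CharP (AdjoinRoot q) 2 := charP_of_injective_ringHom (f := AdjoinRoot.of q) (by
    rw [injective_iff_map_eq_zero]
    intro x hx
    have h1 : q ∣ Polynomial.C x := AdjoinRoot.mk_eq_zero.1 hx
    by_contra hx0
    exact hqm.not_dvd_of_natDegree_lt (Polynomial.C_ne_zero.2 hx0)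
      (by rw [Polynomial.natDegree_C, hqd]; norm_num) h1) 2
  have hzero : ∀ x y : B, AdjoinRoot.of q x + AdjoinRoot.root q * AdjoinRoot.of q y = 0 →
      x = 0 ∧ y = 0 := by
    intro x y hxy
    have h1 : q ∣ Polynomial.C y * Polynomial.X + Polynomial.C x := by
      rw [← AdjoinRoot.mk_eq_zero, map_add, map_mul, AdjoinRoot.mk_C, AdjoinRoot.mk_C,
        AdjoinRoot.mk_X, ← hxy]
      ring
    have h2 : Polynomial.C y * Polynomial.X + Polynomial.C x = 0 := by
      by_contra h0
      exact hqm.not_dvd_of_natDegree_lt h0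
        (by rw [hqd]; exact Nat.lt_succ_of_le Polynomial.natDegree_linear_le) h1
    have h3 := congrArg (Polynomial.coeff · 0) h2
    have h4 := congrArg (Polynomial.coeff · 1) h2
    simp [Polynomial.coeff_X, Polynomial.coeff_C] at h3 h4
    exact ⟨h3, h4⟩
  have hv' : v = fun i => AdjoinRoot.of q (u i) + AdjoinRoot.root q * AdjoinRoot.of q (w i) :=
    funext huw
  have key : AdjoinRoot.of q (gq a b c u + θ * gq a b c w) + AdjoinRoot.root q *
      AdjoinRoot.of q (u (.inl 0) * w (.inl 1) + u (.inl 1) * w (.inl 0)) = 0 := by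
    rw [← hv, hv', gq_add, gq_mul, ← map_gq, ← map_gq, hroot]
    simp only [map_add, map_mul]
    ring
  obtain ⟨k1, k2⟩ := hzero _ _ key
  refine ⟨u, w, ?_, k1, k2⟩
  by_contra hcon
  push Not at hcon
  apply h0
  rw [hv', hcon.1, hcon.2]
  funext i
  simp

theorem sum_triple {R ι : Type} [CommRing R] [CharP R 2] [Fintype ι] (θ α β : R) (c x y : ι → R) :
    ∑ i, c i * (α * x i + θ * β * y i) ^ 2 + ∑ i, θ * c i * (x i * β + y i * α) ^ 2 =
      (α ^ 2 + θ * β ^ 2) * (∑ i, c i * x i ^ 2 + θ * ∑ i, c i * y i ^ 2) := by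
  rw [← Finset.sum_add_distrib, Finset.mul_sum, ← Finset.sum_add_distrib, Finset.mul_sum]
  refine Finset.sum_congr rfl fun i _ => ?_
  have two : (2 : R) = 0 := CharTwo.two_eq_zero
  linear_combination (2 * c i * α * x i * θ * β * y i) * two

theorem not_gAnis_triple {B ι : Type} [CommRing B] [IsDomain B] [CharP B 2]
    [Fintype ι] {a b θ : B} {c : ι → B}
    (hθ : ∀ x y : B, x ^ 2 + θ * y ^ 2 = 0 → x = 0 ∧ y = 0)
    {u w : Fin 2 ⊕ ι → B} (h0 : u ≠ 0 ∨ w ≠ 0) (hG : gq a b c u + θ * gq a b c w = 0)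
    (hB : u (.inl 0) * w (.inl 1) + u (.inl 1) * w (.inl 0) = 0) :
    ¬ GAnis a b (Sum.elim c (fun i => θ * c i)) := by
  intro H
  have two : (2 : B) = 0 := CharTwo.two_eq_zero
  have k0 : u (.inl 0) = 0 ∧ w (.inl 0) = 0 := by
    have h1 := H (Sum.elim ![u (.inl 0) ^ 2 + θ * w (.inl 0) ^ 2,
        u (.inl 0) * u (.inl 1) + θ * w (.inl 0) * w (.inl 1)]
      (Sum.elim (fun i => u (.inl 0) * u (.inr i) + θ * w (.inl 0) * w (.inr i))
        (fun i => u (.inr i) * w (.inl 0) + w (.inr i) * u (.inl 0)))) (by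
      simp only [gq, Sum.elim_inl, Sum.elim_inr, Fintype.sum_sum_type, sum_triple,
        Matrix.cons_val_zero, Matrix.cons_val_one] at hG ⊢
      linear_combination (u (.inl 0) ^ 2 + θ * w (.inl 0) ^ 2) * hG +
        b * θ * hB * (u (.inl 0) * w (.inl 1) + u (.inl 1) * w (.inl 0)) -
        b * θ * (u (.inl 0) ^ 2 * w (.inl 1) ^ 2 + w (.inl 0) ^ 2 * u (.inl 1) ^ 2) * two)
    exact hθ _ _ (by simpa using congrFun h1 (.inl 0))
  have k1 : u (.inl 1) = 0 ∧ w (.inl 1) = 0 := by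
    have h1 := H (Sum.elim ![u (.inl 1) * u (.inl 0) + θ * w (.inl 1) * w (.inl 0),
        u (.inl 1) ^ 2 + θ * w (.inl 1) ^ 2]
      (Sum.elim (fun i => u (.inl 1) * u (.inr i) + θ * w (.inl 1) * w (.inr i))
        (fun i => u (.inr i) * w (.inl 1) + w (.inr i) * u (.inl 1)))) (by
      simp only [gq, Sum.elim_inl, Sum.elim_inr, Fintype.sum_sum_type, sum_triple,
        Matrix.cons_val_zero, Matrix.cons_val_one] at hG ⊢
      linear_combination (u (.inl 1) ^ 2 + θ * w (.inl 1) ^ 2) * hG +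
        a * θ * hB * (u (.inl 0) * w (.inl 1) + u (.inl 1) * w (.inl 0)) -
        a * θ * (u (.inl 0) ^ 2 * w (.inl 1) ^ 2 + w (.inl 0) ^ 2 * u (.inl 1) ^ 2) * two)
    exact hθ _ _ (by simpa using congrFun h1 (.inl 1))
  have h2 := H (Sum.elim 0 (Sum.elim (fun i => u (.inr i)) (fun i => w (.inr i)))) (by
    simp only [gq, Sum.elim_inl, Sum.elim_inr, Fintype.sum_sum_type, k0.1, k0.2, k1.1, k1.2,
      Pi.zero_apply, mul_assoc, ← Finset.mul_sum] at hG ⊢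
    linear_combination hG)
  have hu : u = 0 := by
    funext i
    rcases i with i | i
    · fin_cases i
      · exact k0.1
      · exact k1.1
    · exact congrFun h2 (.inr (.inl i))
  have hw : w = 0 := by
    funext i
    rcases i with i | i
    · fin_cases i
      · exact k0.2
      · exact k1.2
    · exact congrFun h2 (.inr (.inr i))
  exact h0.elim (fun h => h hu) fun h => h hw

variable {F : Type} [Field F] [CharP F 2]

theorem eq_zero_of_sq_add_thetaPoly {n : ℕ} {g : Fin (n + 1) → F} (hg : SqIndep g) (hn : n ≠ 0)
    (x y : MvPolynomial (Fin n) F) (h : x ^ 2 + thetaPoly g * y ^ 2 = 0) : x = 0 ∧ y = 0 := by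
  have h1 : x ^ 2 = thetaPoly g * y ^ 2 := CharTwo.add_eq_zero.1 h
  by_cases hy : y = 0
  · subst hy
    exact ⟨by simpa using h1, rfl⟩
  · obtain ⟨z, rfl⟩ := (IsIntegrallyClosed.pow_dvd_pow_iff two_ne_zero).1 (Dvd.intro_left _ h1.symm)
    exfalso
    apply sq_ne_thetaPoly hg hn z
    have : y ^ 2 ≠ 0 := pow_ne_zero _ hy
    exact mul_right_cancel₀ this (by linear_combination h1)

theorem not_gAnis_thetaPoly {n : ℕ} (hn : n ≠ 0) {φ : QuadraticForm F (Fin 5 → F)}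
    {ψ : QuadraticForm F (Fin (n + 1) → F)} (hψ : ψ.Anisotropic)
    (h : ¬ (extendQF F (funFieldMap F ψ) φ).Anisotropic)
    {a b : F} {c : Fin 3 → F} (hP : Presents φ a b c) {g : Fin (n + 1) → F}
    (hg : DiagPresents ψ g) :
    ¬ GAnis (C a : MvPolynomial (Fin n) F) (C b)
      (Sum.elim (fun i => C (c i)) (fun i => thetaPoly g * C (c i))) := by
  have hgi := hg.sqIndep hψ
  have h1 := hP.not_gAnis_of_extendQF _ h
  have h2 : ¬ GAnis (algebraMap F (FunFieldRing F ψ) a) (algebraMap F (FunFieldRing F ψ) b)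
      (fun i => algebraMap F (FunFieldRing F ψ) (c i)) := by
    intro H
    have : IsFractionRing (FunFieldRing F ψ) (FunField F ψ) :=
      inferInstanceAs (IsFractionRing (FunFieldRing F ψ) (FractionRing (FunFieldRing F ψ)))
    have := H.fraction (FunField F ψ)
    exact h1 this
  obtain ⟨σ, hσ⟩ := exists_funFieldRing_equiv hg (hgi.ne_zero 0)
  have h3 : ¬ GAnis (AdjoinRoot.of (quadricPoly g) (C a)) (AdjoinRoot.of (quadricPoly g) (C b))
      (fun i => AdjoinRoot.of (quadricPoly g) (C (c i))) := by
    intro H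
    apply h2
    refine GAnis.of_injective (f := (σ : FunFieldRing F ψ →+* AdjoinRoot (quadricPoly g)))
      σ.injective ?_
    change GAnis (σ _) (σ _) (fun i => σ _)
    simpa only [hσ] using H
  obtain ⟨u, w, h0, hG, hB⟩ := exists_of_not_gAnis_adjoinRoot rfl h3
  exact not_gAnis_triple (eq_zero_of_sq_add_thetaPoly hgi hn) h0 hG hB

end Extraction

section Specialization

variable {F : Type} [Field F] [CharP F 2]

theorem not_gAnis_dehomogenized {m : ℕ} {φ : QuadraticForm F (Fin 5 → F)}
    {ψ : QuadraticForm F (Fin (m + 2) → F)} (hψ : ψ.Anisotropic)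
    (h : ¬ (extendQF F (funFieldMap F ψ) φ).Anisotropic)
    {a b : F} {c : Fin 3 → F} (hP : Presents φ a b c) {g : Fin (m + 2) → F}
    (hg : DiagPresents ψ g) :
    ¬ GAnis (C a : MvPolynomial (Fin m) F) (C b)
      (Sum.elim (fun i => C (c i)) (fun i => (C (g 1 / g 0) +
        ∑ j : Fin m, C (g j.succ.succ / g 0) * X j ^ 2) * C (c i))) := by
  have h1 := not_gAnis_thetaPoly (Nat.succ_ne_zero m) hψ h hP hg
  have hC : ∀ x : F, finSuccEquiv F m (C x) = Polynomial.C (C x) := fun x =>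
    (finSuccEquiv F m).commutes x
  have hT : finSuccEquiv F m (thetaPoly g) = Polynomial.C (C (g 1 / g 0)) * Polynomial.X ^ 2 +
      ∑ j : Fin m, Polynomial.C (C (g j.succ.succ / g 0)) * Polynomial.C (X j) ^ 2 := by
    rw [thetaPoly, map_sum, Fin.sum_univ_succ]
    simp only [map_mul, map_pow, hC, finSuccEquiv_X_zero, finSuccEquiv_X_succ]
    rfl
  intro H
  have h2 : ¬ GAnis (Polynomial.C (C a : MvPolynomial (Fin m) F)) (Polynomial.C (C b))
      (Sum.elim (fun i => Polynomial.C (C (c i)))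
        (fun i => (Polynomial.C (C (g 1 / g 0)) * Polynomial.X ^ 2 +
          ∑ j : Fin m, Polynomial.C (C (g j.succ.succ / g 0)) * Polynomial.C (X j) ^ 2) *
            Polynomial.C (C (c i)))) := by
    intro H
    refine h1 (GAnis.of_injective (f := (finSuccEquiv F m : MvPolynomial (Fin (m + 1)) F →+*
      Polynomial (MvPolynomial (Fin m) F)))
      (finSuccEquiv F m).injective ?_)
    have e : (fun i => (finSuccEquiv F m : MvPolynomial (Fin (m + 1)) F →+*
        Polynomial (MvPolynomial (Fin m) F))
        ((Sum.elim (fun i => C (c i)) (fun i => thetaPoly g * C (c i))) i)) =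
        Sum.elim (fun i => Polynomial.C (C (c i)))
        (fun i => (Polynomial.C (C (g 1 / g 0)) * Polynomial.X ^ 2 +
          ∑ j : Fin m, Polynomial.C (C (g j.succ.succ / g 0)) * Polynomial.C (X j) ^ 2) *
            Polynomial.C (C (c i))) := by
      funext i
      rcases i with i | i
      · exact hC (c i)
      · change finSuccEquiv F m (thetaPoly g * C (c i)) = _
        rw [map_mul, hT, hC]
        rfl
    rw [e]
    rw [RingHom.coe_coe, hC, hC]
    exact H
  refine exists_zero_eval 1 h2 ?_
  have e : (fun i => Polynomial.eval 1 ((Sum.elim (fun i => Polynomial.C (C (c i)))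
        (fun i => (Polynomial.C (C (g 1 / g 0)) * Polynomial.X ^ 2 +
          ∑ j : Fin m, Polynomial.C (C (g j.succ.succ / g 0)) * Polynomial.C (X j) ^ 2) *
            Polynomial.C (C (c i)))) i)) = (Sum.elim (fun i => C (c i)) (fun i => (C (g 1 / g 0) +
        ∑ j : Fin m, C (g j.succ.succ / g 0) * X j ^ 2) * C (c i)) :
          Fin 3 ⊕ Fin 3 → MvPolynomial (Fin m) F) := by
    funext i
    rcases i with i | i
    · simp only [Sum.elim_inl, Polynomial.eval_C]
    · simp only [Sum.elim_inr, Polynomial.eval_C, Polynomial.eval_mul, Polynomial.eval_add,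
        Polynomial.eval_finsetSum, Polynomial.eval_pow, Polynomial.eval_X, one_pow, mul_one]
  rw [e, Polynomial.eval_C, Polynomial.eval_C]
  exact H

theorem not_gAnis_polynomial {φ : QuadraticForm F (Fin 5 → F)}
    {ψ : QuadraticForm F (Fin 3 → F)} (hψ : ψ.Anisotropic)
    (h : ¬ (extendQF F (funFieldMap F ψ) φ).Anisotropic)
    {a b : F} {c : Fin 3 → F} (hP : Presents φ a b c) {g : Fin 3 → F} (hg : DiagPresents ψ g) :
    ¬ GAnis (Polynomial.C a) (Polynomial.C b) (Sum.elim (fun i => Polynomial.C (c i))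
      (fun i => (Polynomial.C (g 1 / g 0) + Polynomial.C (g 2 / g 0) * Polynomial.X ^ 2) *
        Polynomial.C (c i))) := by
  intro H
  refine not_gAnis_dehomogenized (m := 1) hψ h hP hg (GAnis.of_injective
    (f := (uniqueAlgEquiv F (Fin 1) : MvPolynomial (Fin 1) F →+* Polynomial F))
      (uniqueAlgEquiv F (Fin 1)).injective ?_)
  convert H using 1
  · simp
  · simp
  · funext i
    rcases i with i | i
    · simp
    · simp

theorem not_gAnis_polynomial_polynomial {φ : QuadraticForm F (Fin 5 → F)}
    {ψ : QuadraticForm F (Fin 4 → F)} (hψ : ψ.Anisotropic)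
    (h : ¬ (extendQF F (funFieldMap F ψ) φ).Anisotropic)
    {a b : F} {c : Fin 3 → F} (hP : Presents φ a b c) {g : Fin 4 → F} (hg : DiagPresents ψ g) :
    ¬ GAnis (Polynomial.C (Polynomial.C a)) (Polynomial.C (Polynomial.C b))
      (Sum.elim (fun i => Polynomial.C (Polynomial.C (c i)))
      (fun i => (Polynomial.C (Polynomial.C (g 1 / g 0)) +
        Polynomial.C (Polynomial.C (g 2 / g 0)) * Polynomial.X ^ 2 +
        Polynomial.C (Polynomial.C (g 3 / g 0) * Polynomial.X ^ 2)) *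
        Polynomial.C (Polynomial.C (c i)))) := by
  intro H
  refine not_gAnis_dehomogenized (m := 2) hψ h hP hg (GAnis.of_injective
    (f := (Polynomial.mapRingHom (uniqueAlgEquiv F (Fin 1) :
      MvPolynomial (Fin 1) F →+* Polynomial F)).comp
        (finSuccEquiv F 1 : MvPolynomial (Fin 2) F →+* Polynomial (MvPolynomial (Fin 1) F)))
      ((Polynomial.map_injective _ (uniqueAlgEquiv F (Fin 1)).injective).comp
        (finSuccEquiv F 1).injective) ?_)
  have hC : ∀ x : F, finSuccEquiv F 1 (C x) = Polynomial.C (C x) := fun x =>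
    (finSuccEquiv F 1).commutes x
  have h1 : finSuccEquiv F 1 (X 1) = Polynomial.C (X 0) := finSuccEquiv_X_succ (j := 0)
  convert H using 1
  · simp [hC]
  · simp [hC]
  · funext i
    rcases i with i | i
    · simp [hC]
    · simp [hC, Fin.sum_univ_succ, h1, finSuccEquiv_X_zero, add_assoc]

end Specialization

section Biquadratic

variable {F : Type} [Field F] [CharP F 2]

/-- The form `[a,b] ⊥ ⟨c⟩ ⊥ (x + yX²)⟨c⟩` is isotropic over `F[X]`. -/
def TriIsotropic (a b : F) (c : Fin 3 → F) (x y : F) : Prop :=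
  ¬ GAnis (Polynomial.C a) (Polynomial.C b) (Sum.elim (fun i => Polynomial.C (c i))
    (fun i => (Polynomial.C x + Polynomial.C y * Polynomial.X ^ 2) * Polynomial.C (c i)))

/-- `[a,b]` represents no element of `F²(p,e)`. -/
def AvoidsBiq (a b p e : F) : Prop :=
  ∀ η₀ η₁ : F, (η₀ ≠ 0 ∨ η₁ ≠ 0) → a * η₀ ^ 2 + η₀ * η₁ + b * η₁ ^ 2 ∉ biq p e

/-- The Frobenius map of `F` into `F²(p,e)`. -/
noncomputable def frobBiq (p e : F) : F →+* biq p e :=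
  (frobenius F 2).codRestrict (biq p e) fun x => sq_mem_biq p e x

theorem coe_frobBiq (p e x : F) : (frobBiq p e x : F) = x ^ 2 := rfl

instance (p e : F) : CharP (biq p e) 2 :=
  RingHom.charP (biq p e).subtype Subtype.val_injective 2

variable {a b p e x y : F}

theorem AvoidsBiq.gAnis (h : AvoidsBiq a b p e) :
    GAnis (frobBiq p e a) (frobBiq p e b) (fun _ : Unit => 1) := by
  intro v hv
  have two : (2 : F) = 0 := CharTwo.two_eq_zero
  obtain ⟨l, hl⟩ : ∃ l : F, l = (v (.inl 0)).1 := ⟨_, rfl⟩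
  obtain ⟨m, hm⟩ : ∃ m : F, m = (v (.inl 1)).1 := ⟨_, rfl⟩
  obtain ⟨r, hr⟩ : ∃ r : F, r = (v (.inr ())).1 := ⟨_, rfl⟩
  have h1 : a ^ 2 * l ^ 2 + l * m + b ^ 2 * m ^ 2 + r ^ 2 = 0 := by
    have := congrArg (Subtype.val) hv
    simpa [gq, coe_frobBiq, hl, hm, hr] using this
  have hl0 : l = 0 := by
    by_contra hl0
    apply h 1 ((a * l + b * m + r) / l) (Or.inl one_ne_zero)
    have h2 : m = ((a * l + b * m + r) / l) ^ 2 * l := by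
      field_simp
      linear_combination h1 - (a ^ 2 * l ^ 2 + b ^ 2 * m ^ 2 + r ^ 2 +
        a * l * b * m + a * l * r + b * m * r) * two
    have h3 : a * 1 ^ 2 + 1 * ((a * l + b * m + r) / l) + b * ((a * l + b * m + r) / l) ^ 2 =
        r / l := by
      have : ((a * l + b * m + r) / l) ^ 2 = m / l := by
        rw [eq_div_iff hl0]; exact h2.symm
      rw [this]
      field_simp
      linear_combination (a * l + b * m) * two
    rw [h3, hr, hl]
    exact div_mem (v (.inr ())).2 (v (.inl 0)).2
  have hm0 : m = 0 := by
    by_contra hm0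
    apply h 0 1 (Or.inr one_ne_zero)
    have h2 : (b * m) ^ 2 = r ^ 2 := by
      rw [hl0] at h1
      linear_combination h1 - r ^ 2 * two
    have h3 : b * m = r := by
      have : (b * m + r) ^ 2 = 0 := by rw [CharTwo.add_sq, h2]; exact CharTwo.add_self_eq_zero _
      exact CharTwo.add_eq_zero.1 (pow_eq_zero_iff two_ne_zero |>.1 this)
    have h4 : a * 0 ^ 2 + 0 * 1 + b * 1 ^ 2 = r / m := by
      rw [eq_div_iff hm0]; linear_combination h3
    rw [h4, hr, hm]
    exact div_mem (v (.inr ())).2 (v (.inl 1)).2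
  have hr0 : r = 0 := by
    rw [hl0, hm0] at h1
    simpa using h1
  funext i
  rcases i with i | i
  · fin_cases i
    · exact Subtype.ext (hl.symm.trans hl0)
    · exact Subtype.ext (hm.symm.trans hm0)
  · exact Subtype.ext (hr.symm.trans hr0)

/-- The polynomial `∑ cᵢ rᵢ^{(2)}` for `c = (1,p,e)`, where `r^{(2)}` is the coefficientwise
Frobenius twist of `r`. -/
noncomputable def twistSum (p e : F) (r : Fin 3 → Polynomial F) : Polynomial (biq p e) :=
  (r 0).map (frobBiq p e) + Polynomial.C ⟨p, left_mem_biq p e⟩ * (r 1).map (frobBiq p e) +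
    Polynomial.C ⟨e, right_mem_biq p e⟩ * (r 2).map (frobBiq p e)

theorem twistSum_eq_zero (hc : SqIndep ![1, p, e]) {r : Fin 3 → Polynomial F}
    (h : twistSum p e r = 0) : r = 0 := by
  funext i
  refine Polynomial.ext fun n => ?_
  have h1 := congrArg (fun f => ((Polynomial.coeff f n : biq p e) : F)) h
  simp [twistSum, coe_frobBiq] at h1
  have h2 := hc (fun i => (r i).coeff n) (by simp [Fin.sum_univ_three]; linear_combination h1)
  simpa using congrFun h2 i

theorem frobBiq_equation {v : Fin 2 ⊕ (Fin 3 ⊕ Fin 3) → Polynomial F}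
    (hv : gq (Polynomial.C a) (Polynomial.C b) (Sum.elim (fun i => Polynomial.C (![1, p, e] i))
      (fun i => (Polynomial.C x + Polynomial.C y * Polynomial.X ^ 2) *
        Polynomial.C (![1, p, e] i))) v = 0) :
    Polynomial.C (frobBiq p e a) * (v (.inl 0)).map (frobBiq p e) ^ 2 +
      (v (.inl 0)).map (frobBiq p e) * (v (.inl 1)).map (frobBiq p e) +
      Polynomial.C (frobBiq p e b) * (v (.inl 1)).map (frobBiq p e) ^ 2 +
      twistSum p e (fun i => v (.inr (.inl i))) ^ 2 +
      (Polynomial.C (frobBiq p e x) + Polynomial.C (frobBiq p e y) * Polynomial.X ^ 2) *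
        twistSum p e (fun i => v (.inr (.inr i))) ^ 2 = 0 := by
  have h1 := congrArg (Polynomial.map (frobBiq p e)) hv
  have hp : Polynomial.C (frobBiq p e p) = Polynomial.C ⟨p, left_mem_biq p e⟩ ^ 2 := by
    rw [← Polynomial.C_pow]; rfl
  have he : Polynomial.C (frobBiq p e e) = Polynomial.C ⟨e, right_mem_biq p e⟩ ^ 2 := by
    rw [← Polynomial.C_pow]; rfl
  simp [gq, Fin.sum_univ_three] at h1
  rw [hp, he] at h1
  simp only [twistSum, CharTwo.add_sq]
  linear_combination h1

theorem TriIsotropic.exists_eq (hc : SqIndep ![1, p, e]) (ha : AvoidsBiq a b p e)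
    (hx : x ∉ biq p e) (h : TriIsotropic a b ![1, p, e] x y) :
    ∃ P ∈ biq p e, ∃ Q ∈ biq p e, y = P + Q * x := by
  have two : (2 : F) = 0 := CharTwo.two_eq_zero
  simp only [TriIsotropic, GAnis, not_forall] at h
  obtain ⟨v, hv, h0⟩ := h
  have h1 := frobBiq_equation hv
  have hne : (Sum.elim (fun i => (v (.inl i)).map (frobBiq p e))
      (fun _ => twistSum p e (fun i => v (.inr (.inl i)))) :
      Fin 2 ⊕ Unit → Polynomial (biq p e)) ≠ 0 ∨
      twistSum p e (fun i => v (.inr (.inr i))) ≠ 0 := by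
    by_contra hcon
    push Not at hcon
    obtain ⟨hc1, hc2⟩ := hcon
    apply h0
    funext i
    rcases i with i | i | i
    · have : (v (.inl i)).map (frobBiq p e) = 0 := congrFun hc1 (.inl i)
      exact (Polynomial.map_eq_zero (frobBiq p e)).1 this
    · have : twistSum p e (fun i => v (.inr (.inl i))) = 0 := congrFun hc1 (.inr ())
      exact congrFun (twistSum_eq_zero hc this) i
    · exact congrFun (twistSum_eq_zero hc hc2) i
  obtain ⟨w₀, w₁, e0, e1, eB⟩ := ha.gAnis.represents (frobBiq p e x) (frobBiq p e y) _ _ hne (by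
    rw [← h1]; simp [gq])
  replace e0 := congrArg Subtype.val e0
  replace e1 := congrArg Subtype.val e1
  replace eB := congrArg Subtype.val eB
  simp [gq, coe_frobBiq] at e0 e1 eB
  have hα₀ := (w₀ (.inl 0)).2
  generalize (w₀ (.inl 0)).1 = α₀ at e0 e1 eB hα₀
  have hβ₀ := (w₀ (.inl 1)).2
  generalize (w₀ (.inl 1)).1 = β₀ at e0 e1 eB hβ₀
  have hγ₀ := (w₀ (.inr ())).2
  generalize (w₀ (.inr ())).1 = γ₀ at e0 e1 eB hγ₀
  have hα₁ := (w₁ (.inl 0)).2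
  generalize (w₁ (.inl 0)).1 = α₁ at e0 e1 eB hα₁
  have hβ₁ := (w₁ (.inl 1)).2
  generalize (w₁ (.inl 1)).1 = β₁ at e0 e1 eB hβ₁
  have hγ₁ := (w₁ (.inr ())).2
  generalize (w₁ (.inr ())).1 = γ₁ at e0 e1 eB hγ₁
  have sq_inj : ∀ {s t : F}, s ^ 2 = t ^ 2 → s = t := fun {s t} hst => by
    have : (s + t) ^ 2 = 0 := by rw [CharTwo.add_sq, hst]; exact CharTwo.add_self_eq_zero _
    exact CharTwo.add_eq_zero.1 (pow_eq_zero_iff two_ne_zero |>.1 this)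
  by_cases hα : α₀ = 0
  · subst hα
    have hβ : β₀ ≠ 0 := by
      rintro rfl
      exact hx (by rw [← sq_inj (s := γ₀) (t := x) (by linear_combination e0)]; exact hγ₀)
    have hα1 : α₁ = 0 := by
      have : β₀ * α₁ = 0 := by linear_combination eB
      exact (mul_eq_zero.1 this).resolve_left hβ
    subst hα1
    have hx' : x = b * β₀ + γ₀ := sq_inj (by
      rw [CharTwo.add_sq]; linear_combination -e0)
    have hy' : y = b * β₁ + γ₁ := sq_inj (by
      rw [CharTwo.add_sq]; linear_combination -e1)
    refine ⟨γ₁ - β₁ / β₀ * γ₀, sub_mem hγ₁ (mul_mem (div_mem hβ₁ hβ₀) hγ₀), β₁ / β₀,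
      div_mem hβ₁ hβ₀, ?_⟩
    rw [hx', hy']
    field_simp
    ring
  · set h := (a * α₀ + b * β₀ + γ₀ + x) / α₀ with hh
    have hb : β₀ = h ^ 2 * α₀ := by
      rw [hh]
      field_simp
      linear_combination e0 - (a ^ 2 * α₀ ^ 2 + b ^ 2 * β₀ ^ 2 + γ₀ ^ 2 + x * (a * α₀ + b * β₀ + γ₀)
        + a * α₀ * b * β₀ + a * α₀ * γ₀ + b * β₀ * γ₀) * two
    have hb1 : β₁ = h ^ 2 * α₁ := by
      have : α₀ * (β₁ + h ^ 2 * α₁) = 0 := by rw [hb] at eB; linear_combination eB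
      exact CharTwo.add_eq_zero.1 ((mul_eq_zero.1 this).resolve_left hα)
    have hx' : x = (a + h + b * h ^ 2) * α₀ + γ₀ := sq_inj (by
      rw [hb] at e0
      simp only [CharTwo.add_sq, mul_pow]; linear_combination -e0)
    have hy' : y = (a + h + b * h ^ 2) * α₁ + γ₁ := sq_inj (by
      rw [hb1] at e1
      simp only [CharTwo.add_sq, mul_pow]; linear_combination -e1)
    refine ⟨γ₁ - α₁ / α₀ * γ₀, sub_mem hγ₁ (mul_mem (div_mem hα₁ hα₀) hγ₀), α₁ / α₀,
      div_mem hα₁ hα₀, ?_⟩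
    have : α₁ / α₀ * x = (a + h + b * h ^ 2) * α₁ + α₁ / α₀ * γ₀ := by
      conv_lhs => rw [hx']
      field_simp
    rw [this, hy']
    ring

end Biquadratic

section IndependentTriples

variable {F : Type} [Field F] [CharP F 2] {a b p e x y : F}

theorem TriIsotropic.exists_presents {V : Type} [AddCommGroup V] [Module F V]
    {φ : QuadraticForm F V} (hφ : φ.Anisotropic) (hP : Presents φ a b ![1, p, e])
    (ha : AvoidsBiq a b p e) (hx : x ∉ biq p e) (h : TriIsotropic a b ![1, p, e] x y) :
    ∃ (b' : F) (r : Fin 3 → F), r ≠ 0 ∧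
      Presents φ (x * (r 0 ^ 2 + p * r 1 ^ 2 + e * r 2 ^ 2)) b' ![1, p, e] := by
  have two : (2 : F) = 0 := CharTwo.two_eq_zero
  have hc := (hP.gAnis hφ).sqIndep
  have h1 := exists_zero_eval (0 : F) h
  simp only [GAnis, not_forall] at h1
  obtain ⟨v, hv, h0⟩ := h1
  have h2 : a * v (.inl 0) ^ 2 + v (.inl 0) * v (.inl 1) + b * v (.inl 1) ^ 2 +
      (v (.inr (.inl 0)) ^ 2 + p * v (.inr (.inl 1)) ^ 2 + e * v (.inr (.inl 2)) ^ 2) +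
      x * (v (.inr (.inr 0)) ^ 2 + p * v (.inr (.inr 1)) ^ 2 + e * v (.inr (.inr 2)) ^ 2) = 0 := by
    simp [gq, Fin.sum_univ_three] at hv
    linear_combination hv
  have mem : ∀ r : Fin 3 → F, r 0 ^ 2 + p * r 1 ^ 2 + e * r 2 ^ 2 ∈ biq p e := fun r =>
    ⟨r 0, r 1, r 2, 0, by ring⟩
  set r₁ : Fin 3 → F := fun i => v (.inr (.inl i)) with hr₁
  set r₂ : Fin 3 → F := fun i => v (.inr (.inr i)) with hr₂
  have h3 : a * v (.inl 0) ^ 2 + v (.inl 0) * v (.inl 1) + b * v (.inl 1) ^ 2 +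
      (r₁ 0 ^ 2 + p * r₁ 1 ^ 2 + e * r₁ 2 ^ 2) =
      x * (r₂ 0 ^ 2 + p * r₂ 1 ^ 2 + e * r₂ 2 ^ 2) := by
    linear_combination h2 - x * (r₂ 0 ^ 2 + p * r₂ 1 ^ 2 + e * r₂ 2 ^ 2) * two
  have zero_of : ∀ r : Fin 3 → F, r 0 ^ 2 + p * r 1 ^ 2 + e * r 2 ^ 2 = 0 → r = 0 := fun r hr =>
    hc r (by simp [Fin.sum_univ_three]; linear_combination hr)
  by_cases hη : v (.inl 0) ≠ 0 ∨ v (.inl 1) ≠ 0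
  · obtain ⟨b', hb'⟩ := hP.twist hφ hη r₁
    refine ⟨b', r₂, ?_, ?_⟩
    · intro hr
      apply ha _ _ hη
      have : a * v (.inl 0) ^ 2 + v (.inl 0) * v (.inl 1) + b * v (.inl 1) ^ 2 =
          r₁ 0 ^ 2 + p * r₁ 1 ^ 2 + e * r₁ 2 ^ 2 := by
        simp only [hr, Pi.zero_apply] at h3
        linear_combination h3 - (r₁ 0 ^ 2 + p * r₁ 1 ^ 2 + e * r₁ 2 ^ 2) * two
      rw [this]
      exact mem r₁
    · convert hb' using 1
      simp [Fin.sum_univ_three]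
      linear_combination -h3
  · push Not at hη
    obtain ⟨e0, e1⟩ := hη
    simp only [e0, e1] at h3
    by_cases hr : r₂ = 0
    · exfalso
      apply h0
      have hr' : r₁ = 0 := zero_of r₁ (by
        simp only [hr, Pi.zero_apply] at h3
        linear_combination h3)
      funext i
      rcases i with i | i | i
      · fin_cases i
        · exact e0
        · exact e1
      · exact congrFun hr' i
      · exact congrFun hr i
    · exfalso
      have hne : r₂ 0 ^ 2 + p * r₂ 1 ^ 2 + e * r₂ 2 ^ 2 ≠ 0 := fun h => hr (zero_of _ h)
      apply hx
      have : x = (r₁ 0 ^ 2 + p * r₁ 1 ^ 2 + e * r₁ 2 ^ 2) /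
          (r₂ 0 ^ 2 + p * r₂ 1 ^ 2 + e * r₂ 2 ^ 2) := by
        rw [eq_div_iff hne]; linear_combination -h3
      rw [this]
      exact div_mem (mem _) (mem _)

theorem SqIndep.false_of_mul_mem {g : Fin 4 → F} (hg : SqIndep g) {z : F} (hz : z ≠ 0)
    {c : Fin 3 → F} (m : Fin 4 → Fin 3 → F) (hm : ∀ i, z * g i = ∑ j, m i j ^ 2 * c j) :
    False := by
  obtain ⟨r, hr, hr0⟩ : ∃ r : Fin 4 → F, (∀ j, ∑ i, r i * m i j = 0) ∧ r ≠ 0 := by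
    have := LinearMap.ker_ne_bot_of_finrank_lt (f := (Matrix.of m).vecMulLinear) (by simp)
    obtain ⟨r, hr, hr0⟩ := Submodule.exists_mem_ne_zero_of_ne_bot this
    refine ⟨r, fun j => ?_, hr0⟩
    have := congrFun (LinearMap.mem_ker.1 hr) j
    simpa [Matrix.vecMul, dotProduct] using this
  apply hr0
  apply hg
  have h1 : z * ∑ i, g i * r i ^ 2 = ∑ j, (∑ i, r i * m i j) ^ 2 * c j := by
    simp only [CharTwo.sum_sq, Finset.sum_mul, Finset.mul_sum]
    rw [Finset.sum_comm]
    refine Finset.sum_congr rfl fun i _ => ?_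
    have : ∑ j, (r i * m i j) ^ 2 * c j = r i ^ 2 * ∑ j, m i j ^ 2 * c j := by
      rw [Finset.mul_sum]; exact Finset.sum_congr rfl fun j _ => by ring
    rw [this, ← hm]; ring
  simp only [hr] at h1
  simpa [hz] using h1

theorem exists_eq_mul_add {Q : F} (hQ : Q ≠ 0) (f : Polynomial F) :
    ∃ (f' : Polynomial F) (u v : F), f = (1 + Polynomial.C Q * Polynomial.X ^ 2) * f' +
      (Polynomial.C u + Polynomial.C v * Polynomial.X) := by
  set ϖ : Polynomial F := 1 + Polynomial.C Q * Polynomial.X ^ 2 with hϖ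
  have hd : ϖ.natDegree = 2 := by rw [hϖ]; compute_degree!
  have h0 : ϖ ≠ 0 := by rintro h; rw [h] at hd; simp at hd
  have h1 : (f % ϖ).natDegree ≤ 1 := by
    have := Polynomial.natDegree_mod_lt f (q := ϖ) (by omega)
    omega
  obtain ⟨v, u, h⟩ := Polynomial.exists_eq_X_add_C_of_natDegree_le_one h1
  refine ⟨f / ϖ, u, v, ?_⟩
  conv_lhs => rw [← EuclideanDomain.div_add_mod f ϖ, h]
  ring

theorem twistSum_mul_add (f : Polynomial F) (g : Fin 3 → Polynomial F) (u v : Fin 3 → F) :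
    twistSum p e (fun i => f * g i + (Polynomial.C (u i) + Polynomial.C (v i) * Polynomial.X)) =
      f.map (frobBiq p e) * twistSum p e g +
      (Polynomial.C (frobBiq p e (u 0) + ⟨p, left_mem_biq p e⟩ * frobBiq p e (u 1) +
        ⟨e, right_mem_biq p e⟩ * frobBiq p e (u 2)) +
      Polynomial.C (frobBiq p e (v 0) + ⟨p, left_mem_biq p e⟩ * frobBiq p e (v 1) +
        ⟨e, right_mem_biq p e⟩ * frobBiq p e (v 2)) * Polynomial.X) := by
  simp only [twistSum, Polynomial.map_add, Polynomial.map_mul, Polynomial.map_C,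
    Polynomial.map_X, map_add, map_mul]
  ring

/-- The remainders of a solution modulo `1 + QX²` satisfy linear relations. -/
theorem remainder_relations {ℓ : Type} [Field ℓ] [CharP ℓ 2] {A B X₂ P Q U₁ V₁ U₂ V₂ : ℓ}
    (hQ : Q ≠ 0) (hAB : GAnis A B (fun _ : Unit => 1))
    {H₀ H₁ ρ₁ ρ₂ W₀ W₁ G₁ G₂ : Polynomial ℓ} {s₀ t₀ s₁ t₁ : ℓ}
    (hst₀ : s₀ + t₀ * Q⁻¹ = 0 → s₀ = 0 ∧ t₀ = 0) (hst₁ : s₁ + t₁ * Q⁻¹ = 0 → s₁ = 0 ∧ t₁ = 0)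
    (hx : ∀ u v : ℓ, u ^ 2 + X₂ * v ^ 2 = 0 → u = 0 ∧ v = 0)
    (hH₀ : H₀ = (1 + Polynomial.C Q * Polynomial.X) ^ 2 * W₀ +
      (Polynomial.C s₀ + Polynomial.C t₀ * Polynomial.X))
    (hH₁ : H₁ = (1 + Polynomial.C Q * Polynomial.X) ^ 2 * W₁ +
      (Polynomial.C s₁ + Polynomial.C t₁ * Polynomial.X))
    (hρ₁ : ρ₁ = (1 + Polynomial.C Q * Polynomial.X) ^ 2 * G₁ +
      (Polynomial.C U₁ + Polynomial.C V₁ * Polynomial.X))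
    (hρ₂ : ρ₂ = (1 + Polynomial.C Q * Polynomial.X) ^ 2 * G₂ +
      (Polynomial.C U₂ + Polynomial.C V₂ * Polynomial.X))
    (h : Polynomial.C A * H₀ ^ 2 + H₀ * H₁ + Polynomial.C B * H₁ ^ 2 + ρ₁ ^ 2 +
      (Polynomial.C X₂ + (Polynomial.C P ^ 2 + Polynomial.C Q ^ 2 * Polynomial.C X₂) *
        Polynomial.X ^ 2) * ρ₂ ^ 2 = 0) :
    s₀ = 0 ∧ t₀ = 0 ∧ s₁ = 0 ∧ t₁ = 0 ∧ V₂ = Q * U₂ ∧ V₁ = P * U₂ ∧ V₁ = Q * U₁ := by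
  have two : (2 : ℓ) = 0 := CharTwo.two_eq_zero
  have two' : (2 : Polynomial ℓ) = 0 := CharTwo.two_eq_zero
  have hev : (1 + Polynomial.C Q * Polynomial.X : Polynomial ℓ).eval Q⁻¹ = 0 := by
    simp [mul_inv_cancel₀ hQ]; linear_combination two
  have h' : Polynomial.C A * H₀ ^ 2 + H₀ * H₁ + Polynomial.C B * H₁ ^ 2 +
      (ρ₁ + Polynomial.C P * Polynomial.X * ρ₂) ^ 2 +
      Polynomial.C X₂ * ((1 + Polynomial.C Q * Polynomial.X) * ρ₂) ^ 2 = 0 := by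
    linear_combination h + (Polynomial.C P * Polynomial.X * ρ₁ * ρ₂ +
      Polynomial.C X₂ * Polynomial.C Q * Polynomial.X * ρ₂ ^ 2) * two'
  have e0 : H₀.eval Q⁻¹ = s₀ + t₀ * Q⁻¹ := by simp [hH₀, mul_inv_cancel₀ hQ, CharTwo.add_self_eq_zero]
  have e1 : H₁.eval Q⁻¹ = s₁ + t₁ * Q⁻¹ := by simp [hH₁, mul_inv_cancel₀ hQ, CharTwo.add_self_eq_zero]
  have e2 : ρ₁.eval Q⁻¹ = U₁ + V₁ * Q⁻¹ := by simp [hρ₁, mul_inv_cancel₀ hQ, CharTwo.add_self_eq_zero]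
  have e3 : ρ₂.eval Q⁻¹ = U₂ + V₂ * Q⁻¹ := by simp [hρ₂, mul_inv_cancel₀ hQ, CharTwo.add_self_eq_zero]
  have h2 := congrArg (Polynomial.eval Q⁻¹) h'
  have h3 := hAB (Sum.elim ![H₀.eval Q⁻¹, H₁.eval Q⁻¹]
    (fun _ => (ρ₁ + Polynomial.C P * Polynomial.X * ρ₂).eval Q⁻¹)) (by
      rw [Polynomial.eval_zero] at h2
      rw [← h2]
      simp [gq, mul_inv_cancel₀ hQ, CharTwo.add_self_eq_zero])
  obtain ⟨rfl, rfl⟩ := hst₀ (e0.symm.trans (congrFun h3 (.inl 0)))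
  obtain ⟨rfl, rfl⟩ := hst₁ (e1.symm.trans (congrFun h3 (.inl 1)))
  have h4 : (ρ₁ + Polynomial.C P * Polynomial.X * ρ₂).eval Q⁻¹ = 0 := congrFun h3 (.inr ())
  simp only [Polynomial.eval_add, Polynomial.eval_mul, Polynomial.eval_C, Polynomial.eval_X,
    e2, e3] at h4
  have h5 : Q ^ 2 * U₁ + Q * V₁ + P * (Q * U₂ + V₂) = 0 := by
    have : Q ^ 2 * (U₁ + V₁ * Q⁻¹ + P * Q⁻¹ * (U₂ + V₂ * Q⁻¹)) = 0 := by rw [h4, mul_zero]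
    field_simp at this
    linear_combination this
  have h5' := congrArg (Polynomial.C : ℓ →+* Polynomial ℓ) h5
  simp only [map_add, map_mul, map_pow, map_zero] at h5'
  set π : Polynomial ℓ := 1 + Polynomial.C Q * Polynomial.X with hπ
  have hπ0 : π ≠ 0 := by
    intro h
    have := congrArg (Polynomial.eval 0) h
    simp [hπ] at this
  set ζ : Polynomial ℓ := π * (G₁ + Polynomial.C P * Polynomial.X * G₂) + (Polynomial.C U₁ +
    (Polynomial.C V₁ + Polynomial.C P * Polynomial.C U₂ + Polynomial.C Q * Polynomial.C U₁) *
      Polynomial.X) with hζ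
  have h6 : ρ₁ + Polynomial.C P * Polynomial.X * ρ₂ = π * ζ := by
    rw [hρ₁, hρ₂, hζ, hπ]
    linear_combination -Polynomial.X ^ 2 * h5' + (Polynomial.X ^ 2 * Polynomial.C P *
      Polynomial.C V₂ - Polynomial.C Q * Polynomial.C U₁ * Polynomial.X) * two'
  have h7 : π ^ 2 * (π ^ 2 * (Polynomial.C A * W₀ ^ 2 + W₀ * W₁ + Polynomial.C B * W₁ ^ 2) +
      ζ ^ 2 + Polynomial.C X₂ * ρ₂ ^ 2) = 0 := by
    rw [h6, hH₀, hH₁] at h'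
    simp only [map_zero, zero_mul, add_zero] at h'
    linear_combination h'
  have h8 := congrArg (Polynomial.eval Q⁻¹) ((mul_eq_zero.1 h7).resolve_left (pow_ne_zero 2 hπ0))
  have e4 : ζ.eval Q⁻¹ = (V₁ + P * U₂) * Q⁻¹ := by
    simp [hζ, hev]
    field_simp
    linear_combination Q * U₁ * two
  simp only [Polynomial.eval_add, Polynomial.eval_mul, Polynomial.eval_pow, hev, Polynomial.eval_C,
    e3, e4, Polynomial.eval_zero] at h8
  obtain ⟨h9, h10⟩ := hx ((V₁ + P * U₂) * Q⁻¹) (U₂ + V₂ * Q⁻¹) (by linear_combination h8)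
  have h11 : V₁ + P * U₂ = 0 := (mul_eq_zero.1 h9).resolve_right (inv_ne_zero hQ)
  have h12 : V₂ = Q * U₂ := by
    field_simp at h10
    linear_combination h10 - Q * U₂ * two
  refine ⟨rfl, rfl, rfl, rfl, h12, by linear_combination h11 - P * U₂ * two, ?_⟩
  rw [h12] at h5
  have h13 : Q * (V₁ + Q * U₁) = 0 := by linear_combination h5 - P * Q * U₂ * two
  linear_combination (mul_eq_zero.1 h13).resolve_left hQ - Q * U₁ * two

end IndependentTriples

section Independence

variable {F : Type} [Field F] [CharP F 2] {a b p e x y : F}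

theorem TriIsotropic.not_sqIndep (hc : SqIndep ![1, p, e]) (ha : AvoidsBiq a b p e)
    (hx : x ∉ biq p e) {P Q : F} (hP : P ∈ biq p e) (hQ : Q ∈ biq p e)
    (h : TriIsotropic a b ![1, p, e] x (P + Q * x)) : ¬ SqIndep ![1, P, Q, P * Q] := by
  intro hPQ
  have two : (2 : F) = 0 := CharTwo.two_eq_zero
  have hQ0 : Q ≠ 0 := by simpa using hPQ.ne_zero 2
  have sq_inj : ∀ {s t : F}, s ^ 2 = t ^ 2 → s = t := fun {s t} hst => by
    have : (s + t) ^ 2 = 0 := by rw [CharTwo.add_sq, hst]; exact CharTwo.add_self_eq_zero _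
    exact CharTwo.add_eq_zero.1 (pow_eq_zero_iff two_ne_zero |>.1 this)
  set ϖ : Polynomial F := 1 + Polynomial.C Q * Polynomial.X ^ 2 with hϖ
  have hd : ϖ.natDegree = 2 := by rw [hϖ]; compute_degree!
  have hϖ0 : ϖ ≠ 0 := by rintro h; rw [h] at hd; simp at hd
  have hmapϖ : ϖ.map (frobBiq p e) =
      (1 + Polynomial.C (⟨Q, hQ⟩ : biq p e) * Polynomial.X) ^ 2 := by
    have : frobBiq p e Q = ⟨Q, hQ⟩ ^ 2 := rfl
    simp only [hϖ, Polynomial.map_add, Polynomial.map_one, Polynomial.map_mul, Polynomial.map_C,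
      Polynomial.map_pow, Polynomial.map_X, this, CharTwo.add_sq, map_pow]
    ring
  have hQindep : ∀ s t : F, (frobBiq p e s + frobBiq p e t * (⟨Q, hQ⟩ : biq p e)⁻¹ = 0) →
      frobBiq p e s = 0 ∧ frobBiq p e t = 0 := by
    intro s t h
    have h1 : s ^ 2 + t ^ 2 * Q⁻¹ = 0 := congrArg Subtype.val h
    field_simp at h1
    have h2 := hPQ ![t, 0, s, 0] (by simp [Fin.sum_univ_four]; linear_combination h1)
    have h3 : t = 0 := congrFun h2 0
    have h4 : s = 0 := congrFun h2 2
    simp [h3, h4]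
  have hxindep : ∀ u v : biq p e, u ^ 2 + frobBiq p e x * v ^ 2 = 0 → u = 0 ∧ v = 0 := by
    intro u v h
    have h1 : (u : F) ^ 2 + x ^ 2 * (v : F) ^ 2 = 0 := congrArg Subtype.val h
    have h2 : (u : F) = x * v := sq_inj (by linear_combination h1 - x ^ 2 * (v : F) ^ 2 * two)
    have hv : v = 0 := by
      by_contra hv
      have hv' : (v : F) ≠ 0 := fun h => hv (Subtype.ext h)
      apply hx
      have : x = u / v := by rw [eq_div_iff hv']; exact h2.symm
      rw [this]
      exact div_mem u.2 v.2
    refine ⟨Subtype.ext ?_, hv⟩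
    rw [h2, hv]; simp
  have key : ∀ v : Fin 2 ⊕ (Fin 3 ⊕ Fin 3) → Polynomial F,
      gq (Polynomial.C a) (Polynomial.C b) (Sum.elim (fun i => Polynomial.C (![1, p, e] i))
      (fun i => (Polynomial.C x + Polynomial.C (P + Q * x) * Polynomial.X ^ 2) *
        Polynomial.C (![1, p, e] i))) v = 0 → ∃ w : Fin 2 ⊕ (Fin 3 ⊕ Fin 3) → Polynomial F,
      ∀ i, v i = ϖ * w i := by
    intro v hv
    choose w s t hw using fun i => exists_eq_mul_add hQ0 (v i)
    have hρ : ∀ σ : Fin 3 → Fin 2 ⊕ (Fin 3 ⊕ Fin 3), twistSum p e (fun i => v (σ i)) = _ :=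
      fun σ => (congrArg _ (funext fun i => hw (σ i))).trans
        (twistSum_mul_add ϖ (fun i => w (σ i)) (fun i => s (σ i)) (fun i => t (σ i)))
    have hH : ∀ i, (v i).map (frobBiq p e) = ϖ.map (frobBiq p e) * (w i).map (frobBiq p e) +
        (Polynomial.C (frobBiq p e (s i)) + Polynomial.C (frobBiq p e (t i)) * Polynomial.X) := by
      intro i
      conv_lhs => rw [hw i]
      simp only [hϖ, Polynomial.map_add, Polynomial.map_mul, Polynomial.map_C, Polynomial.map_X]
    simp only [hmapϖ] at hρ hH
    have heq := frobBiq_equation hv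
    have hy : frobBiq p e (P + Q * x) = ⟨P, hP⟩ ^ 2 + ⟨Q, hQ⟩ ^ 2 * frobBiq p e x := by
      rw [map_add, map_mul]; rfl
    rw [hy, map_add, map_mul, map_pow, map_pow] at heq
    obtain ⟨h1, h2, h3, h4, h5, h6, h7⟩ := remainder_relations
      (fun h => hQ0 (congrArg Subtype.val h)) ha.gAnis (hQindep _ _) (hQindep _ _) hxindep
      (hH (.inl 0)) (hH (.inl 1)) (hρ fun i => .inr (.inl i)) (hρ fun i => .inr (.inr i)) heq
    replace h5 := congrArg Subtype.val h5
    replace h6 := congrArg Subtype.val h6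
    replace h7 := congrArg Subtype.val h7
    replace h1 : s (.inl 0) ^ 2 = 0 := congrArg Subtype.val h1
    replace h2 : t (.inl 0) ^ 2 = 0 := congrArg Subtype.val h2
    replace h3 : s (.inl 1) ^ 2 = 0 := congrArg Subtype.val h3
    replace h4 : t (.inl 1) ^ 2 = 0 := congrArg Subtype.val h4
    simp [coe_frobBiq] at h5 h6 h7
    set S : (Fin 2 ⊕ (Fin 3 ⊕ Fin 3) → F) → (Fin 3 → Fin 2 ⊕ (Fin 3 ⊕ Fin 3)) → F := fun f σ =>
      f (σ 0) ^ 2 + p * f (σ 1) ^ 2 + e * f (σ 2) ^ 2 with hS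
    have zero_of : ∀ f σ, S f σ = 0 → ∀ i, f (σ i) = 0 := fun f σ h =>
      congrFun (hc (fun i => f (σ i)) (by simp [Fin.sum_univ_three]; linear_combination h))
    change S t (fun i => .inr (.inr i)) = Q * S s (fun i => .inr (.inr i)) at h5
    change S t (fun i => .inr (.inl i)) = P * S s (fun i => .inr (.inr i)) at h6
    change S t (fun i => .inr (.inl i)) = Q * S s (fun i => .inr (.inl i)) at h7
    have hz : S s (fun i => .inr (.inr i)) = 0 := by
      by_contra hz
      refine hPQ.false_of_mul_mem hz ![fun i => s (.inr (.inr i)), fun i => t (.inr (.inl i)),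
        fun i => t (.inr (.inr i)), fun i => Q * s (.inr (.inl i))] (c := ![1, p, e]) ?_
      intro i
      fin_cases i <;> simp [Fin.sum_univ_three]
      · simp only [hS]; ring
      · rw [mul_comm, ← h6]; simp only [hS]; ring
      · rw [mul_comm, ← h5]; simp only [hS]; ring
      · have : S s (fun i => .inr (.inr i)) * (P * Q) = Q ^ 2 * S s (fun i => .inr (.inl i)) := by
          linear_combination Q * h7 - Q * h6
        rw [this]; simp only [hS]; ring
    have hz1 : S t (fun i => .inr (.inr i)) = 0 := by rw [h5, hz, mul_zero]
    have hz2 : S t (fun i => .inr (.inl i)) = 0 := by rw [h6, hz, mul_zero]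
    have hz3 : S s (fun i => .inr (.inl i)) = 0 := by
      rw [hz2] at h7
      exact (mul_eq_zero.1 h7.symm).resolve_left hQ0
    have hst : ∀ i, s i = 0 ∧ t i = 0 := by
      intro i
      rcases i with i | i | i
      · fin_cases i
        · exact ⟨pow_eq_zero_iff two_ne_zero |>.1 h1, pow_eq_zero_iff two_ne_zero |>.1 h2⟩
        · exact ⟨pow_eq_zero_iff two_ne_zero |>.1 h3, pow_eq_zero_iff two_ne_zero |>.1 h4⟩
      · exact ⟨zero_of s (fun i => .inr (.inl i)) hz3 i, zero_of t (fun i => .inr (.inl i)) hz2 i⟩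
      · exact ⟨zero_of s (fun i => .inr (.inr i)) hz i, zero_of t (fun i => .inr (.inr i)) hz1 i⟩
    refine ⟨w, fun i => ?_⟩
    have := hw i
    rw [(hst i).1, (hst i).2] at this
    rw [this]
    simp [hϖ]
  apply h
  have descent : ∀ (n : ℕ) (v : Fin 2 ⊕ (Fin 3 ⊕ Fin 3) → Polynomial F),
      (∀ i, (v i).natDegree ≤ n) →
      gq (Polynomial.C a) (Polynomial.C b) (Sum.elim (fun i => Polynomial.C (![1, p, e] i))
      (fun i => (Polynomial.C x + Polynomial.C (P + Q * x) * Polynomial.X ^ 2) *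
        Polynomial.C (![1, p, e] i))) v = 0 → v = 0 := by
    intro n
    induction n with
    | zero =>
      intro v hn hv
      obtain ⟨w, hw⟩ := key v hv
      funext i
      by_contra hi
      have hwi : w i ≠ 0 := fun h => hi (by rw [hw i, h, mul_zero]; rfl)
      have := hn i
      rw [hw i, Polynomial.natDegree_mul hϖ0 hwi, hd] at this
      omega
    | succ n ih =>
      intro v hn hv
      obtain ⟨w, hw⟩ := key v hv
      have hw0 : w = 0 := by
        refine ih w (fun i => ?_) (gq_eq_zero_of_mul hϖ0 hw hv)
        by_cases hwi : w i = 0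
        · simp [hwi]
        · have := hn i
          rw [hw i, Polynomial.natDegree_mul hϖ0 hwi, hd] at this
          omega
      funext i
      rw [hw i, hw0]; simp
  intro v hv
  exact descent (Finset.univ.sup fun i => (v i).natDegree) v
    (fun i => Finset.le_sup (f := fun i => (v i).natDegree) (Finset.mem_univ i)) hv

end Independence

section Lines

variable {F : Type} [Field F] [CharP F 2] {V : Type} [AddCommGroup V] [Module F V]

theorem linearIndependent_three {u₀ u₁ u₂ : V} :
    LinearIndependent F ![u₀, u₁, u₂] ↔ ∀ α β γ : F, α • u₀ + β • u₁ + γ • u₂ = 0 →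
      α = 0 ∧ β = 0 ∧ γ = 0 := by
  rw [Fintype.linearIndependent_iff]
  constructor
  · intro h α β γ h0
    have := h ![α, β, γ] (by simpa [Fin.sum_univ_three] using h0)
    exact ⟨this 0, this 1, this 2⟩
  · intro h g hg
    have := h (g 0) (g 1) (g 2) (by simpa [Fin.sum_univ_three] using hg)
    intro i
    fin_cases i
    exacts [this.1, this.2.1, this.2.2]

theorem linearIndependent_four {u₀ u₁ u₂ u₃ : V} :
    LinearIndependent F ![u₀, u₁, u₂, u₃] ↔
      ∀ α β γ δ : F, α • u₀ + β • u₁ + γ • u₂ + δ • u₃ = 0 →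
      α = 0 ∧ β = 0 ∧ γ = 0 ∧ δ = 0 := by
  rw [Fintype.linearIndependent_iff]
  constructor
  · intro h α β γ δ h0
    have := h ![α, β, γ, δ] (by simpa [Fin.sum_univ_four] using h0)
    exact ⟨this 0, this 1, this 2, this 3⟩
  · intro h g hg
    have := h (g 0) (g 1) (g 2) (g 3) (by simpa [Fin.sum_univ_four] using hg)
    intro i
    fin_cases i
    exacts [this.1, this.2.1, this.2.2.1, this.2.2.2]

theorem DiagPresents.map_add {s : ℕ} {ψ : QuadraticForm F (Fin s → F)} {g : Fin s → F}
    (h : DiagPresents ψ g) (v w : Fin s → F) : ψ (v + w) = ψ v + ψ w := by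
  obtain ⟨κ, hκ, T, hT, e⟩ := h
  have hs : Function.Surjective T := LinearMap.surjective_of_injective hT
  obtain ⟨v, rfl⟩ := hs v
  obtain ⟨w, rfl⟩ := hs w
  rw [← _root_.map_add T, e, e, e, ← mul_add, ← Finset.sum_add_distrib]
  congr 1
  refine Finset.sum_congr rfl fun i _ => ?_
  rw [Pi.add_apply, CharTwo.add_sq]; ring

theorem map_smul_sq (ψ : QuadraticForm F V) (r : F) (v : V) : ψ (r • v) = r ^ 2 * ψ v := by
  rw [QuadraticMap.map_smul, smul_eq_mul, _root_.sq]

theorem diagPresents_of_linearIndependent {ψ : QuadraticForm F V}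
    (hadd : ∀ v w, ψ (v + w) = ψ v + ψ w) {n : ℕ} {v : Fin n → V} (hv : LinearIndependent F v) :
    DiagPresents ψ (fun i => ψ (v i)) := by
  refine ⟨1, one_ne_zero, Fintype.linearCombination F v, ?_, fun x => ?_⟩
  · exact hv.fintypeLinearCombination_injective
  · rw [Fintype.linearCombination_apply, one_mul]
    have : ∀ t : Finset (Fin n), ψ (∑ i ∈ t, x i • v i) = ∑ i ∈ t, ψ (v i) * x i ^ 2 := by
      intro t
      induction t using Finset.induction_on with
      | empty => simp
      | insert i t hi ih =>
        rw [Finset.sum_insert hi, Finset.sum_insert hi, hadd, ih, map_smul_sq, mul_comm]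
    exact this _

/-- Every three independent values of `ψ` yield an isotropic form. -/
def TriProperty (a b : F) (c : Fin 3 → F) (ψ : QuadraticForm F V) : Prop :=
  ∀ v₀ v₁ v₂ : V, LinearIndependent F ![v₀, v₁, v₂] →
    TriIsotropic a b c (ψ v₁ / ψ v₀) (ψ v₂ / ψ v₀)

theorem TriProperty.exists_pair {ψ : QuadraticForm F V} (hψ : ψ.Anisotropic)
    (hadd : ∀ v w, ψ (v + w) = ψ v + ψ w) {a b p e : F} (hc : SqIndep ![1, p, e])
    (ha : AvoidsBiq a b p e) (h : TriProperty a b ![1, p, e] ψ) {u₀ u₁ u₂ : V}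
    (hu : LinearIndependent F ![u₀, u₁, u₂]) :
    ∃ α₀ α₁ α₂ β₀ β₁ β₂ : F, LinearIndependent F
      ![α₀ • u₀ + α₁ • u₁ + α₂ • u₂, β₀ • u₀ + β₁ • u₁ + β₂ • u₂] ∧
      ψ (β₀ • u₀ + β₁ • u₁ + β₂ • u₂) / ψ (α₀ • u₀ + α₁ • u₁ + α₂ • u₂) ∈ biq p e := by
  have two : (2 : F) = 0 := CharTwo.two_eq_zero
  have hu' := linearIndependent_three.1 hu
  have h0 : ψ u₀ ≠ 0 := fun h => hu.ne_zero 0 (hψ _ h)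
  have val : ∀ α β γ : F, ψ (α • u₀ + β • u₁ + γ • u₂) =
      α ^ 2 * ψ u₀ + β ^ 2 * ψ u₁ + γ ^ 2 * ψ u₂ := fun α β γ => by
    simp only [hadd, map_smul_sq]
  by_cases hx : ψ u₁ / ψ u₀ ∈ biq p e
  · refine ⟨1, 0, 0, 0, 1, 0, ?_, ?_⟩
    · rw [LinearIndependent.pair_iff]
      intro s t hst
      have := hu' s t 0 (by simpa using hst)
      exact ⟨this.1, this.2.1⟩
    · simpa using hx
  · obtain ⟨P, hP, Q, hQ, hy⟩ := (h _ _ _ hu).exists_eq hc ha hx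
    have hT := h _ _ _ hu
    rw [hy] at hT
    have hns := hT.not_sqIndep hc ha hx hP hQ
    have hy' : ψ u₂ = P * ψ u₀ + Q * ψ u₁ := by field_simp at hy; linear_combination hy
    simp only [SqIndep, not_forall] at hns
    obtain ⟨r, hr, hr0⟩ := hns
    simp [Fin.sum_univ_four] at hr
    by_cases hN : r 1 ^ 2 + Q * r 3 ^ 2 = 0
    · obtain ⟨t, ht⟩ : ∃ t, Q = t ^ 2 := by
        have hM : r 0 ^ 2 + Q * r 2 ^ 2 = 0 := by linear_combination hr - P * hN
        by_cases h3 : r 3 = 0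
        · by_cases h2 : r 2 = 0
          · exfalso
            apply hr0
            have h1 : r 1 = 0 := by simpa [h3] using hN
            have h4 : r 0 = 0 := by simpa [h2] using hM
            funext i; fin_cases i
            exacts [h4, h1, h2, h3]
          · refine ⟨r 0 / r 2, ?_⟩
            field_simp
            linear_combination hM - r 0 ^ 2 * two
        · refine ⟨r 1 / r 3, ?_⟩
          field_simp
          linear_combination hN - r 1 ^ 2 * two
      refine ⟨1, 0, 0, 0, t, 1, ?_, ?_⟩
      · rw [LinearIndependent.pair_iff]
        intro s s' hst
        have := hu' s (s' * t) s' (by rw [← hst]; module)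
        exact ⟨this.1, this.2.2⟩
      · rw [val, val]
        have : (0 ^ 2 * ψ u₀ + t ^ 2 * ψ u₁ + 1 ^ 2 * ψ u₂) /
            (1 ^ 2 * ψ u₀ + 0 ^ 2 * ψ u₁ + 0 ^ 2 * ψ u₂) = P := by
          rw [hy', ht, div_eq_iff (by simpa using h0)]
          linear_combination t ^ 2 * ψ u₁ * two
        rw [this]; exact hP
    · have hPe : P = ((r 0 * r 1 + Q * r 2 * r 3) / (r 1 ^ 2 + Q * r 3 ^ 2)) ^ 2 +
          Q * ((r 0 * r 3 + r 1 * r 2) / (r 1 ^ 2 + Q * r 3 ^ 2)) ^ 2 := by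
        field_simp
        linear_combination (r 1 ^ 2 + Q * r 3 ^ 2) * hr - (r 0 ^ 2 * r 1 ^ 2 + 
          Q * r 0 ^ 2 * r 3 ^ 2 + Q * r 1 ^ 2 * r 2 ^ 2 + Q ^ 2 * r 2 ^ 2 * r 3 ^ 2 + 
          2 * Q * r 0 * r 1 * r 2 * r 3) * two
      set p₀ := (r 0 * r 1 + Q * r 2 * r 3) / (r 1 ^ 2 + Q * r 3 ^ 2)
      set p₁ := (r 0 * r 3 + r 1 * r 2) / (r 1 ^ 2 + Q * r 3 ^ 2)
      refine ⟨p₁, 1, 0, p₀, 0, 1, ?_, ?_⟩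
      · rw [LinearIndependent.pair_iff]
        intro s s' hst
        have := hu' (s * p₁ + s' * p₀) s s' (by rw [← hst]; module)
        exact ⟨this.2.1, this.2.2⟩
      · rw [val, val]
        have hne : p₁ ^ 2 * ψ u₀ + 1 ^ 2 * ψ u₁ + 0 ^ 2 * ψ u₂ ≠ 0 := by
          rw [← val]
          intro h
          have := (hu' p₁ 1 0 (hψ _ h)).2.1
          exact one_ne_zero this
        have : (p₀ ^ 2 * ψ u₀ + 0 ^ 2 * ψ u₁ + 1 ^ 2 * ψ u₂) /
            (p₁ ^ 2 * ψ u₀ + 1 ^ 2 * ψ u₁ + 0 ^ 2 * ψ u₂) = Q := by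
          rw [div_eq_iff hne, hy', hPe]
          linear_combination p₀ ^ 2 * ψ u₀ * two
        rw [this]; exact hQ

/-- Vectors on two different lines over `F²(p,e)` are independent. -/
theorem linearIndependent_of_lines {ψ : QuadraticForm F V} (hψ : ψ.Anisotropic)
    (hadd : ∀ v w, ψ (v + w) = ψ v + ψ w) {p e A B : F} (hAB : A / B ∉ biq p e)
    {v v' u u' : V} (hv : LinearIndependent F ![v, v']) (hu : LinearIndependent F ![u, u'])
    (e₁ : ψ v / A ∈ biq p e) (e₂ : ψ v' / A ∈ biq p e) (e₃ : ψ u / B ∈ biq p e)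
    (e₄ : ψ u' / B ∈ biq p e) : LinearIndependent F ![v, v', u, u'] := by
  rw [linearIndependent_four]
  intro α β γ δ h
  rw [LinearIndependent.pair_iff] at hv hu
  have h1 : α • v + β • v' = -(γ • u + δ • u') := by
    rw [eq_neg_iff_add_eq_zero, ← h]; module
  have h2 : ψ (α • v + β • v') = ψ (γ • u + δ • u') := by rw [h1, QuadraticMap.map_neg]
  have hA : A ≠ 0 := by rintro rfl; exact hAB (by rw [zero_div]; exact zero_mem _)
  have hB : B ≠ 0 := by rintro rfl; exact hAB (by rw [div_zero]; exact zero_mem _)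
  have m1 : ψ (α • v + β • v') / A ∈ biq p e := by
    rw [hadd, map_smul_sq, map_smul_sq, add_div, mul_div_assoc, mul_div_assoc]
    exact add_mem (mul_mem (sq_mem_biq _ _ _) e₁) (mul_mem (sq_mem_biq _ _ _) e₂)
  have m2 : ψ (α • v + β • v') / B ∈ biq p e := by
    rw [h2, hadd, map_smul_sq, map_smul_sq, add_div, mul_div_assoc, mul_div_assoc]
    exact add_mem (mul_mem (sq_mem_biq _ _ _) e₃) (mul_mem (sq_mem_biq _ _ _) e₄)
  have h3 : ψ (α • v + β • v') = 0 := by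
    by_contra h3
    apply hAB
    have : A / B = (ψ (α • v + β • v') / B) / (ψ (α • v + β • v') / A) := by field_simp
    rw [this]
    exact div_mem m2 m1
  have h4 := hv _ _ (hψ _ h3)
  have h5 := hu _ _ (hψ _ (h2 ▸ h3))
  exact ⟨h4.1, h4.2, h5.1, h5.2⟩

end Lines

section NormDegree

variable {F : Type} [Field F] [CharP F 2]

theorem normDegree_le_four {s : ℕ} {c : Fin s → F} {u v : F}
    (h : ∀ i j, c i * c j ∈ biq u v) : normDegree F c ≤ 4 := by
  have hsq : ∀ x : F, x ^ 2 ∈ sqSubfield F := fun x => Subfield.subset_closure ⟨x, rfl⟩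
  have hsub : ∀ x ∈ sqSubfield F, x ∈ biq u v := by
    intro x hx
    have : sqSubfield F ≤ biq u v := Subfield.closure_le.2 (by
      rintro _ ⟨x, rfl⟩; exact sq_mem_biq u v x)
    exact this hx
  let L : IntermediateField (sqSubfield F) F :=
    { biq u v with algebraMap_mem' := fun x => hsub x.1 x.2 }
  have h1 : IntermediateField.adjoin (sqSubfield F)
      (Set.range fun p : Fin s × Fin s => c p.1 * c p.2) ≤ L := by
    rw [IntermediateField.adjoin_le_iff]
    rintro _ ⟨⟨i, j⟩, rfl⟩
    exact h i j
  have h2 : ∀ x ∈ L, x ∈ Submodule.span (sqSubfield F) (Set.range ![1, u, v, u * v]) := by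
    rintro x ⟨α, β, γ, δ, rfl⟩
    have mem : ∀ (i : Fin 4) (r : F), r ^ 2 * (![1, u, v, u * v] : Fin 4 → F) i ∈
        Submodule.span (sqSubfield F) (Set.range ![1, u, v, u * v]) := fun i r =>
      Submodule.smul_mem _ (⟨r ^ 2, hsq r⟩ : sqSubfield F) (Submodule.subset_span ⟨i, rfl⟩)
    have := add_mem (add_mem (add_mem (mem 0 α) (mem 1 β)) (mem 2 γ)) (mem 3 δ)
    convert this using 1
    simp; ring
  have : FiniteDimensional (sqSubfield F)
    (Submodule.span (sqSubfield F) (Set.range ![1, u, v, u * v])) :=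
    FiniteDimensional.span_of_finite _ (Set.finite_range _)
  have h3 : (IntermediateField.adjoin (sqSubfield F)
      (Set.range fun p : Fin s × Fin s => c p.1 * c p.2)).toSubalgebra.toSubmodule ≤
      Submodule.span (sqSubfield F) (Set.range ![1, u, v, u * v]) := fun x hx => h2 x (h1 hx)
  have h4 := Submodule.finrank_mono h3
  have h5 := finrank_range_le_card (R := sqSubfield F) (![1, u, v, u * v] : Fin 4 → F)
  exact h4.trans (by simpa [Set.finrank] using h5)

theorem DiagPresents.false_of_mem {s : ℕ} {ψ : QuadraticForm F (Fin s → F)} {c g : Fin s → F}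
    (hc : ψ.Equivalent (diagQF c)) (hn : normDegree F c = 8) (hg : DiagPresents ψ g) {u v : F}
    (h : ∀ i, g i ∈ biq u v) : False := by
  have : normDegree F c ≤ 4 := by
    obtain ⟨E⟩ := hc
    obtain ⟨κ, hκ, T, hT, e⟩ := hg
    have hs : Function.Surjective T := LinearMap.surjective_of_injective hT
    have key : ∀ i, ∃ m ∈ biq u v, c i = κ * m := by
      intro i
      have h1 : ψ (E.symm (Pi.single i 1)) = c i := by
        rw [QuadraticMap.IsometryEquiv.map_app, diagQF_apply]
        rw [Finset.sum_eq_single i]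
        · simp
        · intro j _ hj; simp [hj]
        · simp
      obtain ⟨w, hw⟩ := hs (E.symm (Pi.single i 1))
      refine ⟨∑ j, g j * w j ^ 2, sum_mem fun j _ => mul_mem (h j) (sq_mem_biq u v (w j)), ?_⟩
      rw [← h1, ← hw, e]
    refine normDegree_le_four (u := u) (v := v) fun i j => ?_
    obtain ⟨m, hm, e1⟩ := key i
    obtain ⟨m', hm', e2⟩ := key j
    have : c i * c j = κ ^ 2 * (m * m') := by rw [e1, e2]; ring
    rw [this]
    exact mul_mem (sq_mem_biq u v κ) (mul_mem hm hm')
  omega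

end NormDegree

section TriProperty

variable {F : Type} [Field F] [CharP F 2]

theorem exists_linearIndependent_three {V : Type} [AddCommGroup V] [Module F V] {u₀ u₁ : V}
    (h : LinearIndependent F ![u₀, u₁]) (hd : 2 < Module.finrank F V) :
    ∃ u₂, LinearIndependent F ![u₀, u₁, u₂] := by
  obtain ⟨x, hx⟩ := exists_linearIndependent_cons_of_lt_finrank h hd
  have hx' : LinearIndependent F ![x, u₀, u₁] := hx
  rw [linearIndependent_three] at hx'
  refine ⟨x, linearIndependent_three.2 fun α β γ e => ?_⟩
  have := hx' γ α β (by rw [← e]; abel)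
  tauto

theorem exists_linearIndependent_four {V : Type} [AddCommGroup V] [Module F V] {u₀ u₁ u₂ : V}
    (h : LinearIndependent F ![u₀, u₁, u₂]) (hd : 3 < Module.finrank F V) :
    ∃ u₃, LinearIndependent F ![u₀, u₁, u₂, u₃] := by
  obtain ⟨x, hx⟩ := exists_linearIndependent_cons_of_lt_finrank h hd
  have hx' : LinearIndependent F ![x, u₀, u₁, u₂] := hx
  rw [linearIndependent_four] at hx'
  refine ⟨x, linearIndependent_four.2 fun α β γ δ e => ?_⟩
  have := hx' δ α β γ (by rw [← e]; abel)
  tauto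

theorem triProperty_three {φ : QuadraticForm F (Fin 5 → F)}
    {ψ : QuadraticForm F (Fin 3 → F)} (hψ : ψ.Anisotropic)
    (h : ¬ (extendQF F (funFieldMap F ψ) φ).Anisotropic) {g : Fin 3 → F} (hg : DiagPresents ψ g)
    {a b : F} {c : Fin 3 → F} (hP : Presents φ a b c) : TriProperty a b c ψ := by
  intro v₀ v₁ v₂ hv
  obtain ⟨g', hg', e⟩ : ∃ g' : Fin 3 → F, DiagPresents ψ g' ∧ g' = ![ψ v₀, ψ v₁, ψ v₂] := by
    refine ⟨_, diagPresents_of_linearIndependent hg.map_add hv, ?_⟩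
    funext i; fin_cases i <;> rfl
  have h1 := not_gAnis_polynomial hψ h hP hg'
  have e0 : g' 0 = ψ v₀ := by rw [e]; rfl
  have e1 : g' 1 = ψ v₁ := by rw [e]; rfl
  have e2 : g' 2 = ψ v₂ := by rw [e]; rfl
  rw [e0, e1, e2] at h1
  exact h1

theorem triProperty_four {φ : QuadraticForm F (Fin 5 → F)}
    {ψ : QuadraticForm F (Fin 4 → F)} (hψ : ψ.Anisotropic)
    (h : ¬ (extendQF F (funFieldMap F ψ) φ).Anisotropic) {g : Fin 4 → F} (hg : DiagPresents ψ g)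
    {a b : F} {c : Fin 3 → F} (hP : Presents φ a b c) : TriProperty a b c ψ := by
  intro v₀ v₁ v₂ hv
  obtain ⟨v₃, hv⟩ := exists_linearIndependent_four hv (by simp)
  have hv' : LinearIndependent F ![v₀, v₁, v₃, v₂] := by
    rw [linearIndependent_four] at hv ⊢
    intro α β γ δ e
    have := hv α β δ γ (by rw [← e]; abel)
    tauto
  obtain ⟨g', hg', e⟩ : ∃ g' : Fin 4 → F, DiagPresents ψ g' ∧
      g' = ![ψ v₀, ψ v₁, ψ v₃, ψ v₂] := by
    refine ⟨_, diagPresents_of_linearIndependent hg.map_add hv', ?_⟩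
    funext i; fin_cases i <;> rfl
  have h1 := exists_zero_eval 0 (not_gAnis_polynomial_polynomial hψ h hP hg')
  have e0 : g' 0 = ψ v₀ := by rw [e]; rfl
  have e1 : g' 1 = ψ v₁ := by rw [e]; rfl
  have e3 : g' 3 = ψ v₂ := by rw [e]; rfl
  rw [e0, e1, e3] at h1
  unfold TriIsotropic
  have e' : ∀ (x y z : F) (c : Fin 3 → F), (fun i => Polynomial.eval (0 : Polynomial F) (Sum.elim
      (fun i => Polynomial.C (Polynomial.C (c i)))
      (fun i => (Polynomial.C (Polynomial.C x) +
        Polynomial.C (Polynomial.C y) * Polynomial.X ^ 2 +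
        Polynomial.C (Polynomial.C z * Polynomial.X ^ 2)) *
        Polynomial.C (Polynomial.C (c i))) i)) =
      (Sum.elim (fun i => Polynomial.C (c i))
    (fun i => (Polynomial.C x + Polynomial.C z * Polynomial.X ^ 2) * Polynomial.C (c i))) := by
    intro x y z c
    funext i
    rcases i with i | i <;> simp
  rw [e', Polynomial.eval_C, Polynomial.eval_C] at h1
  exact h1

end TriProperty

section Dual

variable {F : Type} [Field F] [CharP F 2]

theorem SqIndep.four {p e : F} (hc : SqIndep ![1, p, e]) {α β γ δ : F}
    (h : α ^ 2 + p * β ^ 2 + e * γ ^ 2 + p * e * δ ^ 2 = 0) :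
    α = 0 ∧ β = 0 ∧ γ = 0 ∧ δ = 0 := by
  have two : (2 : F) = 0 := CharTwo.two_eq_zero
  have key : ∀ x y z : F, x ^ 2 + p * y ^ 2 + e * z ^ 2 = 0 → x = 0 ∧ y = 0 ∧ z = 0 := by
    intro x y z h0
    have := hc ![x, y, z] (by simpa [Fin.sum_univ_three] using h0)
    exact ⟨congrFun this 0, congrFun this 1, congrFun this 2⟩
  have hN := key (α * γ + p * β * δ) (α * δ + β * γ) (γ ^ 2 + p * δ ^ 2) (by
    linear_combination (γ ^ 2 + p * δ ^ 2) * h + (2 * α * β * γ * δ * p) * two)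
  have h1 := key γ δ 0 (by linear_combination hN.2.2)
  have h2 := key α β 0 (by rw [h1.1, h1.2.1] at h; linear_combination h)
  exact ⟨h2.1, h2.2.1, h1.1, h1.2.1⟩

theorem biq_le {p e p' e' x : F} (hp : p' ∈ biq p e) (he : e' ∈ biq p e) (hx : x ∈ biq p' e') :
    x ∈ biq p e := by
  obtain ⟨α, β, γ, δ, rfl⟩ := hx
  exact add_mem (add_mem (add_mem (sq_mem_biq p e _) (mul_mem hp (sq_mem_biq p e _)))
    (mul_mem he (sq_mem_biq p e _))) (mul_mem (mul_mem hp he) (sq_mem_biq p e _))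

/-- Any three elements of `F²(p,e)` can be scaled by an element of that field into the span of
`1, p, e` over the squares. -/
theorem exists_dual {p e : F} (hc : SqIndep ![1, p, e]) (P : Fin 3 → F)
    (hP : ∀ j, P j ∈ biq p e) : ∃ c ∈ biq p e, c ≠ 0 ∧ ∀ j, ∃ m : Fin 3 → F,
      c * P j = ∑ k, m k ^ 2 * (![1, p, e] : Fin 3 → F) k := by
  have two : (2 : F) = 0 := CharTwo.two_eq_zero
  choose α β γ δ hm using fun j => hP j
  obtain ⟨r, hr, hr0⟩ : ∃ r : Fin 4 → F,
      (∀ j, r 0 * δ j + r 1 * γ j + r 2 * β j + r 3 * α j = 0) ∧ r ≠ 0 := by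
    have := LinearMap.ker_ne_bot_of_finrank_lt
      (f := (Matrix.of fun j : Fin 3 => ![δ j, γ j, β j, α j]).mulVecLin) (by simp)
    obtain ⟨r, hr, hr0⟩ := Submodule.exists_mem_ne_zero_of_ne_bot this
    refine ⟨r, fun j => ?_, hr0⟩
    have := congrFun (LinearMap.mem_ker.1 hr) j
    simp [Matrix.mulVec, dotProduct, Fin.sum_univ_four] at this
    linear_combination this
  refine ⟨_, ⟨r 0, r 1, r 2, r 3, rfl⟩, fun h => hr0 ?_, fun j => ?_⟩
  · have := hc.four h
    funext i
    fin_cases i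
    exacts [this.1, this.2.1, this.2.2.1, this.2.2.2]
  · refine ⟨![r 0 * α j + p * r 1 * β j + e * r 2 * γ j + p * e * r 3 * δ j,
      r 0 * β j + r 1 * α j + e * r 2 * δ j + e * r 3 * γ j,
      r 0 * γ j + r 2 * α j + p * r 1 * δ j + p * r 3 * β j], ?_⟩
    rw [hm j]
    simp [Fin.sum_univ_three]
    have h2 : (r 0 * δ j + r 1 * γ j + r 2 * β j + r 3 * α j) ^ 2 = 0 := by rw [hr j]; ring
    generalize α j = a0 at *
    generalize β j = a1 at *
    generalize γ j = a2 at *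
    generalize δ j = a3 at *
    generalize r 0 = b0 at *
    generalize r 1 = b1 at *
    generalize r 2 = b2 at *
    generalize r 3 = b3 at *
    have e1 : ∀ x y z w : F, (x + y + z + w) ^ 2 = x ^ 2 + y ^ 2 + z ^ 2 + w ^ 2 := by
      intro x y z w
      linear_combination (x * y + x * z + x * w + y * z + y * w + z * w) * two
    rw [e1] at h2 ⊢
    rw [e1, e1]
    linear_combination p * e * h2

theorem SqIndep.of_linearIndependent {n k : ℕ} {c : Fin n → F} (hc : SqIndep c)
    {m : Fin k → Fin n → F} (hm : LinearIndependent F m) :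
    SqIndep (fun i => ∑ j, m i j ^ 2 * c j) := by
  intro r hr
  have h1 : ∑ j, c j * (∑ i, r i * m i j) ^ 2 = 0 := by
    rw [← hr]
    simp only [Finset.sum_mul, CharTwo.sum_sq, Finset.mul_sum]
    rw [Finset.sum_comm]
    exact Finset.sum_congr rfl fun i _ => Finset.sum_congr rfl fun j _ => by ring
  have h2 := hc _ h1
  have h3 := Fintype.linearIndependent_iff.1 hm r (by
    funext j
    simpa using congrFun h2 j)
  funext i
  exact h3 i

theorem Presents.extend_pair {V : Type} [AddCommGroup V] [Module F V] {φ : QuadraticForm F V}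
    (hφ : φ.Anisotropic) {a b : F} {c : Fin 3 → F} (h : Presents φ a b c) {u v : F}
    (huv : SqIndep ![u, v]) {m m' : Fin 3 → F} (hu : u = ∑ j, m j ^ 2 * c j)
    (hv : v = ∑ j, m' j ^ 2 * c j) :
    ∃ m'' : Fin 3 → F, Presents φ a b ![u, v, ∑ j, m'' j ^ 2 * c j] := by
  have hi : LinearIndependent F ![m, m'] := by
    rw [LinearIndependent.pair_iff]
    intro s t hst
    have := huv ![s, t] (by
      have h1 : ∀ j, s * m j + t * m' j = 0 := fun j => by simpa using congrFun hst j
      have h2 : ∑ j, c j * (s * m j + t * m' j) ^ 2 = 0 := by simp [h1]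
      simp only [CharTwo.add_sq] at h2
      rw [← h2, hu, hv]
      simp [Fin.sum_univ_three]
      ring)
    exact ⟨congrFun this 0, congrFun this 1⟩
  obtain ⟨m'', hm⟩ := exists_linearIndependent_three hi (by simp)
  refine ⟨m'', h.basis ?_ ![m, m', m''] fun i => by fin_cases i <;> simp [hu, hv]⟩
  have := (h.gAnis hφ).sqIndep.of_linearIndependent hm
  have e : ![u, v, ∑ j, m'' j ^ 2 * c j] = fun i => ∑ j, ![m, m', m''] i j ^ 2 * c j := by
    funext i; fin_cases i <;> simp [hu, hv]
  rw [e]; exact this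

theorem DiagPresents.weaklyDominated_of_presents {s : ℕ} {φ : QuadraticForm F (Fin 5 → F)}
    {ψ : QuadraticForm F (Fin s → F)} (hψ : ψ.Anisotropic) {g : Fin s → F}
    (hg : DiagPresents ψ g) {a b : F} {c : Fin 3 → F} (hP : Presents φ a b c) {μ : F}
    (hμ : μ ≠ 0) (S : (Fin s → F) →ₗ[F] (Fin 2 ⊕ Fin 3 → F))
    (hS : ∀ v, gq a b c (S v) = μ * ∑ i, g i * v i ^ 2) : WeaklyDominated ψ φ := by
  obtain ⟨κ, hκ, T, -, e⟩ := hP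
  exact hg.weaklyDominated hψ (mul_ne_zero hκ hμ) (T ∘ₗ S) fun v => by
    rw [LinearMap.comp_apply, e, hS, mul_assoc]

theorem DiagPresents.weaklyDominated_of_mem {s : ℕ} {φ : QuadraticForm F (Fin 5 → F)}
    {ψ : QuadraticForm F (Fin s → F)} (hψ : ψ.Anisotropic) {g : Fin s → F}
    (hg : DiagPresents ψ g) {a b : F} {c : Fin 3 → F} (hP : Presents φ a b c) {μ : F}
    (hμ : μ ≠ 0) (m : Fin s → Fin 3 → F) (hm : ∀ i, μ * g i = ∑ j, m i j ^ 2 * c j) :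
    WeaklyDominated ψ φ := by
  refine hg.weaklyDominated_of_presents hψ hP hμ
    { toFun := fun v => Sum.elim 0 (fun j => ∑ i, m i j * v i)
      map_add' := fun v w => by
        funext i
        rcases i with i | i
        · simp
        · simp [mul_add, Finset.sum_add_distrib]
      map_smul' := fun r v => by
        funext i
        rcases i with i | i
        · simp
        · simp only [Sum.elim_inr, Pi.smul_apply, smul_eq_mul, RingHom.id_apply, Finset.mul_sum]
          exact Finset.sum_congr rfl fun j _ => by ring } fun v => ?_
  have key : ∑ j, c j * (∑ i, m i j * v i) ^ 2 = μ * ∑ i, g i * v i ^ 2 := by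
    simp only [Finset.mul_sum, ← mul_assoc, hm, Finset.sum_mul, CharTwo.sum_sq]
    rw [Finset.sum_comm]
    exact Finset.sum_congr rfl fun i _ => Finset.sum_congr rfl fun j _ => by ring
  rw [← key]
  simp [gq]

end Dual

section Three

variable {F : Type} [Field F] [CharP F 2]

theorem Presents.avoidsBiq {φ : QuadraticForm F (Fin 5 → F)} (hφ : φ.Anisotropic)
    (hpn : ¬ IsPfisterNeighbour φ) {a b p e : F} (h : Presents φ a b ![1, p, e]) :
    AvoidsBiq a b p e := fun _ _ hη => h.not_mem_biq hφ hpn hη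

theorem exists_presents_three {φ : QuadraticForm F (Fin 5 → F)} (hφ : φ.Anisotropic)
    (hpn : ¬ IsPfisterNeighbour φ) {a b p e : F} (hP : Presents φ a b ![1, p, e])
    {ψ : QuadraticForm F (Fin 3 → F)} (hψ : ψ.Anisotropic) {g : Fin 3 → F}
    (hg : DiagPresents ψ g) (hT : ∀ a b c, Presents φ a b c → TriProperty a b c ψ) :
    WeaklyDominated ψ φ ∨ ∃ x p e b, x ∉ biq p e ∧ Presents φ (x * e) b ![1, p, e] ∧
      DiagPresents ψ ![1, x, p] := by
  have two : (2 : F) = 0 := CharTwo.two_eq_zero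
  have hadd := hg.map_add
  have hc := (hP.gAnis hφ).sqIndep
  have hu : LinearIndependent F ![(Pi.single 0 1 : Fin 3 → F), Pi.single 1 1, Pi.single 2 1] := by
    rw [linearIndependent_three]
    intro α β γ h
    have h0 := congrFun h 0
    have h1 := congrFun h 1
    have h2 := congrFun h 2
    simp at h0 h1 h2
    exact ⟨h0, h1, h2⟩
  obtain ⟨α₀, α₁, α₂, β₀, β₁, β₂, hv, hl⟩ :=
    (hT _ _ _ hP).exists_pair hψ hadd hc (hP.avoidsBiq hφ hpn) hu
  generalize α₀ • (Pi.single 0 1 : Fin 3 → F) + α₁ • Pi.single 1 1 + α₂ • Pi.single 2 1 = v₀ at *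
  generalize β₀ • (Pi.single 0 1 : Fin 3 → F) + β₁ • Pi.single 1 1 + β₂ • Pi.single 2 1 = v₁ at *
  obtain ⟨v₂, hv⟩ := exists_linearIndependent_three hv (by simp)
  have hv' : LinearIndependent F ![v₀, v₂, v₁] := by
    rw [linearIndependent_three] at hv ⊢
    intro α β γ e
    have := hv α γ β (by rw [← e]; abel)
    tauto
  have h0 : ψ v₀ ≠ 0 := fun h => hv.ne_zero 0 (hψ _ h)
  have hT' : ∀ a b c, Presents φ a b c → TriIsotropic a b c (ψ v₂ / ψ v₀) (ψ v₁ / ψ v₀) :=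
    fun a b c h => hT a b c h v₀ v₂ v₁ hv'
  have hg' : DiagPresents ψ ![1, ψ v₂ / ψ v₀, ψ v₁ / ψ v₀] := by
    have h1 := (diagPresents_of_linearIndependent hadd hv').scale (inv_ne_zero h0)
    have e : ![1, ψ v₂ / ψ v₀, ψ v₁ / ψ v₀] = fun i => (ψ v₀)⁻¹ * ψ (![v₀, v₂, v₁] i) := by
      funext i; fin_cases i <;> simp [h0, div_eq_inv_mul]
    rw [e]; exact h1
  generalize ψ v₂ / ψ v₀ = x at *
  generalize ψ v₁ / ψ v₀ = l at *
  by_cases hx : x ∈ biq p e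
  · left
    obtain ⟨μ, -, hμ, h⟩ := exists_dual hc ![1, x, l] (by
      intro j; fin_cases j
      exacts [one_mem _, hx, hl])
    choose m hm using h
    exact hg'.weaklyDominated_of_mem hψ hP hμ m hm
  · obtain ⟨μ, hμm, hμ, h⟩ := exists_dual hc ![1, l, l] (by
      intro j; fin_cases j
      exacts [one_mem _, hl, hl])
    choose m hm using h
    have h1l : SqIndep ![1, l] := by
      intro r hr
      have := hg'.sqIndep hψ ![r 0, 0, r 1] (by
        simp [Fin.sum_univ_three, Fin.sum_univ_two] at hr ⊢; exact hr)
      funext i; fin_cases i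
      exacts [congrFun this 0, congrFun this 2]
    obtain ⟨m'', hP'⟩ := (hP.scale hφ (inv_ne_zero hμ)).extend_pair hφ h1l (m := m 0) (m' := m 1)
      (by
        have := hm 0
        simp [Fin.sum_univ_three] at this ⊢
        field_simp
        linear_combination this)
      (by
        have := hm 1
        simp [Fin.sum_univ_three] at this ⊢
        field_simp
        linear_combination this)
    have he' : ∑ j, m'' j ^ 2 * (μ⁻¹ * (![1, p, e] : Fin 3 → F) j) ∈ biq p e :=
      sum_mem fun j _ => mul_mem (sq_mem_biq _ _ _) (mul_mem (inv_mem hμm) (by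
        fin_cases j
        exacts [one_mem _, left_mem_biq p e, right_mem_biq p e]))
    generalize ∑ j, m'' j ^ 2 * (μ⁻¹ * (![1, p, e] : Fin 3 → F) j) = e' at *
    have hx' : x ∉ biq l e' := fun h => hx (biq_le hl he' h)
    obtain ⟨b', r, hr, hP₂⟩ := (hT' _ _ _ hP').exists_presents hφ hP' (hP'.avoidsBiq hφ hpn) hx'
    by_cases h2 : r 2 = 0
    · left
      have hs : r 0 ^ 2 + l * r 1 ^ 2 ≠ 0 := fun h => hr (by
        have := h1l ![r 0, r 1] (by simpa [Fin.sum_univ_two] using h)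
        funext i; fin_cases i
        exacts [congrFun this 0, congrFun this 1, h2])
      refine hg'.weaklyDominated_of_presents hψ hP₂ hs
        { toFun := fun v => Sum.elim ![v 1, 0] ![r 0 * v 0 + l * r 1 * v 2, r 1 * v 0 + r 0 * v 2, 0]
          map_add' := fun v w => by
            funext i
            rcases i with i | i <;> fin_cases i <;> simp <;> ring
          map_smul' := fun t v => by
            funext i
            rcases i with i | i <;> fin_cases i <;> simp <;> ring } fun v => ?_
      simp [gq, Fin.sum_univ_three, h2]
      linear_combination (2 * r 0 * r 1 * v 0 * v 2 * l) * two
    · right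
      refine ⟨x, l, r 0 ^ 2 + l * r 1 ^ 2 + e' * r 2 ^ 2, b', ?_, ?_, hg'⟩
      · exact fun h => hx' (biq_le (left_mem_biq _ _) ⟨r 0, r 1, r 2, 0, by ring⟩ h)
      · have hli : LinearIndependent F ![![1, 0, 0], ![0, 1, 0], r] := by
          rw [linearIndependent_three]
          intro α β γ h
          have e0 := congrFun h 0
          have e1 := congrFun h 1
          have e2 := congrFun h 2
          simp [h2] at e0 e1 e2
          simp [e2] at e0 e1
          exact ⟨e0, e1, e2⟩
        have hm' : ∀ i, (![1, l, r 0 ^ 2 + l * r 1 ^ 2 + e' * r 2 ^ 2] : Fin 3 → F) i =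
            ∑ j, (![![1, 0, 0], ![0, 1, 0], r] : Fin 3 → Fin 3 → F) i j ^ 2 *
              (![1, l, e'] : Fin 3 → F) j := by
          intro i
          fin_cases i <;> simp [Fin.sum_univ_three]
          ring
        refine hP₂.basis ?_ _ hm'
        rw [funext hm']
        exact (hP'.gAnis hφ).sqIndep.of_linearIndependent hli

end Three

section Four

variable {F : Type} [Field F] [CharP F 2]

theorem diagPresents_four {ψ : QuadraticForm F (Fin 4 → F)}
    (hadd : ∀ v w, ψ (v + w) = ψ v + ψ w) {v₀ v₁ v₂ v₃ : Fin 4 → F}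
    (hv : LinearIndependent F ![v₀, v₁, v₂, v₃]) (h0 : ψ v₀ ≠ 0) :
    DiagPresents ψ ![1, ψ v₁ / ψ v₀, ψ v₂ / ψ v₀, ψ v₃ / ψ v₀] := by
  have h1 := (diagPresents_of_linearIndependent hadd hv).scale (inv_ne_zero h0)
  have e : ![1, ψ v₁ / ψ v₀, ψ v₂ / ψ v₀, ψ v₃ / ψ v₀] =
      fun i => (ψ v₀)⁻¹ * ψ (![v₀, v₁, v₂, v₃] i) := by
    funext i; fin_cases i <;> simp [h0, div_eq_inv_mul]
  rw [e]; exact h1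

theorem exists_fourth {ψ : QuadraticForm F (Fin 4 → F)} (hψ : ψ.Anisotropic)
    (hadd : ∀ v w, ψ (v + w) = ψ v + ψ w) {c : Fin 4 → F} (hc : ψ.Equivalent (diagQF c))
    (hn : normDegree F c = 8) {p e : F} {v₀ v₁ v₂ : Fin 4 → F}
    (hv : LinearIndependent F ![v₀, v₁, v₂]) (h1 : ψ v₁ / ψ v₀ ∈ biq p e)
    (h2 : ψ v₂ / ψ v₀ ∈ biq p e) :
    ∃ v₃, LinearIndependent F ![v₀, v₁, v₂, v₃] ∧ ψ v₃ / ψ v₀ ∉ biq p e := by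
  obtain ⟨v₃, hv⟩ := exists_linearIndependent_four hv (by simp)
  refine ⟨v₃, hv, fun h3 => ?_⟩
  refine (diagPresents_four hadd hv fun h => hv.ne_zero 0 (hψ _ h)).false_of_mem hc hn
    (u := p) (v := e) fun i => ?_
  fin_cases i
  exacts [one_mem _, h1, h2, h3]

theorem TriProperty.exists_four {ψ : QuadraticForm F (Fin 4 → F)} (hψ : ψ.Anisotropic)
    (hadd : ∀ v w, ψ (v + w) = ψ v + ψ w) {c : Fin 4 → F} (hc : ψ.Equivalent (diagQF c))
    (hn : normDegree F c = 8) {a b p e : F} (hs : SqIndep ![1, p, e]) (ha : AvoidsBiq a b p e)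
    (hT : TriProperty a b ![1, p, e] ψ) :
    ∃ v₀ v₁ v₂ v₃, LinearIndependent F ![v₀, v₁, v₂, v₃] ∧ ψ v₁ / ψ v₀ ∈ biq p e ∧
      ψ v₂ / ψ v₀ ∈ biq p e ∧ ψ v₃ / ψ v₀ ∉ biq p e := by
  have two : (2 : F) = 0 := CharTwo.two_eq_zero
  suffices H : ∃ v₀ v₁ v₂, LinearIndependent F ![v₀, v₁, v₂] ∧ ψ v₁ / ψ v₀ ∈ biq p e ∧
      ψ v₂ / ψ v₀ ∈ biq p e by
    obtain ⟨v₀, v₁, v₂, hv, h1, h2⟩ := H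
    obtain ⟨v₃, hv, h3⟩ := exists_fourth hψ hadd hc hn hv h1 h2
    exact ⟨v₀, v₁, v₂, v₃, hv, h1, h2, h3⟩
  have hu : LinearIndependent F
      ![(Pi.single 0 1 : Fin 4 → F), Pi.single 1 1, Pi.single 2 1] := by
    rw [linearIndependent_three]
    intro α β γ h
    have h0 := congrFun h 0
    have h1 := congrFun h 1
    have h2 := congrFun h 2
    simp at h0 h1 h2
    exact ⟨h0, h1, h2⟩
  obtain ⟨v, v', hv, hl⟩ : ∃ v v', LinearIndependent F ![v, v'] ∧ ψ v' / ψ v ∈ biq p e := by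
    obtain ⟨_, _, _, _, _, _, hv, hl⟩ := hT.exists_pair hψ hadd hs ha hu
    exact ⟨_, _, hv, hl⟩
  have hv0 : ψ v ≠ 0 := fun h => hv.ne_zero 0 (hψ _ h)
  obtain ⟨w, hw⟩ := exists_linearIndependent_three hv (by simp)
  obtain ⟨z, hz⟩ := exists_linearIndependent_four hw (by simp)
  rw [linearIndependent_four] at hz
  have hvwz : LinearIndependent F ![v, w, z] := by
    rw [linearIndependent_three]
    intro α β γ h
    have := hz α 0 β γ (by rw [← h]; module)
    tauto
  obtain ⟨α₀, α₁, α₂, β₀, β₁, β₂, hu, hl'⟩ := hT.exists_pair hψ hadd hs ha hvwz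
  have hind : ∀ α β γ : F, (β ≠ 0 ∨ γ ≠ 0) →
      LinearIndependent F ![v, v', α • v + β • w + γ • z] := by
    intro α β γ h
    rw [linearIndependent_three]
    intro r s t h1
    have h2 := hz (r + t * α) s (t * β) (t * γ) (by rw [← h1]; module)
    have h3 : t = 0 := by
      rcases h with h | h
      · exact (mul_eq_zero.1 h2.2.2.1).resolve_right h
      · exact (mul_eq_zero.1 h2.2.2.2).resolve_right h
    refine ⟨?_, h2.2.1, h3⟩
    have := h2.1
    rw [h3] at this
    linear_combination this
  by_cases hA : (α₁ ≠ 0 ∨ α₂ ≠ 0) ∨ (β₁ ≠ 0 ∨ β₂ ≠ 0)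
  swap
  · exfalso
    push Not at hA
    obtain ⟨⟨e1, e2⟩, e3, e4⟩ := hA
    rw [LinearIndependent.pair_iff] at hu
    have h1 := hu β₀ (-α₀) (by rw [e1, e2, e3, e4]; module)
    have h2 := hu 1 0 (by rw [e1, e2, neg_eq_zero.1 h1.2]; module)
    exact one_ne_zero h2.1
  have hα := hind α₀ α₁ α₂
  have hβ := hind β₀ β₁ β₂
  generalize α₀ • v + α₁ • w + α₂ • z = u at *
  generalize β₀ • v + β₁ • w + β₂ • z = u' at *
  have hu0 : ψ u ≠ 0 := fun h => hu.ne_zero 0 (hψ _ h)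
  by_cases huv : ψ u / ψ v ∈ biq p e
  · have huv' : ψ u' / ψ v ∈ biq p e := by
      have : ψ u' / ψ v = ψ u' / ψ u * (ψ u / ψ v) := by field_simp
      rw [this]
      exact mul_mem hl' huv
    rcases hA with h | h
    · exact ⟨v, v', u, hα h, hl, huv⟩
    · exact ⟨v, v', u', hβ h, hl, huv'⟩
  · exfalso
    have hvu : ψ v / ψ u ∉ biq p e := fun h => huv (by
      have := inv_mem h
      rwa [inv_div] at this)
    have self : ∀ x : F, x ≠ 0 → x / x ∈ biq p e := fun x hx => by
      rw [div_self hx]; exact one_mem _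
    have h4 := linearIndependent_of_lines hψ hadd hvu hv hu (self _ hv0) hl (self _ hu0) hl'
    rw [linearIndependent_four] at h4
    obtain ⟨γ₀, γ₁, γ₂, δ₀, δ₁, δ₂, ht, hν⟩ := hT.exists_pair hψ hadd hs ha
      (u₀ := v + u) (u₁ := v') (u₂ := u') (by
        rw [linearIndependent_three]
        intro α β γ h
        have := h4 α β α γ (by rw [← h]; module)
        tauto)
    have et : γ₀ • (v + u) + γ₁ • v' + γ₂ • u' = (γ₀ • v + γ₁ • v') + (γ₀ • u + γ₂ • u') := by
      module
    have et' : δ₀ • (v + u) + δ₁ • v' + δ₂ • u' = (δ₀ • v + δ₁ • v') + (δ₀ • u + δ₂ • u') := by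
      module
    rw [et, et'] at ht hν
    have hlin : ∀ x y : F, ψ (x • v + y • v') / ψ v ∈ biq p e := fun x y => by
      rw [hadd, map_smul_sq, map_smul_sq, add_div, mul_div_assoc, mul_div_assoc]
      exact add_mem (mul_mem (sq_mem_biq p e x) (self _ hv0)) (mul_mem (sq_mem_biq p e y) hl)
    have hlin' : ∀ x y : F, ψ (x • u + y • u') / ψ u ∈ biq p e := fun x y => by
      rw [hadd, map_smul_sq, map_smul_sq, add_div, mul_div_assoc, mul_div_assoc]
      exact add_mem (mul_mem (sq_mem_biq p e x) (self _ hu0)) (mul_mem (sq_mem_biq p e y) hl')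
    have m1 := hlin γ₀ γ₁
    have m2 := hlin' γ₀ γ₂
    have m1' := hlin δ₀ δ₁
    have m2' := hlin' δ₀ δ₂
    rw [LinearIndependent.pair_iff] at ht
    have hz1 : γ₀ • v + γ₁ • v' = 0 → δ₀ • v + δ₁ • v' = 0 → False := fun h h' => by
      have k1 := h4 γ₀ γ₁ 0 0 (by rw [← h]; module)
      have k2 := h4 δ₀ δ₁ 0 0 (by rw [← h']; module)
      have k3 := ht δ₂ (-γ₂) (by rw [k1.1, k1.2.1, k2.1, k2.2.1]; module)
      have k4 := ht 1 0 (by rw [k1.1, k1.2.1, neg_eq_zero.1 k3.2]; module)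
      exact one_ne_zero k4.1
    have hz2 : γ₀ • u + γ₂ • u' = 0 → δ₀ • u + δ₂ • u' = 0 → False := fun h h' => by
      have k1 := h4 0 0 γ₀ γ₂ (by rw [← h]; module)
      have k2 := h4 0 0 δ₀ δ₂ (by rw [← h']; module)
      have k3 := ht δ₁ (-γ₁) (by rw [k1.2.2.1, k1.2.2.2, k2.2.2.1, k2.2.2.2]; module)
      have k4 := ht 1 0 (by rw [k1.2.2.1, k1.2.2.2, neg_eq_zero.1 k3.2]; module)
      exact one_ne_zero k4.1
    generalize γ₀ • v + γ₁ • v' = t₁ at *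
    generalize γ₀ • u + γ₂ • u' = t₂ at *
    generalize δ₀ • v + δ₁ • v' = t₁' at *
    generalize δ₀ • u + δ₂ • u' = t₂' at *
    have ht0 : ψ (t₁ + t₂) ≠ 0 := fun h => by
      have := ht 1 0 (by rw [hψ _ h]; module)
      exact one_ne_zero this.1
    obtain ⟨ν, hνdef⟩ : ∃ ν, ν = ψ (t₁' + t₂') / ψ (t₁ + t₂) := ⟨_, rfl⟩
    rw [← hνdef] at hν
    rw [eq_div_iff ht0, hadd, hadd] at hνdef
    have r2 : ψ t₂' = ν * ψ t₂ := by
      by_contra hne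
      have hne' : ψ t₂' / ψ u + ν * (ψ t₂ / ψ u) ≠ 0 := fun h => hne (by
        field_simp at h
        linear_combination h - ν * ψ t₂ * two)
      apply huv
      have : ψ u / ψ v = (ψ t₁' / ψ v + ν * (ψ t₁ / ψ v)) /
          (ψ t₂' / ψ u + ν * (ψ t₂ / ψ u)) := by
        rw [eq_div_iff hne']
        field_simp
        linear_combination -hνdef + (ν * ψ t₂) * two - ψ t₁' * two
      rw [this]
      exact div_mem (add_mem m1' (mul_mem hν m1)) (add_mem m2' (mul_mem hν m2))
    have r1 : ψ t₁' = ν * ψ t₁ := by linear_combination -hνdef - r2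
    have hν0 : ∀ r s : F, r ^ 2 + ν * s ^ 2 = 0 → r = 0 ∧ s = 0 := by
      intro r s h
      refine ht r s (hψ _ ?_)
      rw [hadd, map_smul_sq, map_smul_sq, hadd, hadd, r1, r2]
      linear_combination (ψ t₁ + ψ t₂) * h
    have n1 : ψ t₁ ≠ 0 := fun h => hz1 (hψ _ h) (hψ _ (by rw [r1, h, mul_zero]))
    have n2 : ψ t₂ ≠ 0 := fun h => hz2 (hψ _ h) (hψ _ (by rw [r2, h, mul_zero]))
    have i1 : LinearIndependent F ![t₁, t₁'] := by
      rw [LinearIndependent.pair_iff]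
      intro r s h
      apply hν0
      have := congrArg ψ h
      rw [hadd, map_smul_sq, map_smul_sq, r1, map_zero] at this
      have h5 : (r ^ 2 + ν * s ^ 2) * ψ t₁ = 0 := by linear_combination this
      exact (mul_eq_zero.1 h5).resolve_right n1
    have i2 : LinearIndependent F ![t₂, t₂'] := by
      rw [LinearIndependent.pair_iff]
      intro r s h
      apply hν0
      have := congrArg ψ h
      rw [hadd, map_smul_sq, map_smul_sq, r2, map_zero] at this
      have h5 : (r ^ 2 + ν * s ^ 2) * ψ t₂ = 0 := by linear_combination this
      exact (mul_eq_zero.1 h5).resolve_right n2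
    have hfin := linearIndependent_of_lines hψ hadd hvu i1 i2 m1 m1' m2 m2'
    have q1 : ψ t₁' / ψ t₁ = ν := by rw [r1]; field_simp
    have q2 : ψ t₂' / ψ t₁ = ν * (ψ t₂ / ψ t₁) := by rw [r2]; field_simp
    refine (diagPresents_four hadd hfin n1).false_of_mem hc hn
      (u := ν) (v := ψ t₂ / ψ t₁) fun i => ?_
    fin_cases i
    · exact one_mem _
    · change ψ t₁' / ψ t₁ ∈ _
      rw [q1]; exact left_mem_biq _ _
    · exact right_mem_biq _ _
    · change ψ t₂' / ψ t₁ ∈ _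
      rw [q2]; exact mul_mem (left_mem_biq _ _) (right_mem_biq _ _)

theorem exists_presents_of_ne_zero {φ : QuadraticForm F (Fin 5 → F)} (hφ : φ.Anisotropic)
    {ψ : QuadraticForm F (Fin 4 → F)} (hψ : ψ.Anisotropic) {x b p q : F} {r : Fin 3 → F}
    (hP : Presents φ (x * (r 0 ^ 2 + p * r 1 ^ 2 + q * r 2 ^ 2)) b ![1, p, q])
    (hx : x ∉ biq p q) (hg : DiagPresents ψ ![1, p, q, x]) (h2 : r 2 ≠ 0) :
    ∃ x p e b, x ∉ biq p e ∧ Presents φ (x * e) b ![1, p, e] ∧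
      DiagPresents ψ ![1, x, p, e] := by
  refine ⟨x, p, r 0 ^ 2 + p * r 1 ^ 2 + q * r 2 ^ 2, b, ?_, ?_, ?_⟩
  · exact fun h => hx (biq_le (left_mem_biq _ _) ⟨r 0, r 1, r 2, 0, by ring⟩ h)
  · have hli : LinearIndependent F ![![1, 0, 0], ![0, 1, 0], r] := by
      rw [linearIndependent_three]
      intro α β γ h
      have e0 := congrFun h 0
      have e1 := congrFun h 1
      have e2 := congrFun h 2
      simp [h2] at e0 e1 e2
      simp [e2] at e0 e1
      exact ⟨e0, e1, e2⟩
    have hm' : ∀ i, (![1, p, r 0 ^ 2 + p * r 1 ^ 2 + q * r 2 ^ 2] : Fin 3 → F) i =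
        ∑ j, (![![1, 0, 0], ![0, 1, 0], r] : Fin 3 → Fin 3 → F) i j ^ 2 *
          (![1, p, q] : Fin 3 → F) j := by
      intro i
      fin_cases i <;> simp [Fin.sum_univ_three]
      ring
    refine hP.basis ?_ _ hm'
    rw [funext hm']
    exact (hP.gAnis hφ).sqIndep.of_linearIndependent hli
  · have hli : LinearIndependent F ![![1, 0, 0, 0], ![0, 0, 0, 1], ![0, 1, 0, 0],
        ![r 0, r 1, r 2, 0]] := by
      rw [linearIndependent_four]
      intro α β γ δ h
      have e0 := congrFun h 0
      have e1 := congrFun h 1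
      have e2 := congrFun h 2
      have e3 := congrFun h 3
      simp [h2] at e0 e1 e2 e3
      simp [e2] at e0 e1
      exact ⟨e0, e3, e1, e2⟩
    have hm' : ∀ i, (![1, x, p, r 0 ^ 2 + p * r 1 ^ 2 + q * r 2 ^ 2] : Fin 4 → F) i =
        ∑ j, (![![1, 0, 0, 0], ![0, 0, 0, 1], ![0, 1, 0, 0],
        ![r 0, r 1, r 2, 0]] : Fin 4 → Fin 4 → F) i j ^ 2 *
          (![1, p, q, x] : Fin 4 → F) j := by
      intro i
      fin_cases i <;> simp [Fin.sum_univ_four]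
      ring
    refine hg.basis ?_ _ hm'
    rw [funext hm']
    exact (hg.sqIndep hψ).of_linearIndependent hli

theorem exists_presents_four {φ : QuadraticForm F (Fin 5 → F)} (hφ : φ.Anisotropic)
    (hpn : ¬ IsPfisterNeighbour φ) {a b p e : F} (hP : Presents φ a b ![1, p, e])
    {ψ : QuadraticForm F (Fin 4 → F)} (hψ : ψ.Anisotropic) {c : Fin 4 → F}
    (hc : ψ.Equivalent (diagQF c)) (hn : normDegree F c = 8)
    (hT : ∀ a b c, Presents φ a b c → TriProperty a b c ψ) :
    WeaklyDominated ψ φ ∨ ∃ x p e b, x ∉ biq p e ∧ Presents φ (x * e) b ![1, p, e] ∧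
      DiagPresents ψ ![1, x, p, e] := by
  have hadd := (diagPresents_of_equivalent hc).map_add
  have hs := (hP.gAnis hφ).sqIndep
  obtain ⟨v₀, v₁, v₂, v₃, hv, h1, h2, h3⟩ :=
    (hT _ _ _ hP).exists_four hψ hadd hc hn hs (hP.avoidsBiq hφ hpn)
  have hv' : LinearIndependent F ![v₀, v₃, v₁] := by
    rw [linearIndependent_three]
    rw [linearIndependent_four] at hv
    intro α β γ e
    have := hv α γ 0 β (by rw [← e]; module)
    tauto
  have h0 : ψ v₀ ≠ 0 := fun h => hv.ne_zero 0 (hψ _ h)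
  have hT' : ∀ a b c, Presents φ a b c → TriIsotropic a b c (ψ v₃ / ψ v₀) (ψ v₁ / ψ v₀) :=
    fun a b c h => hT a b c h v₀ v₃ v₁ hv'
  have hg := diagPresents_four hadd hv h0
  generalize ψ v₁ / ψ v₀ = l at *
  generalize ψ v₂ / ψ v₀ = n at *
  generalize ψ v₃ / ψ v₀ = x at *
  have hgs := hg.sqIndep hψ
  have hs' : SqIndep ![1, l, n] := by
    intro r hr
    have := hgs ![r 0, r 1, r 2, 0] (by
      simp [Fin.sum_univ_three, Fin.sum_univ_four] at hr ⊢; exact hr)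
    funext i; fin_cases i
    exacts [congrFun this 0, congrFun this 1, congrFun this 2]
  obtain ⟨μ, hμm, hμ, h⟩ := exists_dual hs ![1, l, n] (by
    intro j; fin_cases j
    exacts [one_mem _, h1, h2])
  choose m hm using h
  have hP' : Presents φ (μ⁻¹ * a) (b / μ⁻¹) ![1, l, n] := by
    refine (hP.scale hφ (inv_ne_zero hμ)).basis hs' m fun i => ?_
    have := hm i
    simp [Fin.sum_univ_three] at this ⊢
    field_simp
    linear_combination this
  have hx' : x ∉ biq l n := fun h => h3 (biq_le h1 h2 h)
  obtain ⟨b', r, hr, hP₂⟩ := (hT' _ _ _ hP').exists_presents hφ hP' (hP'.avoidsBiq hφ hpn) hx'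
  by_cases hr2 : r 2 = 0
  swap
  · exact Or.inr (exists_presents_of_ne_zero hφ hψ hP₂ hx' hg hr2)
  by_cases hr1 : r 1 = 0
  swap
  · right
    have hsn : SqIndep ![1, n, l] := by
      intro t ht
      have := hs' ![t 0, t 2, t 1] (by
        simp [Fin.sum_univ_three] at ht ⊢; rw [← ht]; ring)
      funext i; fin_cases i
      exacts [congrFun this 0, congrFun this 2, congrFun this 1]
    have hP₃ := hP₂.basis hsn ![![1, 0, 0], ![0, 0, 1], ![0, 1, 0]] (by
      intro i; fin_cases i <;> simp [Fin.sum_univ_three])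
    have hP₄ : Presents φ (x * ((![r 0, r 2, r 1] : Fin 3 → F) 0 ^ 2 +
        n * (![r 0, r 2, r 1] : Fin 3 → F) 1 ^ 2 + l * (![r 0, r 2, r 1] : Fin 3 → F) 2 ^ 2))
        b' ![1, n, l] := by
      have e : x * ((![r 0, r 2, r 1] : Fin 3 → F) 0 ^ 2 +
        n * (![r 0, r 2, r 1] : Fin 3 → F) 1 ^ 2 + l * (![r 0, r 2, r 1] : Fin 3 → F) 2 ^ 2) =
        x * (r 0 ^ 2 + l * r 1 ^ 2 + n * r 2 ^ 2) := by
        change x * (r 0 ^ 2 + n * r 2 ^ 2 + l * r 1 ^ 2) = _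
        ring
      rw [e]; exact hP₃
    refine exists_presents_of_ne_zero hφ hψ hP₄
      (fun h => hx' (biq_le (right_mem_biq _ _) (left_mem_biq _ _) h)) ?_ hr1
    refine hg.basis ?_ ![![1, 0, 0, 0], ![0, 0, 1, 0], ![0, 1, 0, 0], ![0, 0, 0, 1]] (by
      intro i; fin_cases i <;> simp [Fin.sum_univ_four])
    intro t ht
    have := hgs ![t 0, t 2, t 1, t 3] (by
      simp [Fin.sum_univ_four] at ht ⊢; rw [← ht]; ring)
    funext i; fin_cases i
    exacts [congrFun this 0, congrFun this 2, congrFun this 1, congrFun this 3]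
  · left
    have hr0 : r 0 ^ 2 ≠ 0 := fun h => hr (by
      funext i; fin_cases i
      exacts [pow_eq_zero_iff two_ne_zero |>.1 h, hr1, hr2])
    refine hg.weaklyDominated_of_presents hψ hP₂ hr0
      { toFun := fun v => Sum.elim ![v 3, 0] ![r 0 * v 0, r 0 * v 1, r 0 * v 2]
        map_add' := fun v w => by
          funext i
          rcases i with i | i <;> fin_cases i <;> simp <;> ring
        map_smul' := fun t v => by
          funext i
          rcases i with i | i <;> fin_cases i <;> simp <;> ring } fun v => ?_
    simp [gq, Fin.sum_univ_three, Fin.sum_univ_four, hr1, hr2]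
    ring

end Four

theorem exists_common_denom {R : Type*} [CommRing R] (K : Type*) [CommRing K] [Algebra R K]
    [IsFractionRing R K] {κ : Type*} [Finite κ] (v : κ → K) :
    ∃ (s : R) (w : κ → R), IsUnit (algebraMap R K s) ∧
      ∀ i, algebraMap R K (w i) = algebraMap R K s * v i := by
  obtain ⟨s, hs⟩ := IsLocalization.exist_integer_multiples_of_finite (nonZeroDivisors R) v
  choose w hw using hs
  exact ⟨s, w, IsLocalization.map_units K s, fun i => by rw [hw i, Algebra.smul_def]⟩

section Seven

/-- Independence over the squares of the products of `x, p, e` other than `p`. -/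
def SevenIndep {F : Type} [Field F] (x p e : F) : Prop :=
  SqIndep ![1, x, e, x * e, x * p * e, p * e, x * p]

variable {F : Type} [Field F] [CharP F 2]

theorem SqIndep.seven {x p e : F} (hc : SqIndep ![1, p, e]) (hx : x ∉ biq p e) :
    SevenIndep x p e := by
  intro r hr
  simp [Fin.sum_univ_succ] at hr
  have hN : r 1 ^ 2 + p * r 6 ^ 2 + e * r 3 ^ 2 + p * e * r 4 ^ 2 = 0 := by
    by_contra hN
    apply hx
    have e1 : x = (r 0 ^ 2 + p * 0 ^ 2 + e * r 2 ^ 2 + p * e * r 5 ^ 2) /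
        (r 1 ^ 2 + p * r 6 ^ 2 + e * r 3 ^ 2 + p * e * r 4 ^ 2) := by
      rw [eq_div_iff hN]
      linear_combination hr - (r 0 ^ 2 + e * r 2 ^ 2 + p * e * r 5 ^ 2) *
        (CharTwo.two_eq_zero : (2 : F) = 0)
    rw [e1]
    exact div_mem ⟨_, _, _, _, rfl⟩ ⟨_, _, _, _, rfl⟩
  have h1 := hc.four hN
  have h2 := hc.four (α := r 0) (β := 0) (γ := r 2) (δ := r 5) (by
    linear_combination hr - x * hN)
  funext i
  fin_cases i
  exacts [h2.1, h1.1, h2.2.2.1, h1.2.2.1, h1.2.2.2, h2.2.2.2, h1.2.1]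

theorem SevenIndep.eq_zero {x p e : F} (h : SevenIndep x p e) {r₀ r₁ r₂ r₃ r₄ r₅ r₆ : F}
    (hr : r₀ ^ 2 + x * r₁ ^ 2 + e * r₂ ^ 2 + x * e * r₃ ^ 2 + x * p * e * r₄ ^ 2 +
      p * e * r₅ ^ 2 + x * p * r₆ ^ 2 = 0) :
    r₀ = 0 ∧ r₁ = 0 ∧ r₂ = 0 ∧ r₃ = 0 ∧ r₄ = 0 ∧ r₅ = 0 ∧ r₆ = 0 := by
  have := h ![r₀, r₁, r₂, r₃, r₄, r₅, r₆] (by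
    simp [Fin.sum_univ_succ]
    linear_combination hr)
  exact ⟨congrFun this 0, congrFun this 1, congrFun this 2, congrFun this 3, congrFun this 4,
    congrFun this 5, congrFun this 6⟩

theorem SqIndep.fraction {n : ℕ} {c : Fin n → F} (h : SqIndep c) :
    SqIndep (fun i => algebraMap (Polynomial F) (FractionRing (Polynomial F))
      (Polynomial.C (c i))) := by
  intro v hv
  obtain ⟨s, w, hs0, hw'⟩ := exists_common_denom (R := Polynomial F) _ v
  have h1 : ∑ i, Polynomial.C (c i) * w i ^ 2 = 0 := by
    apply IsFractionRing.injective (Polynomial F) (FractionRing (Polynomial F))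
    rw [map_zero, map_sum]
    have : ∀ i, algebraMap (Polynomial F) (FractionRing (Polynomial F))
        (Polynomial.C (c i) * w i ^ 2) = algebraMap _ (FractionRing (Polynomial F)) s ^ 2 *
        (algebraMap (Polynomial F) (FractionRing (Polynomial F)) (Polynomial.C (c i)) *
          v i ^ 2) := fun i => by
      rw [map_mul, map_pow, hw' i]; ring
    rw [Finset.sum_congr rfl fun i _ => this i, ← Finset.mul_sum, hv, mul_zero]
  have h2 : w = 0 := by
    funext i
    refine Polynomial.ext fun k => ?_
    have h3 := congrArg (fun f => Polynomial.coeff f (k * 2)) h1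
    simp only [Polynomial.finsetSum_coeff, Polynomial.coeff_C_mul, Polynomial.coeff_zero,
      ← Polynomial.map_frobenius_expand (R := F) (p := 2), Polynomial.coeff_map,
      Polynomial.coeff_expand_mul two_pos, frobenius_def] at h3
    simpa using congrFun (h _ h3) i
  funext i
  have := hw' i
  rw [h2] at this
  exact (hs0.mul_right_eq_zero).1 (by simpa using this.symm)

theorem SevenIndep.fraction {x p e : F} (h : SevenIndep x p e) :
    SevenIndep (algebraMap (Polynomial F) (FractionRing (Polynomial F)) (Polynomial.C x))
      (algebraMap _ _ (Polynomial.C p)) (algebraMap _ _ (Polynomial.C e)) := by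
  have h1 := SqIndep.fraction h
  unfold SevenIndep
  convert h1 using 1
  funext i
  fin_cases i <;> simp

end Seven

section Residue

variable {E : Type} [Field E] [CharP E 2]

theorem sum_of_gq {ι : Type*} [Fintype ι] {a b f₀ f₁ : E} {d : ι → E} {w₀ w₁ : Fin 2 ⊕ ι → E}
    (h0 : gq a b d w₀ = f₀) (h1 : gq a b d w₁ = f₁)
    (hB : w₀ (.inl 0) * w₁ (.inl 1) + w₀ (.inl 1) * w₁ (.inl 0) = 0) :
    ∑ i, d i * (w₁ (.inl 1) * w₀ (.inr i) + w₀ (.inl 1) * w₁ (.inr i)) ^ 2 =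
      w₁ (.inl 1) ^ 2 * f₀ + w₀ (.inl 1) ^ 2 * f₁ := by
  have e1 : ∀ i, d i * (w₁ (.inl 1) * w₀ (.inr i) + w₀ (.inl 1) * w₁ (.inr i)) ^ 2 =
      w₁ (.inl 1) ^ 2 * (d i * w₀ (.inr i) ^ 2) + w₀ (.inl 1) ^ 2 * (d i * w₁ (.inr i) ^ 2) :=
    fun i => by rw [CharTwo.add_sq]; ring
  rw [Finset.sum_congr rfl fun i _ => e1 i, Finset.sum_add_distrib, ← Finset.mul_sum,
    ← Finset.mul_sum]
  simp only [gq] at h0 h1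
  have two : (2 : E) = 0 := CharTwo.two_eq_zero
  linear_combination w₁ (.inl 1) ^ 2 * h0 + w₀ (.inl 1) ^ 2 * h1 -
    (a * (w₀ (.inl 0) * w₁ (.inl 1) + w₀ (.inl 1) * w₁ (.inl 0)) +
      w₀ (.inl 1) * w₁ (.inl 1)) * hB + (a * (w₀ (.inl 0) * w₁ (.inl 1) * w₀ (.inl 1) *
      w₁ (.inl 0)) - b * w₀ (.inl 1) ^ 2 * w₁ (.inl 1) ^ 2) * two

/-- Two values without polar interaction force isotropy. -/
theorem SevenIndep.not_gAnis {x p e b κ : E} (h7 : SevenIndep x p e) (hx : x ≠ 0) (he : e ≠ 0)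
    (h : ¬ GAnis (Polynomial.C (x * e)) (Polynomial.C b)
      (Sum.elim (fun i => Polynomial.C ((![1, p, e] : Fin 3 → E) i))
        (fun i => (Polynomial.C x + Polynomial.C p * Polynomial.X ^ 2 +
          Polynomial.C (e * κ ^ 2)) * Polynomial.C ((![1, p, e] : Fin 3 → E) i)))) :
    ¬ GAnis 1 (x * e * b) ![x, e, x * e, x * p * e, p * e + p * e ^ 2 / x * κ ^ 2] := by
  intro ha
  have two : (2 : E) = 0 := CharTwo.two_eq_zero
  simp only [GAnis, not_forall] at h
  obtain ⟨v, hv, hv0⟩ := h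
  set cx := Polynomial.C x with hcx
  set ce := Polynomial.C e with hce
  set cp := Polynomial.C p with hcp
  set ck := Polynomial.C κ with hck
  have hxx : cx * Polynomial.C x⁻¹ = 1 := by
    rw [hcx, ← Polynomial.C_mul, mul_inv_cancel₀ hx, Polynomial.C_1]
  have hcx0 : cx ≠ 0 := by simpa [hcx] using hx
  have hce0 : ce ≠ 0 := by simpa [hce] using he
  let w : Fin 2 ⊕ Fin 5 → Polynomial E := Sum.elim ![cx * ce * v (.inl 0), v (.inl 1)]
    ![ce * v (.inr (.inl 2)) + ce * ck * v (.inr (.inr 0)), cx * v (.inr (.inr 0)),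
      v (.inr (.inl 0)) + cp * Polynomial.X * v (.inr (.inr 1)) + ce * ck * v (.inr (.inr 2)),
      v (.inr (.inl 1)) + Polynomial.X * v (.inr (.inr 0)), cx * v (.inr (.inr 1))]
  have hw : w ≠ 0 ∨ ce * v (.inr (.inr 2)) ≠ 0 := by
    by_contra! hcon
    obtain ⟨hw, h2⟩ := hcon
    have r2 := (mul_eq_zero.1 h2).resolve_left hce0
    have a0 : cx * ce * v (.inl 0) = 0 := congrFun hw (.inl 0)
    have a1 : v (.inl 1) = 0 := congrFun hw (.inl 1)
    have d0 : ce * v (.inr (.inl 2)) + ce * ck * v (.inr (.inr 0)) = 0 := congrFun hw (.inr 0)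
    have d1 : cx * v (.inr (.inr 0)) = 0 := congrFun hw (.inr 1)
    have d2 : v (.inr (.inl 0)) + cp * Polynomial.X * v (.inr (.inr 1)) +
      ce * ck * v (.inr (.inr 2)) = 0 := congrFun hw (.inr 2)
    have d3 : v (.inr (.inl 1)) + Polynomial.X * v (.inr (.inr 0)) = 0 := congrFun hw (.inr 3)
    have d4 : cx * v (.inr (.inr 1)) = 0 := congrFun hw (.inr 4)
    have r0 := (mul_eq_zero.1 d1).resolve_left hcx0
    have r1 := (mul_eq_zero.1 d4).resolve_left hcx0
    rw [r0] at d0 d3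
    rw [r1, r2] at d2
    apply hv0
    funext i
    rcases i with i | i | i <;> fin_cases i
    · exact (mul_eq_zero.1 a0).resolve_left (mul_ne_zero hcx0 hce0)
    · exact a1
    · simpa using d2
    · simpa using d3
    · exact (mul_eq_zero.1 (by simpa using d0 : ce * v (.inr (.inl 2)) = 0)).resolve_left hce0
    · exact r0
    · exact r1
    · exact r2
  have two' : (2 : Polynomial E) = 0 := by
    rw [← Polynomial.C_ofNat, two, Polynomial.C_0]
  obtain ⟨w₀, w₁, h0, h1, hB⟩ := ha.represents (x ^ 2) (x * p) w _ hw (by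
    simp only [gq, Fintype.sum_sum_type, Fin.sum_univ_five, Fin.sum_univ_three, w, Sum.elim_inl, Sum.elim_inr,
      Matrix.cons_val, div_eq_mul_inv, map_mul, map_add, map_pow, map_one] at hv ⊢
    simp only [← hcx, ← hce, ← hcp, ← hck] at hv ⊢
    linear_combination (cx * ce) * hv +
      (cx * cp * ce ^ 2 * ck ^ 2 * v (.inr (.inr 1)) ^ 2) * hxx +
      (cx * ce ^ 2 * ck * v (.inr (.inl 2)) * v (.inr (.inr 0)) +
        cx * ce * (v (.inr (.inl 0)) * cp * Polynomial.X * v (.inr (.inr 1)) +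
          v (.inr (.inl 0)) * ce * ck * v (.inr (.inr 2)) +
          cp * Polynomial.X * v (.inr (.inr 1)) * ce * ck * v (.inr (.inr 2))) +
        cx * cp * ce * Polynomial.X * v (.inr (.inl 1)) * v (.inr (.inr 0))) * two')
  have hs := sum_of_gq h0 h1 hB
  simp only [Fin.sum_univ_five, Matrix.cons_val] at hs
  generalize hm : w₁ (.inl 1) * w₀ (.inr 4) + w₀ (.inl 1) * w₁ (.inr 4) = m at hs
  obtain ⟨y, hy⟩ : ∃ y, e = x * y := ⟨e / x, by field_simp⟩
  have hdiv : p * e ^ 2 / x = x * p * y ^ 2 := by rw [hy]; field_simp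
  rw [hdiv] at hs h1
  obtain ⟨hd1, -, -, -, -, hm0, hd0⟩ := h7.eq_zero (r₀ := w₁ (.inl 1) * x)
    (r₁ := w₁ (.inl 1) * w₀ (.inr 0) + w₀ (.inl 1) * w₁ (.inr 0))
    (r₂ := w₁ (.inl 1) * w₀ (.inr 1) + w₀ (.inl 1) * w₁ (.inr 1))
    (r₃ := w₁ (.inl 1) * w₀ (.inr 2) + w₀ (.inl 1) * w₁ (.inr 2))
    (r₄ := w₁ (.inl 1) * w₀ (.inr 3) + w₀ (.inl 1) * w₁ (.inr 3)) (r₅ := m)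
    (r₆ := w₀ (.inl 1) + y * κ * m) (by
      linear_combination hs + (w₁ (.inl 1) ^ 2 * x ^ 2 + w₀ (.inl 1) ^ 2 * (x * p) +
        x * p * w₀ (.inl 1) * y * κ * m) * two)
  have hd1 := (mul_eq_zero.1 hd1).resolve_right hx
  simp only [gq, Fin.sum_univ_five, Matrix.cons_val] at h1
  rw [hd1] at h1
  obtain ⟨-, -, -, -, -, hq, hr⟩ := h7.eq_zero (r₀ := w₁ (.inl 0)) (r₁ := w₁ (.inr 0))
    (r₂ := w₁ (.inr 1)) (r₃ := w₁ (.inr 2)) (r₄ := w₁ (.inr 3)) (r₅ := w₁ (.inr 4))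
    (r₆ := 1 + y * κ * w₁ (.inr 4)) (by
      linear_combination h1 + (x * p + x * p * y * κ * w₁ (.inr 4)) * two)
  rw [hq] at hr
  simp at hr

end Residue

section Descent

variable {F : Type} [Field F] [CharP F 2]

theorem GAnis.of_eq {R ι : Type*} [CommRing R] [Fintype ι] {a b a' b' : R} {d d' : ι → R}
    (h : GAnis a b d) (ha : a' = a) (hb : b' = b) (hd : ∀ i, d' i = d i) : GAnis a' b' d' := by
  rw [ha, hb, funext hd]
  exact h

theorem decomposes_three_of_presents {φ : QuadraticForm F (Fin 5 → F)} {x e b p : F}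
    (h7 : SevenIndep x p e) (hx : x ≠ 0) (he : e ≠ 0) (h : Presents φ (x * e) b ![1, p, e])
    {ψ : QuadraticForm F (Fin 3 → F)} (hψ : ψ.Anisotropic) (hg : DiagPresents ψ ![1, x, p])
    (hi : ¬ (extendQF F (funFieldMap F ψ) φ).Anisotropic) : Decomposes φ ψ := by
  have h1 := not_gAnis_polynomial hψ hi h hg
  have e1 : (fun i => (Polynomial.C ((![1, x, p] : Fin 3 → F) 1 / (![1, x, p] : Fin 3 → F) 0) +
      Polynomial.C ((![1, x, p] : Fin 3 → F) 2 / (![1, x, p] : Fin 3 → F) 0) *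
        Polynomial.X ^ 2) * Polynomial.C ((![1, p, e] : Fin 3 → F) i)) =
      (fun i => (Polynomial.C x + Polynomial.C p * Polynomial.X ^ 2 +
        Polynomial.C (e * 0 ^ 2)) * Polynomial.C ((![1, p, e] : Fin 3 → F) i)) := by
    funext i
    simp
  rw [e1] at h1
  have h2 := h7.not_gAnis hx he h1
  simp only [GAnis, not_forall] at h2
  obtain ⟨v, hv, hv0⟩ := h2
  simp only [gq, Fin.sum_univ_five, Matrix.cons_val] at hv
  by_cases hD : v (.inl 1) = 0
  · rw [hD] at hv
    obtain ⟨h0, h1, h2, h3, h4, h5, -⟩ := h7.eq_zero (r₀ := v (.inl 0)) (r₁ := v (.inr 0))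
      (r₂ := v (.inr 1)) (r₃ := v (.inr 2)) (r₄ := v (.inr 3)) (r₅ := v (.inr 4)) (r₆ := 0)
      (by linear_combination hv)
    refine absurd (_root_.funext fun i => ?_) hv0
    rcases i with i | i <;> fin_cases i <;> assumption
  · refine decomposes_three hx he h hψ hg (h₀ := v (.inl 0) / v (.inl 1))
      (f := v (.inr 0) / v (.inl 1)) (g₀ := v (.inr 1) / v (.inl 1))
      (g₁ := v (.inr 2) / v (.inl 1)) (g₂ := v (.inr 4) / v (.inl 1))
      (g₃ := v (.inr 3) / v (.inl 1)) ?_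
    field_simp
    linear_combination hv - (x * v (.inr 0) ^ 2 + e * v (.inr 1) ^ 2 + x * e * v (.inr 2) ^ 2 +
      p * e * v (.inr 4) ^ 2 + x * p * e * v (.inr 3) ^ 2) * (CharTwo.two_eq_zero : (2 : F) = 0)

theorem SevenIndep.not_gAnis_four {x p e b : F} (h7 : SevenIndep x p e) (hx : x ≠ 0) (he : e ≠ 0)
    (h : ¬ GAnis (1 : Polynomial F) (Polynomial.C (x * e * b))
      (fun i => (![Polynomial.C x, Polynomial.C e, Polynomial.C (x * e), Polynomial.C (x * p * e),
        Polynomial.C (p * e) + Polynomial.C (p * e ^ 2 / x) * Polynomial.X ^ 2] :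
          Fin 5 → Polynomial F) i)) :
    ¬ GAnis 1 (x * e * b) ![x, e, x * e, x * p * e] := by
  intro ha
  have two : (2 : F) = 0 := CharTwo.two_eq_zero
  simp only [GAnis, not_forall] at h
  obtain ⟨v, hv, hv0⟩ := h
  simp only [gq, Fin.sum_univ_five, Matrix.cons_val] at hv
  obtain ⟨w₀, w₁, h0, h1, hB⟩ := ha.represents (p * e) (p * e ^ 2 / x)
    (Sum.elim ![v (.inl 0), v (.inl 1)] ![v (.inr 0), v (.inr 1), v (.inr 2), v (.inr 3)])
    (v (.inr 4)) (by
      by_contra! hcon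
      refine hv0 (_root_.funext fun i => ?_)
      rcases i with i | i <;> fin_cases i
      exacts [congrFun hcon.1 (.inl 0), congrFun hcon.1 (.inl 1), congrFun hcon.1 (.inr 0),
        congrFun hcon.1 (.inr 1), congrFun hcon.1 (.inr 2), congrFun hcon.1 (.inr 3), hcon.2]) (by
      simp only [gq, Fin.sum_univ_four, Sum.elim_inl, Sum.elim_inr, Matrix.cons_val,
        Polynomial.C_1]
      linear_combination hv)
  have hs := sum_of_gq h0 h1 hB
  simp only [Fin.sum_univ_four, Matrix.cons_val] at hs
  obtain ⟨y, hy⟩ : ∃ y, e = x * y := ⟨e / x, by field_simp⟩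
  have hy0 : y ≠ 0 := by rintro rfl; simp at hy; exact he hy
  have hdiv : p * e ^ 2 / x = x * p * y ^ 2 := by rw [hy]; field_simp
  rw [hdiv] at hs
  obtain ⟨-, -, -, -, -, hd1, -⟩ := h7.eq_zero (r₀ := 0)
    (r₁ := w₁ (.inl 1) * w₀ (.inr 0) + w₀ (.inl 1) * w₁ (.inr 0))
    (r₂ := w₁ (.inl 1) * w₀ (.inr 1) + w₀ (.inl 1) * w₁ (.inr 1))
    (r₃ := w₁ (.inl 1) * w₀ (.inr 2) + w₀ (.inl 1) * w₁ (.inr 2))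
    (r₄ := w₁ (.inl 1) * w₀ (.inr 3) + w₀ (.inl 1) * w₁ (.inr 3)) (r₅ := w₁ (.inl 1))
    (r₆ := w₀ (.inl 1) * y) (by
      linear_combination hs + (w₁ (.inl 1) ^ 2 * (p * e) +
        w₀ (.inl 1) ^ 2 * (x * p * y ^ 2)) * two)
  obtain ⟨-, -, -, -, -, -, hd0⟩ := h7.eq_zero (r₀ := 0)
    (r₁ := w₁ (.inl 1) * w₀ (.inr 0) + w₀ (.inl 1) * w₁ (.inr 0))
    (r₂ := w₁ (.inl 1) * w₀ (.inr 1) + w₀ (.inl 1) * w₁ (.inr 1))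
    (r₃ := w₁ (.inl 1) * w₀ (.inr 2) + w₀ (.inl 1) * w₁ (.inr 2))
    (r₄ := w₁ (.inl 1) * w₀ (.inr 3) + w₀ (.inl 1) * w₁ (.inr 3)) (r₅ := w₁ (.inl 1))
    (r₆ := w₀ (.inl 1) * y) (by
      linear_combination hs + (w₁ (.inl 1) ^ 2 * (p * e) +
        w₀ (.inl 1) ^ 2 * (x * p * y ^ 2)) * two)
  have hd0 := (mul_eq_zero.1 hd0).resolve_right hy0
  simp only [gq, Fin.sum_univ_four, Matrix.cons_val] at h0
  rw [hd0] at h0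
  obtain ⟨-, -, -, -, -, hq, -⟩ := h7.eq_zero (r₀ := w₀ (.inl 0)) (r₁ := w₀ (.inr 0))
    (r₂ := w₀ (.inr 1)) (r₃ := w₀ (.inr 2)) (r₄ := w₀ (.inr 3)) (r₅ := 1) (r₆ := 0) (by
      linear_combination h0 + (p * e) * two)
  exact one_ne_zero hq

theorem decomposes_four_of_presents {φ : QuadraticForm F (Fin 5 → F)} {x e b p : F}
    (h7 : SevenIndep x p e) (hx : x ≠ 0) (he : e ≠ 0) (h : Presents φ (x * e) b ![1, p, e])
    {ψ : QuadraticForm F (Fin 4 → F)} (hψ : ψ.Anisotropic) (hg : DiagPresents ψ ![1, x, p, e])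
    (hi : ¬ (extendQF F (funFieldMap F ψ) φ).Anisotropic) : Decomposes φ ψ := by
  have h1 := not_gAnis_polynomial_polynomial hψ hi h hg
  let K := FractionRing (Polynomial F)
  have hinj : Function.Injective (algebraMap (Polynomial F) K) := IsFractionRing.injective _ _
  have : CharP K 2 := charP_of_injective_ringHom
    (f := (algebraMap (Polynomial F) K).comp Polynomial.C)
    (hinj.comp Polynomial.C_injective) 2
  let j : F → K := fun z => algebraMap (Polynomial F) K (Polynomial.C z)
  have h2 : ¬ GAnis (Polynomial.C (j x * j e)) (Polynomial.C (j b))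
      (Sum.elim (fun i => Polynomial.C ((![1, j p, j e] : Fin 3 → K) i))
        (fun i => (Polynomial.C (j x) + Polynomial.C (j p) * Polynomial.X ^ 2 +
          Polynomial.C (j e * (algebraMap (Polynomial F) K Polynomial.X) ^ 2)) *
            Polynomial.C ((![1, j p, j e] : Fin 3 → K) i))) := by
    intro H
    refine h1 (GAnis.of_injective (f := Polynomial.mapRingHom (algebraMap (Polynomial F) K))
      (Polynomial.map_injective _ hinj) (H.of_eq ?_ ?_ ?_))
    · simp [j]
    · simp [j]
    · rintro (i | i) <;> fin_cases i <;> simp [j]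
  have h3 := h7.fraction.not_gAnis (by simpa using hx) (by simpa using he) h2
  have h4 := h7.not_gAnis_four (b := b) hx he fun H => by
    have H' := H.fraction K
    refine h3 (H'.of_eq ?_ ?_ ?_)
    · exact (map_one _).symm
    · change j x * j e * j b = j (x * e * b)
      simp only [j, map_mul]
    · have hdiv : algebraMap (Polynomial F) K (Polynomial.C (p * e ^ 2 / x)) =
          j p * j e ^ 2 / j x := by
        rw [eq_div_iff (by simpa [j] using hx)]
        simp only [j, ← map_mul, ← map_pow, div_mul_cancel₀ _ hx]
      intro i
      fin_cases i
      · rfl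
      · rfl
      · change j x * j e = j (x * e)
        simp only [j, map_mul]
      · change j x * j p * j e = j (x * p * e)
        simp only [j, map_mul]
      · change j p * j e + j p * j e ^ 2 / j x * algebraMap (Polynomial F) K Polynomial.X ^ 2 =
          algebraMap (Polynomial F) K (Polynomial.C (p * e) +
            Polynomial.C (p * e ^ 2 / x) * Polynomial.X ^ 2)
        rw [map_add, map_mul (algebraMap (Polynomial F) K), hdiv]
        simp only [j, map_mul, map_pow]
  simp only [GAnis, not_forall] at h4
  obtain ⟨v, hv, hv0⟩ := h4
  simp only [gq, Fin.sum_univ_four, Matrix.cons_val] at hv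
  by_cases hD : v (.inl 1) = 0
  · rw [hD] at hv
    obtain ⟨h0, h1, h2, h3, h4, -, -⟩ := h7.eq_zero (r₀ := v (.inl 0)) (r₁ := v (.inr 0))
      (r₂ := v (.inr 1)) (r₃ := v (.inr 2)) (r₄ := v (.inr 3)) (r₅ := 0) (r₆ := 0)
      (by linear_combination hv)
    refine absurd (_root_.funext fun i => ?_) hv0
    rcases i with i | i <;> fin_cases i <;> assumption
  · refine decomposes_four hx he h hψ hg (h₀ := v (.inl 0) / v (.inl 1))
      (f := v (.inr 0) / v (.inl 1)) (g₀ := v (.inr 1) / v (.inl 1))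
      (g₁ := v (.inr 2) / v (.inl 1)) (g₂ := v (.inr 3) / v (.inl 1)) ?_
    field_simp
    linear_combination hv - (x * v (.inr 0) ^ 2 + e * v (.inr 1) ^ 2 + x * e * v (.inr 2) ^ 2 +
      x * p * e * v (.inr 3) ^ 2) * (CharTwo.two_eq_zero : (2 : F) = 0)

end Descent

section Forward

variable {F : Type} [Field F] [CharP F 2]

theorem decomposes_of_isotropic {φ : QuadraticForm F (Fin 5 → F)} (hφa : φ.Anisotropic)
    (hφt : HasTypeRS φ 1 3) (hφpn : ¬ IsPfisterNeighbour φ) {s : ℕ}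
    {ψ : QuadraticForm F (Fin s → F)} (hψa : ψ.Anisotropic) {c : Fin s → F}
    (hc : ψ.Equivalent (diagQF c)) (hcase : s = 3 ∨ (s = 4 ∧ normDegree F c = 8))
    (hi : ¬ (extendQF F (funFieldMap F ψ) φ).Anisotropic) : Decomposes φ ψ := by
  obtain ⟨a, b, c', hP⟩ := presents_of_hasTypeRS hφt
  obtain ⟨a, b, p, e, hP⟩ := hP.normalize hφa
  have hg := diagPresents_of_equivalent hc
  have key : ∀ {x p e b}, x ∉ biq p e → Presents φ (x * e) b ![1, p, e] →
      SevenIndep x p e ∧ x ≠ 0 ∧ e ≠ 0 := fun {x p e b} hx h => by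
    have h1 := (h.gAnis hφa).sqIndep
    have h7 := h1.seven hx
    exact ⟨h7, h7.ne_zero 1, h1.ne_zero 2⟩
  rcases hcase with rfl | ⟨rfl, hn⟩
  · rcases exists_presents_three hφa hφpn hP hψa hg
      (fun a b c h => triProperty_three hψa hi hg h) with h | ⟨x, p, e, b, hx, hP, hg⟩
    · exact decomposes_of_weaklyDominated hφt hψa hg (.inl rfl) h
    · obtain ⟨h7, hx0, he0⟩ := key hx hP
      exact decomposes_three_of_presents h7 hx0 he0 hP hψa hg hi
  · rcases exists_presents_four hφa hφpn hP hψa hc hn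
      (fun a b c h => triProperty_four hψa hi hg h) with h | ⟨x, p, e, b, hx, hP, hg⟩
    · exact decomposes_of_weaklyDominated hφt hψa hg (.inr rfl) h
    · obtain ⟨h7, hx0, he0⟩ := key hx hP
      exact decomposes_four_of_presents h7 hx0 he0 hP hψa hg hi

end Forward

section TotallyIsotropic

variable {K : Type} [Field K]

/-- The Witt index of an anisotropic form plus `k` hyperbolic planes is `k`. -/
theorem finrank_le_of_totallyIsotropic {V N : Type} [AddCommGroup V] [Module K V]
    [AddCommGroup N] [Module K N] [FiniteDimensional K N] {Q : QuadraticForm K V}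
    (hQ : Q.Anisotropic) {k : ℕ} (J : N →ₗ[K] V × (Fin k → Fin 2 → K))
    (hJ : Function.Injective J) (h : ∀ x, (Q.prod (hypQF K k)) (J x) = 0) :
    Module.finrank K N ≤ k := by
  have h' : ∀ x, Q (J x).1 + ∑ i, (J x).2 i 0 * (J x).2 i 1 = 0 := fun x => by
    have := h x
    rwa [QuadraticMap.prod_apply, hypQF_apply] at this
  let c (j : Fin 2) : N →ₗ[K] (Fin k → K) :=
    { toFun := fun x i => (J x).2 i j
      map_add' := fun x y => by funext i; simp
      map_smul' := fun t x => by funext i; simp }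
  have hfst : ∀ x, c 0 x = 0 → (J x).1 = 0 := fun x hx => hQ _ (by
    have e := h' x
    rwa [Finset.sum_eq_zero (fun i _ => by
      rw [show (J x).2 i 0 = 0 from congrFun hx i, zero_mul]), add_zero] at e)
  have horth : ∀ x y, c 0 x = 0 → ∑ i, c 0 y i * c 1 x i = 0 := fun x y hx => by
    have e1 := h' (y + x)
    have e2 := h' y
    have hx1 : ∀ i, (J x).2 i 0 = 0 := fun i => congrFun hx i
    simp only [map_add, Prod.fst_add, Prod.snd_add, hfst x hx, add_zero, Pi.add_apply, hx1,
      mul_add, Finset.sum_add_distrib] at e1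
    change ∑ i, (J y).2 i 0 * (J x).2 i 1 = 0
    linear_combination e1 - e2
  let B : LinearMap.BilinForm K (Fin k → K) := Matrix.toBilin' 1
  have hB : B.Nondegenerate := LinearMap.BilinForm.nondegenerate_toBilin'_of_det_ne_zero' _ (by simp)
  have hBa : ∀ v w, B v w = ∑ i, v i * w i := fun v w => by
    simp [B, Matrix.toBilin'_apply', dotProduct]
  have hle : (LinearMap.ker (c 0)).map (c 1) ≤ B.orthogonal (LinearMap.range (c 0)) := by
    rintro _ ⟨x, hx, rfl⟩ _ ⟨y, rfl⟩
    change B _ _ = 0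
    rw [hBa]
    exact horth x y hx
  have h1 := Submodule.finrank_mono hle
  rw [LinearMap.BilinForm.finrank_orthogonal hB] at h1
  have hinj : Function.Injective ((c 1).domRestrict (LinearMap.ker (c 0))) := by
    rw [← LinearMap.ker_eq_bot, LinearMap.ker_eq_bot']
    rintro ⟨x, hx⟩ hx1
    refine Subtype.ext (hJ ?_)
    rw [Submodule.coe_zero, map_zero]
    refine Prod.ext (hfst x hx) ?_
    funext i j
    fin_cases j
    · exact congrFun hx i
    · exact congrFun hx1 i
  have h2 := LinearMap.finrank_range_of_inj hinj
  rw [LinearMap.range_domRestrict] at h2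
  have h3 := (c 0).finrank_range_add_finrank_ker
  have h4 := Submodule.finrank_le (LinearMap.range (c 0))
  simp only [Module.finrank_fin_fun] at h1 h4
  omega

/-- The norm form `[1,d]` of the quadratic algebra generated by `i` with `i² = i - d`. -/
def nrm (d : K) (u : Fin 2 → K) : K := u 0 ^ 2 + u 0 * u 1 + d * u 1 ^ 2

/-- Left multiplication by `u` in the quadratic algebra with norm `nrm d`. -/
def cmul (d : K) (u : Fin 2 → K) : (Fin 2 → K) →ₗ[K] (Fin 2 → K) where
  toFun v := ![u 0 * v 0 - d * u 1 * v 1, u 0 * v 1 + u 1 * v 0 + u 1 * v 1]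
  map_add' v w := by funext i; fin_cases i <;> simp <;> ring
  map_smul' t v := by funext i; fin_cases i <;> simp <;> ring

/-- Conjugation in the quadratic algebra with norm `nrm d`. -/
def cconj : (Fin 2 → K) →ₗ[K] (Fin 2 → K) where
  toFun v := ![v 0 + v 1, - v 1]
  map_add' v w := by funext i; fin_cases i <;> simp <;> ring
  map_smul' t v := by funext i; fin_cases i <;> simp <;> ring

theorem nrm_smul (d t : K) (u : Fin 2 → K) : nrm d (t • u) = t ^ 2 * nrm d u := by
  simp [nrm]; ring

theorem nrm_cmul (d : K) (u v : Fin 2 → K) : nrm d (cmul d u v) = nrm d u * nrm d v := by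
  simp [nrm, cmul]; ring

theorem nrm_cconj (d : K) (u : Fin 2 → K) : nrm d (cconj u) = nrm d u := by
  simp [nrm, cconj]; ring

/-- Multiplicativity of the quaternion norm. -/
theorem nrm_quaternion (d a : K) (h₀ h₁ u v : Fin 2 → K) :
    nrm d (cmul d h₀ u - a • cmul d h₁ (cconj v)) + a * nrm d (cmul d h₀ v + cmul d h₁ (cconj u)) =
      (nrm d h₀ + a * nrm d h₁) * (nrm d u + a * nrm d v) := by
  simp [nrm, cmul, cconj]; ring

theorem pfisterQF_nrm (p : Fin 2 → K) (d : K) (x₀ x₁ x₂ x₃ : Fin 2 → K) :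
    pfisterQF 2 p d (subsetVec x₀ x₁ x₂ x₃) =
      nrm d x₀ + p 0 * nrm d x₁ + p 1 * (nrm d x₂ + p 0 * nrm d x₃) := by
  rw [pfisterQF_subsetVec]; simp only [nrm]; ring

variable [CharP K 2]

/-- An isotropic `3`-fold Pfister form has a totally isotropic subspace of dimension `4`. -/
theorem exists_totallyIsotropic_pfisterQF {p : Fin 2 → K} {d : K}
    {v : Finset (Fin 2) → Fin 2 → K} (hv0 : v ≠ 0) (hv : pfisterQF 2 p d v = 0) :
    ∃ J : (Fin 4 → K) →ₗ[K] (Finset (Fin 2) → Fin 2 → K), Function.Injective J ∧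
      ∀ u, pfisterQF 2 p d (J u) = 0 := by
  let π (i : Fin 4) : (Fin 4 → K) →ₗ[K] K := LinearMap.proj (φ := fun _ => K) i
  let g := pairMap (π 0) (π 1)
  let h := pairMap (π 2) (π 3)
  have hgh : ∀ u, g u = 0 → h u = 0 → u = 0 := fun u h1 h2 => by
    funext i
    fin_cases i
    exacts [congrFun h1 0, congrFun h1 1, congrFun h2 0, congrFun h2 1]
  by_cases h1 : ∃ u, u ≠ 0 ∧ nrm d u = 0
  · obtain ⟨u, hu0, hu⟩ := h1
    refine ⟨subsetMap ((π 0).smulRight u) ((π 1).smulRight u) ((π 2).smulRight u)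
      ((π 3).smulRight u), ?_, fun w => ?_⟩
    · rw [← LinearMap.ker_eq_bot, LinearMap.ker_eq_bot']
      intro w hw
      obtain ⟨e0, e1, e2, e3⟩ := subsetVec_eq_zero hw
      funext i
      fin_cases i
      exacts [(smul_eq_zero.1 e0).resolve_right hu0, (smul_eq_zero.1 e1).resolve_right hu0,
        (smul_eq_zero.1 e2).resolve_right hu0, (smul_eq_zero.1 e3).resolve_right hu0]
    · refine (pfisterQF_nrm _ _ _ _ _ _).trans ?_
      simp [nrm_smul, hu]
  push Not at h1
  by_cases h2 : ∃ x y, (x ≠ 0 ∨ y ≠ 0) ∧ nrm d x + p 0 * nrm d y = 0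
  · obtain ⟨x, y, hxy, he⟩ := h2
    have hs : nrm d y ≠ 0 := fun hs => by
      have hy : y = 0 := by_contra fun hy => h1 y hy hs
      have hx : x = 0 := by_contra fun hx => h1 x hx (by rw [hs] at he; simpa using he)
      tauto
    let L := cmul d (cmul d x (cconj y))
    refine ⟨subsetMap (L ∘ₗ g) (nrm d y • g) (L ∘ₗ h) (nrm d y • h), ?_, fun w => ?_⟩
    · rw [← LinearMap.ker_eq_bot, LinearMap.ker_eq_bot']
      intro w hw
      obtain ⟨e0, e1, e2, e3⟩ := subsetVec_eq_zero hw
      exact hgh w ((smul_eq_zero.1 e1).resolve_left hs) ((smul_eq_zero.1 e3).resolve_left hs)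
    · refine (pfisterQF_nrm _ _ _ _ _ _).trans ?_
      simp only [LinearMap.comp_apply, L, nrm_cmul, nrm_cconj, LinearMap.smul_apply, nrm_smul]
      linear_combination (nrm d y * (nrm d (g w) + p 1 * nrm d (h w))) * he
  push Not at h2
  have hvs := exists_subsetVec v
  rw [hvs, pfisterQF_nrm] at hv
  generalize v ∅ = x₀ at hv hvs
  generalize v {0} = x₁ at hv hvs
  generalize v {1} = x₂ at hv hvs
  generalize v {0, 1} = x₃ at hv hvs
  have hs : nrm d x₂ + p 0 * nrm d x₃ ≠ 0 := fun hs => by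
    rw [hs, mul_zero, add_zero] at hv
    have e2 : x₂ = 0 := by_contra fun h => h2 x₂ x₃ (.inl h) hs
    have e3 : x₃ = 0 := by_contra fun h => h2 x₂ x₃ (.inr h) hs
    have e0 : x₀ = 0 := by_contra fun h => h2 x₀ x₁ (.inl h) hv
    have e1 : x₁ = 0 := by_contra fun h => h2 x₀ x₁ (.inr h) hv
    refine hv0 ?_
    rw [hvs, e0, e1, e2, e3]
    simpa using subsetVec_smul (0 : K) 0 0 0 0
  let h₀ := cmul d x₀ (cconj x₂) - p 0 • cmul d x₁ (cconj (-x₃))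
  let h₁ := cmul d x₀ (-x₃) + cmul d x₁ (cconj (cconj x₂))
  have hn : nrm d h₀ + p 0 * nrm d h₁ =
      (nrm d x₀ + p 0 * nrm d x₁) * (nrm d x₂ + p 0 * nrm d x₃) := by
    have e : nrm d (-x₃) = nrm d x₃ := by simp [nrm]
    rw [← e, ← nrm_cconj d x₂]
    exact nrm_quaternion d (p 0) x₀ x₁ (cconj x₂) (-x₃)
  refine ⟨subsetMap (cmul d h₀ ∘ₗ g - p 0 • (cmul d h₁ ∘ₗ cconj ∘ₗ h))
    (cmul d h₀ ∘ₗ h + cmul d h₁ ∘ₗ cconj ∘ₗ g) ((nrm d x₂ + p 0 * nrm d x₃) • g)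
    ((nrm d x₂ + p 0 * nrm d x₃) • h), ?_, fun w => ?_⟩
  · rw [← LinearMap.ker_eq_bot, LinearMap.ker_eq_bot']
    intro w hw
    obtain ⟨e0, e1, e2, e3⟩ := subsetVec_eq_zero hw
    exact hgh w ((smul_eq_zero.1 e2).resolve_left hs) ((smul_eq_zero.1 e3).resolve_left hs)
  · refine (pfisterQF_nrm _ _ _ _ _ _).trans ?_
    have e := nrm_quaternion d (p 0) h₀ h₁ (g w) (h w)
    simp only [LinearMap.comp_apply, LinearMap.smul_apply, LinearMap.sub_apply,
      LinearMap.add_apply, nrm_smul]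
    rw [hn] at e
    linear_combination e + (nrm d x₂ + p 0 * nrm d x₃) *
      (nrm d (g w) + p 0 * nrm d (h w)) * hv

end TotallyIsotropic

section ScalarExtension

variable {F : Type} [Field F] {K : Type} [Field K] (f : F →+* K)

theorem quadraticMap_extendLin {ι κ : Type} [Fintype ι] [DecidableEq ι] [Fintype κ]
    [DecidableEq κ] (T : (ι → F) →ₗ[F] (κ → F)) {Q₁ : QuadraticForm K (ι → K)}
    {Q₂ : QuadraticForm K (κ → K)}
    (h : ∀ v : ι → F, Q₁ (fun i => f (v i)) = Q₂ (fun i => f (T v i))) (w : ι → K) :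
    Q₂ (extendLin f T w) = Q₁ w := by
  have hf : ∀ i : ι, (Pi.single i 1 : ι → K) = fun j => f ((Pi.single i 1 : ι → F) j) := by
    intro i; funext j
    by_cases hj : j = i
    · subst hj; simp
    · simp [hj]
  have hK : ∀ v : ι → F, (Q₂.comp (extendLin f T)) (fun i => f (v i)) =
      Q₁ (fun i => f (v i)) := by
    intro v
    rw [QuadraticMap.comp_apply, extendLin_map, h]
  have : Q₂.comp (extendLin f T) = Q₁ := by
    refine quadraticForm_ext (fun i => ?_) fun i j => ?_
    · rw [hf, hK]
    · have : (Pi.single i 1 + Pi.single j 1 : ι → K) =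
          fun k => f ((Pi.single i 1 + Pi.single j 1 : ι → F) k) := by
        rw [hf i, hf j]; funext k; simp
      rw [this, hK]
  rw [← this]; rfl

theorem extendLin_injective {ι κ : Type} [Fintype ι] [DecidableEq ι] [Fintype κ]
    [DecidableEq κ] {T : (ι → F) →ₗ[F] (κ → F)} (hT : Function.Injective T) :
    Function.Injective (extendLin f T) := by
  obtain ⟨S, hS⟩ := T.exists_leftInverse_of_injective (LinearMap.ker_eq_bot.2 hT)
  refine Function.LeftInverse.injective (g := extendLin f S) fun w => ?_
  rw [extendLin, extendLin, ← LinearMap.comp_apply, ← Matrix.toLin'_mul, ← Matrix.map_mul,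
    ← LinearMap.toMatrix'_comp, hS]
  simp

theorem pfisterQF_map (p : Fin 2 → F) (d : F) (v : Finset (Fin 2) → Fin 2 → F) :
    pfisterQF 2 (fun i => f (p i)) (f d) (fun S i => f (v S i)) = f (pfisterQF 2 p d v) := by
  simp only [pfisterQF_two_apply, map_add, map_mul, map_pow]

theorem hypQF_map {k : ℕ} (v : Fin k → Fin 2 → F) :
    hypQF K k (fun S i => f (v S i)) = f (hypQF F k v) := by
  simp only [hypQF_apply, map_sum, map_mul]

/-- Coordinates on `(α → R) × (β → γ → R)`. -/
def flattenProd (R α β γ : Type) [CommRing R] :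
    (α ⊕ β × γ → R) ≃ₗ[R] (α → R) × (β → γ → R) where
  toFun v := (fun i => v (.inl i), fun i j => v (.inr (i, j)))
  invFun w := Sum.elim w.1 fun x => w.2 x.1 x.2
  map_add' _ _ := rfl
  map_smul' _ _ := rfl
  left_inv v := by funext i; rcases i with i | i <;> rfl
  right_inv _ := rfl

/-- Coordinates on `((α → R) × (β → γ → R)) × (δ → ε → R)`. -/
def flattenProd₂ (R α β γ δ ε : Type) [CommRing R] :
    ((α ⊕ β × γ) ⊕ δ × ε → R) ≃ₗ[R] ((α → R) × (β → γ → R)) × (δ → ε → R) where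
  toFun v := ((fun i => v (.inl (.inl i)), fun i j => v (.inl (.inr (i, j)))),
    fun i j => v (.inr (i, j)))
  invFun w := Sum.elim (Sum.elim w.1.1 fun x => w.1.2 x.1 x.2) fun x => w.2 x.1 x.2
  map_add' _ _ := rfl
  map_smul' _ _ := rfl
  left_inv v := by funext i; rcases i with (i | i) | i <;> rfl
  right_inv _ := rfl

/-- Coordinates on `β → γ → R`. -/
def flattenPi (R β γ : Type) [CommRing R] : (β × γ → R) ≃ₗ[R] (β → γ → R) where
  toFun v := fun i j => v (i, j)
  invFun w := fun x => w x.1 x.2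
  map_add' _ _ := rfl
  map_smul' _ _ := rfl
  left_inv _ := rfl
  right_inv _ := rfl

theorem exists_isotropic_of_weaklyDominated {s n : ℕ} {ψ : QuadraticForm F (Fin s → F)}
    {φ : QuadraticForm F (Fin n → F)} (h : WeaklyDominated ψ φ) {w : Fin s → K} (hw0 : w ≠ 0)
    (hw : extendQF F f ψ w = 0) : ∃ x, x ≠ 0 ∧ extendQF F f φ x = 0 := by
  obtain ⟨α, T, hT, e⟩ := h
  refine ⟨extendLin f T w, (map_ne_zero_iff _ (extendLin_injective f hT)).2 hw0, ?_⟩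
  rw [quadraticMap_extendLin f T (Q₁ := f α • extendQF F f ψ), _root_.smul_apply, hw, smul_zero]
  intro v
  rw [_root_.smul_apply, extendQF_map, extendQF_map, ← e, _root_.smul_apply, smul_eq_mul, smul_eq_mul,
    map_mul]

theorem exists_isotropic_pfisterQF_of_weaklyDominated {s : ℕ} {ψ : QuadraticForm F (Fin s → F)}
    {γ : F} (hγ : γ ≠ 0) {p : Fin 2 → F} {d : F} (h : WeaklyDominated ψ (γ • pfisterQF 2 p d))
    {w : Fin s → K} (hw0 : w ≠ 0) (hw : extendQF F f ψ w = 0) :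
    ∃ x, x ≠ 0 ∧ pfisterQF 2 (fun i => f (p i)) (f d) x = 0 := by
  obtain ⟨α, T, hT, e⟩ := h
  let T' := (flattenPi F (Finset (Fin 2)) (Fin 2)).symm.toLinearMap ∘ₗ T
  have hT' : Function.Injective T' := (flattenPi F (Finset (Fin 2)) (Fin 2)).symm.injective.comp hT
  refine ⟨flattenPi K (Finset (Fin 2)) (Fin 2) (extendLin f T' w), ?_, ?_⟩
  · rw [LinearEquiv.map_ne_zero_iff]
    exact (map_ne_zero_iff _ (extendLin_injective f hT')).2 hw0
  have := quadraticMap_extendLin f T' (Q₁ := f α • extendQF F f ψ)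
    (Q₂ := f γ • (pfisterQF 2 (fun i => f (p i)) (f d)).comp
      (flattenPi K (Finset (Fin 2)) (Fin 2)).toLinearMap) (fun v => ?_) w
  · rw [_root_.smul_apply, _root_.smul_apply, hw, smul_zero] at this
    exact (smul_eq_zero.1 this).resolve_left ((map_ne_zero f).2 hγ)
  · have e' := congrArg f (e v)
    simp only [_root_.smul_apply, smul_eq_mul, map_mul] at e'
    rw [_root_.smul_apply, extendQF_map, smul_eq_mul, e', ← pfisterQF_map]
    rfl

variable [CharP K 2]

theorem not_anisotropic_of_decomposes {s : ℕ} {φ : QuadraticForm F (Fin 5 → F)}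
    {ψ : QuadraticForm F (Fin s → F)} (h : Decomposes φ ψ) {w : Fin s → K} (hw0 : w ≠ 0)
    (hw : extendQF F f ψ w = 0) : ¬(extendQF F f φ).Anisotropic := by
  intro ha
  obtain ⟨φ', γ, p, cc, -, ⟨k, l, ⟨E⟩⟩, h1, h2⟩ := h
  obtain ⟨x, hx0, hx⟩ := exists_isotropic_of_weaklyDominated f h1 hw0 hw
  obtain ⟨y, hy0, hy⟩ := exists_isotropic_pfisterQF_of_weaklyDominated f γ.ne_zero h2 hw0 hw
  obtain ⟨J, hJ, hJ0⟩ := exists_totallyIsotropic_pfisterQF hy0 hy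
  have hdim := E.toLinearEquiv.finrank_eq
  simp only [Module.finrank_prod, Module.finrank_pi_fintype, Module.finrank_self,
    Finset.sum_const, Finset.card_univ, Fintype.card_fin, Fintype.card_finset, smul_eq_mul] at hdim
  let e₁ (R : Type) [CommRing R] := flattenProd R (Fin 5) (Fin k) (Fin 2)
  let e₂ (R : Type) [CommRing R] := flattenProd₂ R (Fin 5) (Finset (Fin 2)) (Fin 2) (Fin l) (Fin 2)
  let T := (e₁ F).symm.toLinearMap ∘ₗ E.toLinearEquiv.symm.toLinearMap ∘ₗ (e₂ F).toLinearMap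
  have hT : Function.Injective T :=
    (e₁ F).symm.injective.comp (E.toLinearEquiv.symm.injective.comp (e₂ F).injective)
  have hform := quadraticMap_extendLin f T
    (Q₁ := (((extendQF F f φ').prod (f γ • pfisterQF 2 (fun i => f (p i)) (f cc))).prod
      (hypQF K l)).comp (e₂ K).toLinearMap)
    (Q₂ := ((extendQF F f φ).prod (hypQF K k)).comp (e₁ K).toLinearMap) (fun v => by
      have e := congrArg f (E.map_app (E.toLinearEquiv.symm (e₂ F v)))
      rw [show E (E.toLinearEquiv.symm (e₂ F v)) = e₂ F v from
        E.toLinearEquiv.apply_symm_apply _] at e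
      simp only [QuadraticMap.prod_apply, map_add, _root_.smul_apply, smul_eq_mul, map_mul,
        ← extendQF_map, ← hypQF_map, ← pfisterQF_map] at e
      exact e)
  let I : ((Fin 4 → K) × K × (Fin l → K)) →ₗ[K]
      ((Fin 5 → K) × (Finset (Fin 2) → Fin 2 → K)) × (Fin l → Fin 2 → K) :=
    { toFun := fun z => ((z.2.1 • x, J z.1), fun i => ![z.2.2 i, 0])
      map_add' := fun a b => by
        refine Prod.ext (Prod.ext (add_smul _ _ _) (map_add J _ _)) ?_
        funext i j; fin_cases j <;> simp
      map_smul' := fun t a => by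
        refine Prod.ext (Prod.ext (mul_smul _ _ _) (map_smul J _ _)) ?_
        funext i j; fin_cases j <;> simp }
  have hI : Function.Injective I := by
    rw [← LinearMap.ker_eq_bot, LinearMap.ker_eq_bot']
    rintro ⟨a, t, b⟩ hz
    have h1 : t • x = 0 := congrArg (fun z => z.1.1) hz
    have h2 : J a = 0 := congrArg (fun z => z.1.2) hz
    have h3 : (fun i => ![b i, 0]) = (0 : Fin l → Fin 2 → K) := congrArg (fun z => z.2) hz
    refine Prod.ext ((map_eq_zero_iff J hJ).1 h2)
      (Prod.ext ((smul_eq_zero.1 h1).resolve_right hx0) ?_)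
    funext i
    exact congrFun (congrFun h3 i) 0
  have hle := finrank_le_of_totallyIsotropic ha
    ((e₁ K).toLinearMap ∘ₗ extendLin f T ∘ₗ (e₂ K).symm.toLinearMap ∘ₗ I)
    ((e₁ K).injective.comp ((extendLin_injective f hT).comp ((e₂ K).symm.injective.comp hI)))
    (fun z => by
      have e := hform ((e₂ K).symm (I z))
      rw [QuadraticMap.comp_apply, QuadraticMap.comp_apply] at e
      refine e.trans ?_
      rw [LinearEquiv.coe_coe, LinearEquiv.apply_symm_apply, QuadraticMap.prod_apply,
        QuadraticMap.prod_apply, hypQF_apply]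
      simp only [I, LinearMap.coe_mk, AddHom.coe_mk, _root_.smul_apply, hJ0, QuadraticMap.map_smul,
        hx]
      simp)
  simp only [Module.finrank_prod, Module.finrank_fin_fun, Module.finrank_self] at hle
  omega

end ScalarExtension

section Backward

variable {F : Type} [Field F]

theorem not_qfPoly_dvd_X {n : ℕ} (ψ : QuadraticForm F (Fin n → F)) (i₀ : Fin n) :
    ¬ qfPoly F ψ ∣ X i₀ := by
  intro hd
  let ρ : MvPolynomial (Fin n) F →ₐ[F] Polynomial F :=
    aeval fun i => if i = i₀ then Polynomial.X else 0
  have h1 : ρ (X i₀) = Polynomial.X := by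
    change aeval _ _ = _
    rw [aeval_X, if_pos rfl]
  have h2 : Polynomial.X ^ 2 ∣ ρ (qfPoly F ψ) := by
    rw [qfPoly, map_sum]
    refine Finset.dvd_sum fun i _ => ?_
    rw [map_sum]
    refine Finset.dvd_sum fun j _ => ?_
    rw [map_mul, map_mul, _root_.sq]
    refine Dvd.dvd.mul_left (mul_dvd_mul ?_ ?_) _ <;>
    · change _ ∣ aeval _ _
      rw [aeval_X]
      split_ifs
      · exact dvd_rfl
      · exact dvd_zero _
  have h3 := h2.trans (map_dvd ρ hd)
  rw [h1, Polynomial.X_pow_dvd_iff] at h3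
  simpa using h3 1 one_lt_two

/-- The quotient map from the polynomial ring to the coordinate ring of a quadric. -/
noncomputable def funFieldRingMk {n : ℕ} (ψ : QuadraticForm F (Fin n → F)) :
    MvPolynomial (Fin n) F →+* FunFieldRing F ψ :=
  Ideal.Quotient.mk (Ideal.span {qfPoly F ψ})

theorem funFieldRingMk_eq_zero {n : ℕ} {ψ : QuadraticForm F (Fin n → F)}
    {x : MvPolynomial (Fin n) F} : funFieldRingMk ψ x = 0 ↔ qfPoly F ψ ∣ x :=
  Ideal.Quotient.eq_zero_iff_mem.trans Ideal.mem_span_singleton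

theorem sum_coeffMat_mul_funFieldRingMk {n : ℕ} (ψ : QuadraticForm F (Fin n → F)) :
    ∑ i, ∑ j, algebraMap F (FunFieldRing F ψ) (coeffMat F ψ i j) *
      (funFieldRingMk ψ (X i) * funFieldRingMk ψ (X j)) = 0 := by
  have h : funFieldRingMk ψ (qfPoly F ψ) = 0 := funFieldRingMk_eq_zero.2 dvd_rfl
  rw [qfPoly] at h
  simp only [map_sum, map_mul] at h
  exact h

theorem funField_isField {n : ℕ} {ψ : QuadraticForm F (Fin n → F)} [IsDomain (FunFieldRing F ψ)] :
    IsField (FunField F ψ) :=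
  Field.toIsField (FractionRing (FunFieldRing F ψ))

theorem exists_isotropic_funField {n : ℕ} (ψ : QuadraticForm F (Fin n → F)) (hn : n ≠ 0) :
    ∃ w, w ≠ 0 ∧ extendQF F (funFieldMap F ψ) ψ w = 0 := by
  have : NeZero n := ⟨hn⟩
  let ι : FunFieldRing F ψ →+* FunField F ψ := algebraMap _ _
  have hι : Function.Injective ι := IsFractionRing.injective (FunFieldRing F ψ)
    (FractionRing (FunFieldRing F ψ))
  refine ⟨fun i => ι (funFieldRingMk ψ (X i)), fun h => ?_, ?_⟩
  · have h0 : funFieldRingMk ψ (X 0) = 0 := hι ((congrFun h 0).trans (map_zero ι).symm)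
    exact not_qfPoly_dvd_X ψ 0 (funFieldRingMk_eq_zero.1 h0)
  · have h := congrArg ι (sum_coeffMat_mul_funFieldRingMk ψ)
    rw [extendQF_apply]
    simp only [map_sum, map_mul, map_zero] at h
    exact h

theorem not_anisotropic_of_isField {K : Type} [CommRing K] (hK : IsField K) [CharP F 2] (f : F →+* K)
    {s : ℕ} {φ : QuadraticForm F (Fin 5 → F)} {ψ : QuadraticForm F (Fin s → F)}
    (h : Decomposes φ ψ) {w : Fin s → K} (hw0 : w ≠ 0) (hw : extendQF F f ψ w = 0) :
    ¬(extendQF F f φ).Anisotropic := by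
  let _ := hK.toField
  have : CharP K 2 := charP_of_injective_ringHom f.injective 2
  exact not_anisotropic_of_decomposes (K := K) f h hw0 hw

theorem not_anisotropic_funField_of_decomposes [CharP F 2] {s : ℕ}
    {φ : QuadraticForm F (Fin 5 → F)} {ψ : QuadraticForm F (Fin s → F)} (hψa : ψ.Anisotropic)
    {c : Fin s → F} (hc : ψ.Equivalent (diagQF c)) (hs : 2 ≤ s) (h : Decomposes φ ψ) :
    ¬ (extendQF F (funFieldMap F ψ) φ).Anisotropic := by
  obtain ⟨n, rfl⟩ : ∃ n, s = n + 1 := ⟨s - 1, by omega⟩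
  have hg := diagPresents_of_equivalent hc
  have hi := hg.sqIndep hψa
  obtain ⟨σ, -⟩ := exists_funFieldRing_equiv hg (hi.ne_zero 0)
  have : IsDomain (AdjoinRoot (quadricPoly c)) :=
    AdjoinRoot.isDomain_of_prime (quadricPoly_prime hi (by omega))
  have : IsDomain (FunFieldRing F ψ) := MulEquiv.isDomain _ σ.toMulEquiv
  obtain ⟨w, hw0, hw⟩ := exists_isotropic_funField ψ (by omega)
  exact not_anisotropic_of_isField funField_isField _ h hw0 hw

end Backward

theorem stmt8 (F : Type) [Field F] [CharP F 2]
    (φ : QuadraticForm F (Fin 5 → F)) (hφa : φ.Anisotropic) (hφt : HasTypeRS φ 1 3)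
    (hφpn : ¬ IsPfisterNeighbour φ)
    (s : ℕ) (ψ : QuadraticForm F (Fin s → F)) (hψa : ψ.Anisotropic)
    (c : Fin s → F) (hc : ψ.Equivalent (diagQF c))
    (hcase : s = 3 ∨ (s = 4 ∧ normDegree F c = 8)) :
    (¬ (extendQF F (funFieldMap F ψ) φ).Anisotropic ↔
      ∃ (φ' : QuadraticForm F (Fin 5 → F)) (γ : Fˣ) (p : Fin 2 → Fˣ) (cc : F),
        HasTypeRS φ' 1 3 ∧
        WittEquiv φ (φ'.prod ((γ : F) • pfisterQF 2 (fun i => (p i : F)) cc)) ∧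
        WeaklyDominated ψ φ' ∧
        WeaklyDominated ψ ((γ : F) • pfisterQF 2 (fun i => (p i : F)) cc)) :=
  ⟨decomposes_of_isotropic hφa hφt hφpn hψa hc hcase, fun h =>
    not_anisotropic_funField_of_decomposes hψa hc (by omega) h⟩
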